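/- Let (V, V₊, v) be a complete order unit space with open cone C := V₊°. Then there exists a JB-algebra structure on V with unit element v and cone of squares V₊ if and only if there exists a gauge-reversing bijection Φ: C → C. -/

import Mathlib

open scoped Topology

section Defs

/-- `(V, P, v)` is an order unit space: `P` is a proper cone, the induced order is
archimedean, `v` is an order unit, and the norm of `V` is the order unit norm. -/
structure IsOrderUnitSpace (V : Type*) [NormedAddCommGroup V] [NormedSpace ℝ V]
    (P : Set V) (v : V) : Prop where
  add_mem : ∀ x ∈ P, ∀ y ∈ P, x + y ∈ P
  smul_mem : ∀ r : ℝ, 0 ≤ r → ∀ x ∈ P, r • x ∈ P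
  proper : ∀ x : V, x ∈ P → -x ∈ P → x = 0
  archimedean : ∀ x b : V, (∀ r : ℝ, 0 ≤ r → b - r • x ∈ P) → -x ∈ P
  unit_mem : v ∈ P
  unit_order : ∀ x : V, ∃ r : ℝ, 0 < r ∧ r • v - x ∈ P
  norm_eq : ∀ x : V, ‖x‖ = sInf {r : ℝ | 0 ≤ r ∧ x + r • v ∈ P ∧ r • v - x ∈ P}

variable {V : Type*} [NormedAddCommGroup V] [NormedSpace ℝ V]
variable {W : Type*} [NormedAddCommGroup W] [NormedSpace ℝ W]

/-- The open cone (norm interior of the cone `P`) of an order unit space. -/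
def openCone (P : Set V) (v : V) : Set V := {x | ∃ ε : ℝ, 0 < ε ∧ x - ε • v ∈ P}

/-- The order unit norm `‖x‖_u` determined by an order unit `u`. -/
noncomputable def ounorm (P : Set V) (u x : V) : ℝ :=
  sInf {r : ℝ | 0 ≤ r ∧ x + r • u ∈ P ∧ r • u - x ∈ P}

/-- Thompson's metric `d_T(x,y) = log inf {r ≥ 1 : r⁻¹ y ≤ x ≤ r y}`. -/
noncomputable def thompsonDist (P : Set V) (x y : V) : ℝ :=
  Real.log (sInf {r : ℝ | 1 ≤ r ∧ x - r⁻¹ • y ∈ P ∧ r • y - x ∈ P})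

/-- `Φ` is a gauge-reversing bijection from the open cone of `(V, P, v)` onto the
open cone of `(W, Q, w)`: a bijection, homogeneous of degree `-1`,
and an order-anti-isomorphism. -/
def GaugeReversing (P : Set V) (v : V) (Q : Set W) (w : W) (Φ : V → W) : Prop :=
  Set.BijOn Φ (openCone P v) (openCone Q w) ∧
  (∀ x ∈ openCone P v, ∀ r : ℝ, 0 < r → Φ (r • x) = r⁻¹ • Φ x) ∧
  (∀ x ∈ openCone P v, ∀ y ∈ openCone P v, (y - x ∈ P ↔ Φ x - Φ y ∈ Q))

/-- `Φ` is a gauge-preserving bijection from the open cone of `(V, P, v)` onto the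
open cone of `(W, Q, w)`: a bijection, homogeneous of degree `1`,
and an order-isomorphism. -/
def GaugePreserving (P : Set V) (v : V) (Q : Set W) (w : W) (Φ : V → W) : Prop :=
  Set.BijOn Φ (openCone P v) (openCone Q w) ∧
  (∀ x ∈ openCone P v, ∀ r : ℝ, 0 < r → Φ (r • x) = r • Φ x) ∧
  (∀ x ∈ openCone P v, ∀ y ∈ openCone P v, (y - x ∈ P ↔ Φ y - Φ x ∈ Q))

/-- `mul` is a JB-algebra structure on the order unit space `(V, P, v)` with unit
element `v` and cone of squares `P`. -/
def IsJBAlgebraStructure (P : Set V) (v : V) (mul : V →ₗ[ℝ] V →ₗ[ℝ] V) : Prop :=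
  (∀ x y : V, mul x y = mul y x) ∧
  (∀ x : V, mul v x = x) ∧
  (∀ x y : V, mul x (mul y (mul x x)) = mul (mul x y) (mul x x)) ∧
  (∀ x y : V, ‖mul x y‖ ≤ ‖x‖ * ‖y‖) ∧
  (∀ x : V, ‖mul x x‖ = ‖x‖ ^ 2) ∧
  (∀ x y : V, ‖mul x x‖ ≤ ‖mul x x + mul y y‖) ∧
  P = {y : V | ∃ x : V, mul x x = y}

/-- `S` is a `d_T`-symmetry of the open cone of `(V, P, v)` at the point `p`:
an involutive `d_T`-isometry of the open cone having `p` as an isolated fixed point. -/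
def IsDTSymmetry (P : Set V) (v : V) (S : V → V) (p : V) : Prop :=
  (∀ x ∈ openCone P v, S x ∈ openCone P v) ∧
  (∀ x ∈ openCone P v, S (S x) = x) ∧
  (∀ x ∈ openCone P v, ∀ y ∈ openCone P v,
    thompsonDist P (S x) (S y) = thompsonDist P x y) ∧
  p ∈ openCone P v ∧ S p = p ∧
  (∃ ε : ℝ, 0 < ε ∧ ∀ x ∈ openCone P v, S x = x → thompsonDist P p x < ε → x = p)

/-- A complete order unit space `(W, Q, w)` together with a gauge-reversing bijection
from the open cone of `(V, P, v)` onto the open cone of `(W, Q, w)`. -/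
structure GaugeReversingTarget (V : Type*) [NormedAddCommGroup V] [NormedSpace ℝ V]
    (P : Set V) (v : V) where
  W : Type
  [instGroup : NormedAddCommGroup W]
  [instSpace : NormedSpace ℝ W]
  [instComplete : CompleteSpace W]
  Q : Set W
  w : W
  ous : IsOrderUnitSpace W Q w
  Φ : V → W
  grev : GaugeReversing P v Q w Φ

/-- The state space of the order unit space `(V, P, v)`, as a subset of the
weak-* dual of `V`. -/
def stateSpace (P : Set V) (v : V) : Set (WeakDual ℝ V) :=
  {ρ | (∀ x ∈ P, 0 ≤ ρ x) ∧ ρ v = 1}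

/-- A real-valued function on the dual is affine on `K`. -/
def AffineOnK (K : Set (WeakDual ℝ V)) (g : WeakDual ℝ V → ℝ) : Prop :=
  ∀ ρ ∈ K, ∀ σ ∈ K, ∀ t : ℝ, 0 ≤ t → t ≤ 1 →
    g ((1 - t) • ρ + t • σ) = (1 - t) * g ρ + t * g σ

/-- An extended-real-valued function on the dual is affine on `K`. -/
def AffineOnKE (K : Set (WeakDual ℝ V)) (g : WeakDual ℝ V → EReal) : Prop :=
  ∀ ρ ∈ K, ∀ σ ∈ K, ∀ t : ℝ, 0 ≤ t → t ≤ 1 →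
    g ((1 - t) • ρ + t • σ) = ((1 - t : ℝ) : EReal) * g ρ + ((t : ℝ) : EReal) * g σ

/-- Membership in the extended cone `C_usc` of nonnegative affine upper semicontinuous
functions on the state space `K`. -/
def memCusc (K : Set (WeakDual ℝ V)) (g : WeakDual ℝ V → ℝ) : Prop :=
  (∀ ρ ∈ K, 0 ≤ g ρ) ∧ AffineOnK K g ∧ UpperSemicontinuousOn g K

/-- `p` is an extremal vector of the cone `C_usc` over the state space `K`. -/
def IsExtremalCusc (K : Set (WeakDual ℝ V)) (p : WeakDual ℝ V → ℝ) : Prop :=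
  memCusc K p ∧ (∃ ρ ∈ K, p ρ ≠ 0) ∧
  ∀ x, memCusc K x → (∀ ρ ∈ K, x ρ ≤ p ρ) →
    ∃ t : ℝ, 0 ≤ t ∧ t ≤ 1 ∧ ∀ ρ ∈ K, x ρ = t * p ρ

/-- The cone `C_usc` over the state space `K` is strongly atomic: each of its
members is the least upper bound of the extremal vectors it dominates. -/
def StronglyAtomicCusc (K : Set (WeakDual ℝ V)) : Prop :=
  ∀ g, memCusc K g →
    (∀ p, IsExtremalCusc K p → (∀ ρ ∈ K, p ρ ≤ g ρ) → ∀ ρ ∈ K, p ρ ≤ g ρ) ∧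
    (∀ h, memCusc K h →
      (∀ p, IsExtremalCusc K p → (∀ ρ ∈ K, p ρ ≤ g ρ) → ∀ ρ ∈ K, p ρ ≤ h ρ) →
      ∀ ρ ∈ K, g ρ ≤ h ρ)

end Defs

set_option linter.unusedSectionVars false

section OrderedSetting

variable {V : Type*} [NormedAddCommGroup V] [NormedSpace ℝ V]

/-- The norm of the ordered space `V` is the order unit norm of `e`. -/
structure IsNormUnit {V : Type*} [NormedAddCommGroup V] [NormedSpace ℝ V] [PartialOrder V]
    (e : V) : Prop where
  nonneg : 0 ≤ e
  le_norm : ∀ x : V, x ≤ ‖x‖ • e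
  norm_le : ∀ (x : V) (r : ℝ), 0 ≤ r → x ≤ r • e → -x ≤ r • e → ‖x‖ ≤ r
  arch : ∀ x : V, (∀ r : ℝ, 0 < r → x ≤ r • e) → x ≤ 0

/-- The interior of the positive cone, described by the order unit `e`. -/
def unitCone [PartialOrder V] (e : V) : Set V := {x | ∃ ε : ℝ, 0 < ε ∧ ε • e ≤ x}

variable [PartialOrder V] [IsOrderedAddMonoid V] [IsOrderedModule ℝ V] {e : V}

theorem nonneg_of_smul_nonneg' {x : V} {r : ℝ} (hr : 0 < r) (h : 0 ≤ r • x) : 0 ≤ x := by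
  have := smul_nonneg (inv_nonneg.2 hr.le) h
  rwa [smul_smul, inv_mul_cancel₀ hr.ne', one_smul] at this

namespace IsNormUnit

theorem neg_le_norm (he : IsNormUnit e) (x : V) : -(‖x‖ • e) ≤ x := by
  have := he.le_norm (-x)
  rw [norm_neg] at this
  exact neg_le.mp this

theorem le_smul (he : IsNormUnit e) {x : V} {r : ℝ} (h : ‖x‖ ≤ r) : x ≤ r • e :=
  (he.le_norm x).trans (smul_le_smul_of_nonneg_right h he.nonneg)

theorem neg_le_smul (he : IsNormUnit e) {x : V} {r : ℝ} (h : ‖x‖ ≤ r) : -(r • e) ≤ x :=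
  (neg_le_neg (smul_le_smul_of_nonneg_right h he.nonneg)).trans (he.neg_le_norm x)

theorem norm_le_of_abs (he : IsNormUnit e) {x : V} {r : ℝ} (hr : 0 ≤ r) (h1 : -(r • e) ≤ x)
    (h2 : x ≤ r • e) : ‖x‖ ≤ r := he.norm_le x r hr h2 (neg_le.mp h1)

theorem norm_unit_le (he : IsNormUnit e) : ‖e‖ ≤ 1 :=
  he.norm_le_of_abs zero_le_one (by rw [one_smul]; exact (neg_nonpos.2 he.nonneg).trans he.nonneg)
    (by simp)

theorem norm_le_of_nonneg (he : IsNormUnit e) {x : V} {r : ℝ} (hr : 0 ≤ r) (h1 : 0 ≤ x)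
    (h2 : x ≤ r • e) : ‖x‖ ≤ r :=
  he.norm_le_of_abs hr ((neg_nonpos.2 (smul_nonneg hr he.nonneg)).trans h1) h2

theorem norm_mono (he : IsNormUnit e) {x y : V} (h1 : 0 ≤ x) (h2 : x ≤ y) : ‖x‖ ≤ ‖y‖ :=
  he.norm_le_of_nonneg (norm_nonneg _) h1 (h2.trans (he.le_norm y))

/-- If `x ≤ y + r e` for all `r > 0`, then `x ≤ y`. -/
theorem arch' (he : IsNormUnit e) {x y : V} (h : ∀ r : ℝ, 0 < r → x ≤ y + r • e) : x ≤ y := by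
  have := he.arch (x - y) fun r hr => by
    rw [sub_le_iff_le_add']; exact h r hr
  exact sub_nonpos.mp this

theorem le_of_tendsto (he : IsNormUnit e) {ι : Type*} {l : Filter ι} [l.NeBot] {f g : ι → V}
    {x y : V} (hf : Filter.Tendsto f l (𝓝 x)) (hg : Filter.Tendsto g l (𝓝 y))
    (h : ∀ᶠ i in l, f i ≤ g i) : x ≤ y := by
  refine he.arch' fun r hr => ?_
  have h1 : ∀ᶠ i in l, ‖(f i - g i) - (x - y)‖ < r := by
    have := (hf.sub hg)
    rw [tendsto_iff_norm_sub_tendsto_zero] at this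
    exact this.eventually (gt_mem_nhds hr)
  obtain ⟨i, hi, hi'⟩ := (h.and h1).exists
  have := he.neg_le_smul hi'.le
  linear_combination (norm := (apply le_of_eq; module)) this + hi

theorem nonneg_of_tendsto (he : IsNormUnit e) {ι : Type*} {l : Filter ι} [l.NeBot] {f : ι → V}
    {x : V} (hf : Filter.Tendsto f l (𝓝 x)) (h : ∀ᶠ i in l, 0 ≤ f i) : 0 ≤ x :=
  he.le_of_tendsto tendsto_const_nhds hf h

theorem orderClosedTopology (he : IsNormUnit e) : OrderClosedTopology V where
  isClosed_le' := by
    refine isClosed_iff_clusterPt.2 ?_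
    rintro ⟨a, b⟩ h
    have := mem_closure_iff_clusterPt.2 h
    rw [mem_closure_iff_seq_limit] at this
    obtain ⟨u, hu, hu'⟩ := this
    exact he.le_of_tendsto (f := fun n => (u n).1) (g := fun n => (u n).2) (hu'.fst_nhds) (hu'.snd_nhds)
      (Filter.Eventually.of_forall hu)

end IsNormUnit

namespace unitCone

theorem nonneg (he : IsNormUnit e) {x : V} (hx : x ∈ unitCone e) : 0 ≤ x := by
  obtain ⟨ε, h, h'⟩ := hx
  exact (smul_nonneg h.le he.nonneg).trans h'

theorem unit_mem : e ∈ unitCone e := ⟨1, one_pos, by simp⟩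

theorem smul_mem {x : V} (hx : x ∈ unitCone e) {r : ℝ} (hr : 0 < r) : r • x ∈ unitCone e := by
  obtain ⟨ε, h, h'⟩ := hx
  refine ⟨r * ε, by positivity, ?_⟩
  rw [mul_smul]
  exact smul_le_smul_of_nonneg_left h' hr.le

theorem mem_of_le {x y : V} (hx : x ∈ unitCone e) (h : x ≤ y) : y ∈ unitCone e := by
  obtain ⟨ε, h1, h'⟩ := hx
  exact ⟨ε, h1, h'.trans h⟩

theorem add_mem (he : IsNormUnit e) {x y : V} (hx : x ∈ unitCone e) (hy : y ∈ unitCone e) :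
    x + y ∈ unitCone e :=
  mem_of_le hx (by simpa using nonneg he hy)

theorem add_nonneg_mem {x y : V} (hx : x ∈ unitCone e) (hy : 0 ≤ y) :
    x + y ∈ unitCone e :=
  mem_of_le hx (by simpa using hy)

/-- Any element is dominated by a multiple of an interior point. -/
theorem exists_le_smul (he : IsNormUnit e) {x : V} (hx : x ∈ unitCone e) (y : V) :
    ∃ r : ℝ, 0 < r ∧ y ≤ r • x := by
  obtain ⟨ε, h, h'⟩ := hx
  refine ⟨(‖y‖ + 1) / ε, by positivity, ?_⟩
  have h1 : y ≤ (‖y‖ + 1) • e := he.le_smul (by simp)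
  refine h1.trans ?_
  have := smul_le_smul_of_nonneg_left h' (show 0 ≤ (‖y‖ + 1) / ε by positivity)
  rwa [smul_smul, div_mul_cancel₀ _ h.ne'] at this

theorem mem_of_norm_sub_lt (he : IsNormUnit e) {x : V} {ε : ℝ} (hx : ε • e ≤ x) {y : V}
    (hy : ‖y - x‖ < ε) : y ∈ unitCone e := by
  refine ⟨ε - ‖y - x‖, by linarith, ?_⟩
  have := he.neg_le_norm (y - x)
  linear_combination (norm := (apply le_of_eq; module)) this + hx

theorem isOpen (he : IsNormUnit e) : IsOpen (unitCone e) := by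
  rw [Metric.isOpen_iff]
  rintro x ⟨ε, h, h'⟩
  exact ⟨ε, h, fun y hy => mem_of_norm_sub_lt he h' (by rwa [← dist_eq_norm])⟩

theorem mem_nhds (he : IsNormUnit e) {x : V} (hx : x ∈ unitCone e) : unitCone e ∈ 𝓝 x :=
  (isOpen he).mem_nhds hx

end unitCone

end OrderedSetting

section JordanMul

variable {V : Type*} [NormedAddCommGroup V] [NormedSpace ℝ V]

/-- `M` is a continuous unital Jordan product on `V` with unit `e`. -/
structure IsJordanMul (M : V →L[ℝ] V →L[ℝ] V) (e : V) : Prop where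
  comm : ∀ x y, M x y = M y x
  one_mul : ∀ x, M e x = x
  jordan : ∀ x y, M x (M (M x x) y) = M (M x x) (M x y)

namespace IsJordanMul

variable {M : V →L[ℝ] V →L[ℝ] V} {e : V}

theorem mul_one (hM : IsJordanMul M e) (x : V) : M x e = x := by rw [hM.comm, hM.one_mul]

theorem map_one (hM : IsJordanMul M e) : M e = 1 := by
  ext x; simp [hM.one_mul]

theorem linearized_apply (hM : IsJordanMul M e) (a b c u : V) :
    M a (M (M b c) u) + M b (M (M a c) u) + M c (M (M a b) u) =
      M (M b c) (M a u) + M (M a c) (M b u) + M (M a b) (M c u) := by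
  have h0 := hM.jordan (a + b + c) u
  have h1 := hM.jordan (a + b) u
  have h2 := hM.jordan (a + c) u
  have h3 := hM.jordan (b + c) u
  have h4 := hM.jordan a u
  have h5 := hM.jordan b u
  have h6 := hM.jordan c u
  simp only [map_add, add_apply, hM.comm b a, hM.comm c a, hM.comm c b]
    at h0 h1 h2 h3
  linear_combination (norm := module) (1/2 : ℝ) • (h0 - h1 - h2 - h3 + h4 + h5 + h6)

theorem linearized (hM : IsJordanMul M e) (a b c : V) :
    M a * M (M b c) + M b * M (M a c) + M c * M (M a b) =
      M (M b c) * M a + M (M a c) * M b + M (M a b) * M c := by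
  ext u; exact hM.linearized_apply a b c u

theorem mul_linearized (hM : IsJordanMul M e) (a b c : V) :
    M a * M (M b c) + M b * M (M a c) + M c * M (M a b) =
      M (M a (M b c)) + M b * M a * M c + M c * M a * M b := by
  ext d
  have h1 := hM.linearized_apply a b c d
  have h2 := hM.linearized_apply d b c a
  have e1 := hM.comm d (M (M b c) a)
  simp only [add_apply, mul_apply_eq_comp] at *
  rw [hM.comm (M a (M b c)) d, hM.comm a (M b c), hM.comm c d, hM.comm b d,
    hM.comm a (M d c), hM.comm a (M d b)]
  rw [hM.comm (M d c) (M b a), hM.comm (M d b) (M c a), hM.comm d a, hM.comm b a, hM.comm c a] at h2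
  rw [hM.comm c d, hM.comm b d] at h1
  linear_combination (norm := module) h1 - h2

/-- Powers of `z`. -/
noncomputable def pw (M : V →L[ℝ] V →L[ℝ] V) (e z : V) (n : ℕ) : V := (M z)^[n] e

theorem pw_zero (z : V) : pw M e z 0 = e := rfl

theorem pw_succ (z : V) (n : ℕ) : pw M e z (n + 1) = M z (pw M e z n) := by
  simp [pw, Function.iterate_succ_apply']

theorem pw_one (hM : IsJordanMul M e) (z : V) : pw M e z 1 = z := by
  rw [pw_succ, pw_zero, hM.mul_one]

theorem pw_mul_aux (hM : IsJordanMul M e) (z : V) (N : ℕ) : ∀ m n : ℕ, m + n = N →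
    M (pw M e z m) (pw M e z n) = pw M e z N ∧ Commute (M (pw M e z m)) (M (pw M e z n)) := by
  induction N using Nat.strong_induction_on with
  | _ N ih =>
    have key : ∀ m n : ℕ, m + n = N → Commute (M (pw M e z m)) (M (pw M e z n)) := by
      rcases Nat.eq_zero_or_pos N with rfl | hN
      · intro m n h
        obtain ⟨rfl, rfl⟩ : m = 0 ∧ n = 0 := by omega
        exact Commute.refl _
      set g : ℕ → (V →L[ℝ] V) := fun m => M (pw M e z m) * M (pw M e z (N - m)) -
        M (pw M e z (N - m)) * M (pw M e z m) with hg
      have hstep : ∀ m, m + 1 ≤ N → g (m + 1) = g m + g 1 := by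
        intro m hm
        obtain ⟨n, rfl⟩ : ∃ n, N = m + n + 1 := ⟨N - m - 1, by omega⟩
        have hl := hM.linearized z (pw M e z m) (pw M e z n)
        rw [(ih (m + n) (by omega) m n rfl).1, ← pw_succ, ← pw_succ] at hl
        simp only [hg, hM.pw_one]
        rw [show m + n + 1 - (m + 1) = n by omega, show m + n + 1 - m = n + 1 by omega,
          show m + n + 1 - 1 = m + n by omega]
        rw [← sub_eq_zero] at hl ⊢
        rw [← neg_eq_zero, ← hl]
        abel
      have hlin : ∀ m, m ≤ N → g m = (m : ℝ) • g 1 := by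
        intro m
        induction m with
        | zero => intro _; simp [hg, pw_zero, hM.map_one]
        | succ k ihk =>
          intro hk
          rw [hstep k hk, ihk (by omega)]
          push_cast; module
      have hN' : g N = 0 := by simp [hg, pw_zero, hM.map_one]
      have h1 : g 1 = 0 := by
        have := hlin N le_rfl
        rw [hN'] at this
        rcases smul_eq_zero.mp this.symm with h | h
        · exact absurd (by exact_mod_cast h) hN.ne'
        · exact h
      intro m n h
      have := hlin m (by omega)
      rw [h1, smul_zero] at this
      simp only [hg] at this
      rw [show N - m = n by omega] at this
      exact sub_eq_zero.mp this
    intro m n h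
    refine ⟨?_, key m n h⟩
    cases n with
    | zero => rw [pw_zero, hM.mul_one, ← h]; rfl
    | succ k =>
      have hc : Commute (M (pw M e z m)) (M (pw M e z 1)) := by
        rcases Nat.lt_or_ge (m + 1) N with h' | h'
        · exact (ih _ h' m 1 rfl).2
        · exact key m 1 (by omega)
      rw [hM.pw_one] at hc
      have := congrArg (fun T : V →L[ℝ] V => T (pw M e z k)) hc.eq
      simp only [mul_apply_eq_comp] at this
      rw [pw_succ, this, (ih (m + k) (by omega) m k rfl).1, ← pw_succ]
      congr 1

theorem pw_mul (hM : IsJordanMul M e) (z : V) (m n : ℕ) :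
    M (pw M e z m) (pw M e z n) = pw M e z (m + n) := (hM.pw_mul_aux z _ m n rfl).1

theorem pw_commute (hM : IsJordanMul M e) (z : V) (m n : ℕ) :
    Commute (M (pw M e z m)) (M (pw M e z n)) := (hM.pw_mul_aux z _ m n rfl).2

end IsJordanMul

end JordanMul

section JordanInverse

variable {V : Type*} [NormedAddCommGroup V] [NormedSpace ℝ V]

/-- `x` and `y` are mutually inverse in the Jordan sense. -/
def JInv (M : V →L[ℝ] V →L[ℝ] V) (e x y : V) : Prop := M x y = e ∧ Commute (M x) (M y)

/-- The operator `2 L_x ^ 2 - L_{x ^ 2}`. -/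
noncomputable def quadRep (M : V →L[ℝ] V →L[ℝ] V) (x : V) : V →L[ℝ] V :=
  (2 : ℝ) • (M x * M x) - M (M x x)

/-- The polarization of `quadRep`. -/
noncomputable def quadRep₂ (M : V →L[ℝ] V →L[ℝ] V) (x y : V) : V →L[ℝ] V :=
  M x * M y + M y * M x - M (M x y)

variable {M : V →L[ℝ] V →L[ℝ] V} {e : V}

theorem quadRep_add (hM : IsJordanMul M e) (x k : V) :
    quadRep M (x + k) = quadRep M x + (2 : ℝ) • quadRep₂ M x k + quadRep M k := by
  simp only [quadRep, quadRep₂, map_add, add_apply, hM.comm k x, add_mul, mul_add]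
  module

theorem quadRep_smul (r : ℝ) (x : V) : quadRep M (r • x) = (r ^ 2) • quadRep M x := by
  simp only [quadRep, map_smul, smul_apply, smul_mul_smul_comm]
  module

theorem quadRep₂_smul (r : ℝ) (x y : V) : quadRep₂ M x (r • y) = r • quadRep₂ M x y := by
  simp only [quadRep₂, map_smul, smul_mul_assoc, mul_smul_comm]
  module

theorem quadRep₂_add (x y z : V) :
    quadRep₂ M x (y + z) = quadRep₂ M x y + quadRep₂ M x z := by
  simp only [quadRep₂, map_add, add_mul, mul_add]
  module

theorem quadRep₂_self (x : V) : quadRep₂ M x x = quadRep M x := by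
  simp only [quadRep₂, quadRep]
  module

theorem quadRep₂_one (hM : IsJordanMul M e) (x : V) : quadRep₂ M x e = M x := by
  simp [quadRep₂, hM.map_one, hM.mul_one]

theorem quadRep_one (hM : IsJordanMul M e) : quadRep M e = 1 := by
  simp [quadRep, hM.map_one]; module

theorem quadRep_apply_one (hM : IsJordanMul M e) (x : V) : quadRep M x e = M x x := by
  simp only [quadRep, sub_apply, smul_apply, mul_apply_eq_comp, hM.mul_one]; module

namespace JInv

variable {x y : V}

theorem symm (hM : IsJordanMul M e) (h : JInv M e x y) : JInv M e y x :=
  ⟨by rw [hM.comm]; exact h.1, h.2.symm⟩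

theorem smul (h : JInv M e x y) {r : ℝ} (hr : r ≠ 0) : JInv M e (r • x) (r⁻¹ • y) := by
  refine ⟨?_, ?_⟩
  · simp [h.1, smul_smul, hr]
  · simpa using (h.2.smul_left r).smul_right r⁻¹

theorem mul_apply_apply (h : JInv M e x y) (u : V) : M x (M y u) = M y (M x u) :=
  congrArg (fun T : V →L[ℝ] V => T u) h.2.eq

theorem sq_mul (hM : IsJordanMul M e) (h : JInv M e x y) : M (M x x) y = x := by
  rw [hM.comm, ← h.mul_apply_apply, hM.comm y x, h.1, hM.mul_one]

theorem mul_quadRep (hM : IsJordanMul M e) (h : JInv M e x y) : M y * quadRep M x = M x := by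
  have h1 := hM.mul_linearized y x x
  rw [hM.comm y x, h.1, hM.map_one, hM.comm y (M x x), h.sq_mul hM, h.2.eq] at h1
  simp only [quadRep, mul_sub, mul_smul_comm, mul_one] at h1 ⊢
  rw [mul_assoc] at h1
  linear_combination (norm := module) -h1

theorem commute_sq (hM : IsJordanMul M e) (h : JInv M e x y) : Commute (M x) (M (M y y)) := by
  have h1 := hM.linearized x y y
  rw [h.1, hM.map_one] at h1
  simp only [mul_one, one_mul] at h1
  exact add_right_cancel (add_right_cancel h1)

theorem sq_mul_sq (hM : IsJordanMul M e) (h : JInv M e x y) : M (M x x) (M y y) = e := by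
  have h1 := congrArg (fun T : V →L[ℝ] V => T x) (h.commute_sq hM).eq
  simp only [mul_apply_eq_comp] at h1
  rw [hM.comm, ← h1, (h.symm hM).sq_mul hM, h.1]

theorem quadRep_mul (hM : IsJordanMul M e) (h : JInv M e x y) :
    quadRep M y * quadRep M x = 1 := by
  have h1 := hM.mul_linearized (M y y) x x
  rw [hM.comm (M y y) (M x x), h.sq_mul_sq hM, (h.symm hM).sq_mul hM, hM.map_one,
    (h.commute_sq hM).eq] at h1
  have h2 := h.mul_quadRep hM
  have h3 : M (M y y) * quadRep M x = (2 : ℝ) • (M x * M y) - 1 := by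
    simp only [quadRep, mul_sub, mul_smul_comm] at h1 ⊢
    rw [mul_assoc] at h1
    linear_combination (norm := module) -h1
  rw [quadRep, sub_mul, h3, smul_mul_assoc, mul_assoc, h2, h.2.eq]
  module

theorem quadRep_apply (hM : IsJordanMul M e) (h : JInv M e x y) : quadRep M y x = y := by
  have h1 := h.1
  rw [hM.comm] at h1
  simp only [quadRep, sub_apply, smul_apply, mul_apply_eq_comp, h1, hM.mul_one,
    (h.symm hM).sq_mul hM]
  module

theorem quadRep_quadRep (hM : IsJordanMul M e) (h : JInv M e x y) (u : V) :
    quadRep M y (quadRep M x u) = u :=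
  congrArg (fun T : V →L[ℝ] V => T u) (h.quadRep_mul hM)

theorem unique (hM : IsJordanMul M e) {y' : V} (h : JInv M e x y) (h' : JInv M e x y') :
    y = y' := by
  rw [← h.quadRep_quadRep hM y, (h.symm hM).quadRep_apply hM, ← (h'.symm hM).quadRep_apply hM,
    h.quadRep_quadRep hM]

theorem sub_eq (hM : IsJordanMul M e) {x' y' : V} (h : JInv M e x y) (h' : JInv M e x' y') :
    y - y' = quadRep M y ((x' - x) - quadRep M (x' - x) y') := by
  set k := x' - x with hk
  have h1 : quadRep₂ M x' k y' = k := by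
    simp only [quadRep₂, sub_apply, add_apply, mul_apply_eq_comp, h'.1, hM.mul_one]
    rw [hM.comm k y', h'.mul_apply_apply, hM.comm (M x' k)]
    abel
  have h2 : quadRep M x y' = x' - (2 : ℝ) • k + quadRep M k y' := by
    have : x = x' + (-1 : ℝ) • k := by rw [hk]; module
    rw [this, quadRep_add hM, quadRep₂_smul, quadRep_smul]
    simp only [add_apply, smul_apply, h1, (h'.symm hM).quadRep_apply hM]
    module
  have h3 := (h.symm hM).quadRep_apply hM
  rw [← h.quadRep_quadRep hM (y - y'), map_sub, h2, h3]
  congr 1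
  rw [hk]; module

end JInv

end JordanInverse

section JBForward

variable {V : Type*} [NormedAddCommGroup V] [NormedSpace ℝ V]
  [PartialOrder V] [IsOrderedAddMonoid V] [IsOrderedModule ℝ V]

/-- The part of the JB-algebra axioms used to construct the inverse map. -/
structure IsJBMul (M : V →L[ℝ] V →L[ℝ] V) (e : V) : Prop extends IsJordanMul M e where
  norm_mul_le : ∀ x y, ‖M x y‖ ≤ ‖x‖ * ‖y‖
  sq_nonneg : ∀ x, 0 ≤ M x x

namespace IsJBMul

variable {M : V →L[ℝ] V →L[ℝ] V} {e : V}

theorem opNorm_le (h : IsJBMul M e) (x : V) : ‖M x‖ ≤ ‖x‖ :=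
  (M x).opNorm_le_bound (norm_nonneg x) (h.norm_mul_le x)

theorem quadRep_norm_le (h : IsJBMul M e) (x : V) : ‖quadRep M x‖ ≤ 3 * ‖x‖ ^ 2 := by
  rw [quadRep]
  have h1 : ‖M x * M x‖ ≤ ‖x‖ * ‖x‖ := (_root_.norm_mul_le _ _).trans
    (mul_le_mul (h.opNorm_le x) (h.opNorm_le x) (norm_nonneg _) (norm_nonneg _))
  have h2 : ‖M (M x x)‖ ≤ ‖x‖ * ‖x‖ := (h.opNorm_le _).trans (h.norm_mul_le x x)
  refine (norm_sub_le _ _).trans ?_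
  rw [norm_smul, Real.norm_eq_abs, abs_of_pos two_pos]
  nlinarith

theorem sq_le (h : IsJBMul M e) (he : IsNormUnit e) {k : V} (hk : 0 ≤ k) :
    M k k ≤ ‖k‖ • k := by
  have h1 : ‖k - (‖k‖ / 2) • e‖ ≤ ‖k‖ / 2 := by
    refine he.norm_le_of_abs (by positivity) ?_ ?_
    · simpa using hk
    · have := he.le_norm k
      linear_combination (norm := (apply le_of_eq; module)) this
  have h2 := he.le_norm (M (k - (‖k‖ / 2) • e) (k - (‖k‖ / 2) • e))
  have h3 := h.norm_mul_le (k - (‖k‖ / 2) • e) (k - (‖k‖ / 2) • e)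
  have h4 : ‖M (k - (‖k‖ / 2) • e) (k - (‖k‖ / 2) • e)‖ ≤ (‖k‖ / 2) * (‖k‖ / 2) :=
    h3.trans (mul_le_mul h1 h1 (norm_nonneg _) (by positivity))
  have h5 := he.le_smul h4
  simp only [map_sub, map_smul, sub_apply, smul_apply, h.mul_one, h.one_mul] at h5
  linear_combination (norm := (apply le_of_eq; module)) h5

theorem neg_le_add_mul (h : IsJBMul M e) (he : IsNormUnit e) {k : V} (hk : 0 ≤ k) (t : V) :
    -((‖t‖ ^ 2 * ‖k‖ / 4) • e) ≤ k + M t k := by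
  rcases (norm_nonneg k).eq_or_lt with h0 | h0
  · have : k = 0 := norm_eq_zero.mp h0.symm
    subst this; simp
  have h1 := h.sq_nonneg ((2 : ℝ) • k + ‖k‖ • t)
  have h2 := h.sq_le he hk
  have h3 : M t t ≤ (‖t‖ ^ 2) • e := he.le_smul (by rw [sq]; exact h.norm_mul_le t t)
  simp only [map_add, map_smul, add_apply, smul_apply, h.comm k t] at h1
  have h4 : 0 ≤ (4 * ‖k‖) • (k + M t k + (‖t‖ ^ 2 * ‖k‖ / 4) • e) := by
    linear_combination (norm := (apply le_of_eq; module)) h1 + (4 : ℝ) • h2 + (‖k‖ ^ 2) • h3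
  have h5 := nonneg_of_smul_nonneg' (by positivity : 0 < 4 * ‖k‖) h4
  linear_combination (norm := (apply le_of_eq; module)) h5

theorem pw_norm_le (h : IsJBMul M e) (he : IsNormUnit e) (z : V) (n : ℕ) :
    ‖IsJordanMul.pw M e z n‖ ≤ ‖z‖ ^ n := by
  induction n with
  | zero => simpa [IsJordanMul.pw_zero] using he.norm_unit_le
  | succ n ih =>
    rw [IsJordanMul.pw_succ, pow_succ']
    exact (h.norm_mul_le _ _).trans (by gcongr)

theorem exists_jinv [CompleteSpace V] (h : IsJBMul M e) (he : IsNormUnit e) {x : V} {ε : ℝ}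
    (hε : 0 < ε) (hx : ε • e ≤ x) : ∃ y, JInv M e x y ∧ ‖y‖ ≤ ε⁻¹ := by
  set l := ‖x‖ + ε with hl
  have hl0 : 0 < l := by positivity
  set z := e - l⁻¹ • x with hz
  set r := ‖x‖ / l with hr
  have hr1 : r < 1 := by rw [hr, div_lt_one hl0]; linarith
  have hr0 : 0 ≤ r := by positivity
  have hz1 : ‖z‖ ≤ r := by
    refine he.norm_le_of_nonneg hr0 ?_ ?_
    · have := he.le_smul (show ‖x‖ ≤ l by linarith)
      have := smul_le_smul_of_nonneg_left this (inv_nonneg.2 hl0.le)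
      rw [smul_smul, inv_mul_cancel₀ hl0.ne', one_smul] at this
      exact sub_nonneg.2 this
    · have := smul_le_smul_of_nonneg_left hx (inv_nonneg.2 hl0.le)
      have h2 : r = 1 - l⁻¹ * ε := by rw [hr]; field_simp; rw [hl]; ring
      rw [h2]
      linear_combination (norm := (apply le_of_eq; module)) this
  have hb : ∀ n, ‖IsJordanMul.pw M e z n‖ ≤ r ^ n := fun n =>
    (h.pw_norm_le he z n).trans (pow_le_pow_left₀ (norm_nonneg _) hz1 n)
  have hsum : Summable (IsJordanMul.pw M e z) :=
    Summable.of_norm_bounded (summable_geometric_of_lt_one hr0 hr1) hb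
  obtain ⟨s, hs⟩ := hsum
  have hsn : ‖s‖ ≤ (1 - r)⁻¹ := by
    rw [← hs.tsum_eq]
    exact tsum_of_norm_bounded (hasSum_geometric_of_lt_one hr0 hr1) hb
  have hx' : x = l • (e - z) := by rw [hz]; simp [smul_smul, hl0.ne']
  have h1 : M z s = s - e := by
    have h1 : HasSum (fun n => IsJordanMul.pw M e z (n + 1)) (M z s) := by
      simpa [IsJordanMul.pw_succ] using (M z).hasSum hs
    have h2 := (hasSum_nat_add_iff' (f := IsJordanMul.pw M e z) 1).2 hs
    simp only [Finset.range_one, Finset.sum_singleton, IsJordanMul.pw_zero] at h2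
    exact h1.unique h2
  have hc : Commute (M z) (M s) := by
    have h2 := M.hasSum hs
    have h3 := h2.mul_left (M z)
    have h4 := h2.mul_right (M z)
    have : (fun n => M z * M (IsJordanMul.pw M e z n)) =
        fun n => M (IsJordanMul.pw M e z n) * M z := by
      funext n
      have := h.pw_commute z 1 n
      rw [h.pw_one] at this
      exact this.eq
    rw [this] at h3
    exact h3.unique h4
  have h2 : JInv M e (e - z) s := by
    refine ⟨?_, ?_⟩
    · rw [map_sub, sub_apply, h1, h.one_mul]; abel
    · rw [map_sub, h.map_one]
      exact (Commute.one_left _).sub_left hc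
  refine ⟨l⁻¹ • s, ?_, ?_⟩
  · rw [hx']; exact h2.smul hl0.ne'
  · rw [norm_smul, Real.norm_eq_abs, abs_of_pos (inv_pos.2 hl0)]
    have h3 : l⁻¹ * (1 - r)⁻¹ = ε⁻¹ := by
      rw [← mul_inv]; congr 1; rw [hr]; field_simp; rw [hl]; ring
    rw [← h3]
    gcongr

end IsJBMul

end JBForward

section JBForward

variable {V : Type*} [NormedAddCommGroup V] [NormedSpace ℝ V]
  [PartialOrder V] [IsOrderedAddMonoid V] [IsOrderedModule ℝ V]

namespace IsJBMul

variable {M : V →L[ℝ] V →L[ℝ] V} {e : V}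

theorem quadRep₂_eq (h : IsJBMul M e) {x y k : V} (hxy : JInv M e x y) {a b : ℝ}
    (hk : k = a • x + b • e) : quadRep₂ M x k = M (M y k) * quadRep M x := by
  have h1 := hxy.mul_quadRep h.toIsJordanMul
  rw [hk, quadRep₂_add, quadRep₂_smul, quadRep₂_smul, quadRep₂_self,
    quadRep₂_one h.toIsJordanMul]
  simp only [map_add, map_smul, h.comm y x, hxy.1, h.mul_one, h.map_one, add_mul, smul_mul_assoc,
    one_mul, h1]

/-- One step of the continuation method along a segment. -/
theorem quadRep_step (h : IsJBMul M e) (he : IsNormUnit e) {x y x' y' k t : V} {d R K η : ℝ}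
    (hd0 : 0 ≤ d) (hd1 : d ≤ 1) (hR : 0 ≤ R) (hη : 0 ≤ η)
    (hxy : JInv M e x y) (hxy' : JInv M e x' y') (hx' : x' = x + d • k)
    (ht : quadRep₂ M x k = M t * quadRep M x)
    (hxR : ‖x‖ ≤ R) (hkR : ‖k‖ ≤ R) (htR : ‖t‖ ≤ R) (hyK : ‖y‖ ≤ K) (hyK' : ‖y'‖ ≤ K)
    (hpos : ∀ u, 0 ≤ u → -((η * ‖u‖) • e) ≤ quadRep M y u) {C : ℝ}
    (hC : 2 * R + R ^ 2 ≤ C)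
    (hC2 : R ^ 2 * (3 * K ^ 2) +
      3 * K ^ 2 * (4 * R ^ 2 * (3 * R ^ 2) + (1 + 2 * R) * (3 * R ^ 2)) * (3 * K ^ 2) ≤ C) :
    ∀ u, 0 ≤ u → -((((1 + C * d) * η + C * d ^ 2) * ‖u‖) • e) ≤ quadRep M y' u := by
  have hJ := h.toIsJordanMul
  set E : V →L[ℝ] V := quadRep M y * ((-4 : ℝ) • (M t * M t * quadRep M x) +
    (1 - (2 * d) • M t) * quadRep M k) with hE
  have hUx : quadRep M x' = quadRep M x + (2 * d) • (M t * quadRep M x) + d ^ 2 • quadRep M k := by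
    rw [hx', quadRep_add hJ, quadRep₂_smul, quadRep_smul, ht, smul_smul]
  have h1 : quadRep M y * ((1 - (2 * d) • M t) * quadRep M x') = 1 + d ^ 2 • E := by
    have h0 : (1 - (2 * d) • M t) * quadRep M x' = quadRep M x +
        d ^ 2 • ((-4 : ℝ) • (M t * M t * quadRep M x) + (1 - (2 * d) • M t) * quadRep M k) := by
      rw [hUx]
      simp only [sub_mul, mul_add, one_mul, smul_mul_assoc, mul_smul_comm, mul_assoc]
      module
    rw [h0, mul_add, hxy.quadRep_mul hJ, mul_smul_comm]
  have h2 : quadRep M y * (1 - (2 * d) • M t) = quadRep M y' + d ^ 2 • (E * quadRep M y') := by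
    have h3 := congrArg (fun T => T * quadRep M y') h1
    simp only [mul_assoc, (hxy'.symm hJ).quadRep_mul hJ, mul_one, add_mul, one_mul,
      smul_mul_assoc] at h3
    exact h3
  have hqx : ‖quadRep M x‖ ≤ 3 * R ^ 2 := (h.quadRep_norm_le x).trans (by gcongr)
  have hqk : ‖quadRep M k‖ ≤ 3 * R ^ 2 := (h.quadRep_norm_le k).trans (by gcongr)
  have hqy : ‖quadRep M y‖ ≤ 3 * K ^ 2 := (h.quadRep_norm_le y).trans (by gcongr)
  have hqy' : ‖quadRep M y'‖ ≤ 3 * K ^ 2 := (h.quadRep_norm_le y').trans (by gcongr)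
  have hMt : ‖M t‖ ≤ R := (h.opNorm_le t).trans htR
  have hEn : ‖E‖ ≤ 3 * K ^ 2 * (4 * R ^ 2 * (3 * R ^ 2) + (1 + 2 * R) * (3 * R ^ 2)) := by
    rw [hE]
    refine (_root_.norm_mul_le _ _).trans ?_
    refine mul_le_mul hqy ?_ (norm_nonneg _) (by positivity)
    refine (norm_add_le _ _).trans (add_le_add ?_ ?_)
    · rw [norm_smul]
      have e1 : ‖M t * M t * quadRep M x‖ ≤ R * R * (3 * R ^ 2) :=
        (_root_.norm_mul_le _ _).trans (mul_le_mul ((_root_.norm_mul_le _ _).trans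
          (mul_le_mul hMt hMt (norm_nonneg _) hR)) hqx (norm_nonneg _) (by positivity))
      norm_num
      linarith
    · refine (_root_.norm_mul_le _ _).trans (mul_le_mul ?_ hqk (norm_nonneg _) (by positivity))
      refine (norm_sub_le _ _).trans (add_le_add ?_ ?_)
      · exact ContinuousLinearMap.norm_id_le
      · rw [norm_smul, Real.norm_eq_abs, abs_of_nonneg (by positivity)]
        have : d * ‖M t‖ ≤ 1 * R := mul_le_mul hd1 hMt (norm_nonneg _) zero_le_one
        linarith
  intro u hu
  have a1 := h.neg_le_add_mul he hu ((-(2 * d)) • t)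
  have a2 : ‖(-(2 * d)) • t‖ ^ 2 * ‖u‖ / 4 ≤ d ^ 2 * R ^ 2 * ‖u‖ := by
    rw [norm_smul, mul_pow, Real.norm_eq_abs, sq_abs]
    have : ‖t‖ ^ 2 ≤ R ^ 2 := by gcongr
    have h3 : d ^ 2 * ‖u‖ * ‖t‖ ^ 2 ≤ d ^ 2 * ‖u‖ * R ^ 2 := by gcongr
    linarith
  set w : V := u + M ((-(2 * d)) • t) u + (d ^ 2 * R ^ 2 * ‖u‖) • e with hw
  have hw0 : 0 ≤ w := by
    have a3 := smul_le_smul_of_nonneg_right a2 he.nonneg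
    rw [hw]
    linear_combination (norm := (apply le_of_eq; module)) a1 + a3
  have hw1 : ‖w‖ ≤ (1 + C * d) * ‖u‖ := by
    have b1 : ‖M ((-(2 * d)) • t) u‖ ≤ 2 * d * R * ‖u‖ := by
      refine (h.norm_mul_le _ _).trans ?_
      rw [norm_smul, Real.norm_eq_abs, abs_neg, abs_of_nonneg (by positivity)]
      gcongr
    have b2 : ‖(d ^ 2 * R ^ 2 * ‖u‖) • e‖ ≤ d * R ^ 2 * ‖u‖ := by
      rw [norm_smul, Real.norm_eq_abs, abs_of_nonneg (by positivity)]
      have : d ^ 2 * R ^ 2 * ‖u‖ * ‖e‖ ≤ d ^ 2 * R ^ 2 * ‖u‖ * 1 := by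
        gcongr; exact he.norm_unit_le
      have b3 : d ^ 2 * (R ^ 2 * ‖u‖) ≤ d * (R ^ 2 * ‖u‖) := by
        apply mul_le_mul_of_nonneg_right _ (by positivity); nlinarith
      linarith
    have b4 : (2 * R + R ^ 2) * (d * ‖u‖) ≤ C * (d * ‖u‖) := by gcongr
    calc ‖w‖ ≤ ‖u‖ + 2 * d * R * ‖u‖ + d * R ^ 2 * ‖u‖ :=
        (norm_add_le _ _).trans (add_le_add ((norm_add_le _ _).trans (add_le_add le_rfl b1)) b2)
      _ ≤ _ := by linarith
  have c1 := hpos w hw0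
  have c2 : η * ‖w‖ ≤ η * ((1 + C * d) * ‖u‖) := by gcongr
  have c3 := smul_le_smul_of_nonneg_right c2 he.nonneg
  have c4 : quadRep M y' u = quadRep M y w - (d ^ 2 * R ^ 2 * ‖u‖) • quadRep M y e -
      d ^ 2 • E (quadRep M y' u) := by
    have h3 := congrArg (fun T : V →L[ℝ] V => T u) h2
    simp only [mul_apply_eq_comp, sub_apply, add_apply, smul_apply,
      one_apply_eq_self] at h3
    have : w = (u - (2 * d) • M t u) + (d ^ 2 * R ^ 2 * ‖u‖) • e := by
      rw [hw]; simp; module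
    rw [this, map_add, h3, map_smul]
    module
  have c5 : ‖quadRep M y e‖ ≤ 3 * K ^ 2 := by
    refine ((quadRep M y).le_opNorm e).trans ?_
    calc _ ≤ 3 * K ^ 2 * 1 := by gcongr; exact he.norm_unit_le
      _ = _ := mul_one _
  have c6 : ‖E (quadRep M y' u)‖ ≤
      3 * K ^ 2 * (4 * R ^ 2 * (3 * R ^ 2) + (1 + 2 * R) * (3 * R ^ 2)) * (3 * K ^ 2 * ‖u‖) := by
    refine (E.le_opNorm _).trans (mul_le_mul hEn ?_ (norm_nonneg _) (by positivity))
    exact ((quadRep M y').le_opNorm u).trans (by gcongr)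
  have d1 := he.le_smul c5
  have d2 := he.le_smul c6
  have hcc := smul_le_smul_of_nonneg_right hC2 (smul_nonneg
    (show 0 ≤ d ^ 2 * ‖u‖ by positivity) he.nonneg)
  rw [c4]
  linear_combination (norm := (apply le_of_eq; module)) c1 + c3 +
    (d ^ 2 * R ^ 2 * ‖u‖) • d1 + d ^ 2 • d2 + hcc

theorem quadRep_nonneg [CompleteSpace V] (h : IsJBMul M e) (he : IsNormUnit e) {x y : V}
    (hx : x ∈ unitCone e) (hxy : JInv M e x y) {u : V} (hu : 0 ≤ u) : 0 ≤ quadRep M y u := by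
  have hJ := h.toIsJordanMul
  obtain ⟨ε₀, hε₀, hxε₀⟩ := hx
  obtain ⟨ε, hε, hε1, hxε⟩ : ∃ ε : ℝ, 0 < ε ∧ ε ≤ 1 ∧ ε • e ≤ x :=
    ⟨min ε₀ 1, by positivity, min_le_right _ _,
      (smul_le_smul_of_nonneg_right (min_le_left _ _) he.nonneg).trans hxε₀⟩
  set k := x - e with hk
  have hseg : ∀ s : ℝ, 0 ≤ s → s ≤ 1 → ∃ y, JInv M e (e + s • k) y ∧ ‖y‖ ≤ ε⁻¹ := by
    intro s hs0 hs1
    refine h.exists_jinv he hε ?_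
    have h1 : ε • e ≤ e := by
      simpa using smul_le_smul_of_nonneg_right hε1 he.nonneg
    have hs1' : 0 ≤ 1 - s := by linarith
    have h2 := smul_le_smul_of_nonneg_left h1 hs1'
    rw [hk]
    linear_combination (norm := (apply le_of_eq; module)) h2 + s • hxε
  set K := ε⁻¹ with hK
  have hK0 : 0 ≤ K := (inv_pos.2 hε).le
  set R := (1 + ‖k‖) * (1 + K) with hR
  have hR0 : 0 ≤ R := by positivity
  set C := (2 * R + R ^ 2) + (R ^ 2 * (3 * K ^ 2) +
      3 * K ^ 2 * (4 * R ^ 2 * (3 * R ^ 2) + (1 + 2 * R) * (3 * R ^ 2)) * (3 * K ^ 2)) with hC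
  have hC0 : 0 ≤ C := by positivity
  have main : ∀ n : ℕ, 0 < n → -((((Real.exp C) * ‖u‖) / n) • e) ≤ quadRep M y u := by
    intro n hn
    have hn' : (0 : ℝ) < n := by exact_mod_cast hn
    have hind : ∀ j : ℕ, j ≤ n → ∀ yj, JInv M e (e + ((j : ℝ) / n) • k) yj →
        ∀ u, 0 ≤ u → -((((1 + C / n) ^ j - 1) / n * ‖u‖) • e) ≤ quadRep M yj u := by
      intro j
      induction j with
      | zero =>
        intro _ yj hyj u hu
        have : yj = e := by
          have h1 : JInv M e e e := ⟨h.one_mul e, Commute.refl _⟩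
          simp only [Nat.cast_zero, zero_div, zero_smul, add_zero] at hyj
          exact hyj.unique hJ h1
        rw [this, quadRep_one hJ]
        simpa using hu
      | succ j ih =>
        intro hj y' hy' u hu
        have hj1 : ((j : ℝ) + 1) / n ≤ 1 := by
          rw [div_le_one hn']; exact_mod_cast hj
        have hj0 : ((j : ℝ)) / n ≤ 1 := by
          rw [div_le_one hn']; exact_mod_cast (by omega : j ≤ n)
        obtain ⟨y₀, hy₀, hy₀K⟩ := hseg ((j : ℝ) / n) (by positivity) hj0
        push_cast at hy'
        obtain ⟨y₁, hy₁, hy₁K⟩ := hseg (((j : ℝ) + 1) / n) (by positivity) hj1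
        have hy'K : ‖y'‖ ≤ K := by rw [hy'.unique hJ hy₁]; exact hy₁K
        have hkR : ‖k‖ ≤ R := by
          rw [hR]; nlinarith [norm_nonneg k]
        have hxR : ‖e + ((j : ℝ) / n) • k‖ ≤ R := by
          have : ‖((j : ℝ) / n) • k‖ ≤ 1 * ‖k‖ := by
            rw [norm_smul, Real.norm_eq_abs, abs_of_nonneg (by positivity)]
            gcongr
          refine (norm_add_le _ _).trans ?_
          rw [hR]; nlinarith [norm_nonneg k, he.norm_unit_le]
        have htR : ‖M y₀ k‖ ≤ R := by
          refine (h.norm_mul_le _ _).trans ?_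
          have := mul_le_mul_of_nonneg_right hy₀K (norm_nonneg k)
          rw [hR]; nlinarith [norm_nonneg k]
        have ht : quadRep₂ M (e + ((j : ℝ) / n) • k) k =
            M (M y₀ k) * quadRep M (e + ((j : ℝ) / n) • k) := by
          rcases Nat.eq_zero_or_pos j with rfl | hjp
          · have h1 : JInv M e e e := ⟨h.one_mul e, Commute.refl _⟩
            simp only [Nat.cast_zero, zero_div, zero_smul, add_zero] at hy₀ ⊢
            have : y₀ = e := hy₀.unique hJ h1
            rw [this, quadRep_one hJ, h.one_mul, mul_one]
            simp [quadRep₂, h.map_one]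
          · have hjp' : (0 : ℝ) < j := by exact_mod_cast hjp
            refine h.quadRep₂_eq hy₀ (a := n / j) (b := -(n / j)) ?_
            match_scalars <;> field_simp
            ring
        have hstep := h.quadRep_step he (d := 1 / n) (by positivity)
          (by rw [div_le_one hn']; exact_mod_cast hn) hR0
          (η := ((1 + C / n) ^ j - 1) / n)
          (div_nonneg (sub_nonneg.2 (one_le_pow₀ (by
            have : 0 ≤ C / n := by positivity
            linarith))) hn'.le) hy₀ hy' (by module) ht hxR hkR htR hy₀K hy'K
          (ih (by omega) y₀ hy₀) (C := C) (by rw [hC]; simp; positivity)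
          (by rw [hC]; simp; positivity) u hu
        convert hstep using 4
        rw [pow_succ]
        generalize (1 + C / n) ^ j = q
        field_simp
        ring
    have h1 := hind n le_rfl y (by rw [div_self hn'.ne', hk]; simpa using hxy) u hu
    refine le_trans ?_ h1
    have h2 : (1 + C / n) ^ n ≤ Real.exp C := by
      have := Real.add_one_le_exp (C / n)
      calc (1 + C / n) ^ n ≤ (Real.exp (C / n)) ^ n := by
            gcongr; linarith
        _ = Real.exp C := by rw [← Real.exp_nat_mul]; congr 1; field_simp
    apply neg_le_neg
    apply smul_le_smul_of_nonneg_right _ he.nonneg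
    rw [mul_div_right_comm]
    gcongr
    linarith
  have hlim : Filter.Tendsto (fun n : ℕ => -((((Real.exp C) * ‖u‖) / n) • e)) Filter.atTop
      (𝓝 (-((0 : ℝ) • e))) :=
    ((tendsto_const_div_atTop_nhds_zero_nat _).smul_const e).neg
  simp only [zero_smul, neg_zero] at hlim
  exact he.le_of_tendsto hlim tendsto_const_nhds
    ((Filter.eventually_gt_atTop 0).mono fun n hn => main n hn)

theorem jinv_mem_unitCone [CompleteSpace V] (h : IsJBMul M e) (he : IsNormUnit e) {x y : V}
    (hx : x ∈ unitCone e) (hxy : JInv M e x y) : y ∈ unitCone e := by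
  have hJ := h.toIsJordanMul
  have hp := fun {u : V} => h.quadRep_nonneg he (u := u) hx hxy
  obtain ⟨ε, hε, hxε⟩ := hx
  have h1 := hp (sub_nonneg.2 hxε)
  rw [map_sub, map_smul, hxy.quadRep_apply hJ] at h1
  have h2 := hp (sub_nonneg.2 (he.le_smul (show ‖M x x‖ ≤ ‖M x x‖ + 1 by linarith)))
  rw [map_sub, map_smul, ← quadRep_apply_one hJ, hxy.quadRep_quadRep hJ] at h2
  have hc : 0 < ‖quadRep M x e‖ + 1 := by positivity
  set c := ‖quadRep M x e‖ + 1
  refine ⟨ε / c, by positivity, ?_⟩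
  have hce : (ε / c) * c = ε := by field_simp
  have h3 := smul_le_smul_of_nonneg_left h2 (show 0 ≤ ε / c by positivity)
  rw [smul_sub, smul_smul, hce] at h3
  linear_combination (norm := (apply le_of_eq; module)) h3 + h1

theorem jinv_antitone [CompleteSpace V] (h : IsJBMul M e) (he : IsNormUnit e) {x y x' y' : V}
    (hx : x ∈ unitCone e) (hxy : JInv M e x y) (hxy' : JInv M e x' y') (hle : x ≤ x') :
    y' ≤ y := by
  have hJ := h.toIsJordanMul
  obtain ⟨ε, hε, hxε⟩ := hx
  set k := x' - x with hk
  have hk0 : 0 ≤ k := sub_nonneg.2 hle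
  have hmem : ∀ s : ℝ, 0 ≤ s → ε • e ≤ x + s • k := fun s hs =>
    hxε.trans (by simpa using smul_nonneg hs hk0)
  choose! f hf hfK using fun s hs => h.exists_jinv he hε (hmem s hs)
  set K := ε⁻¹
  have hK0 : 0 ≤ K := (inv_pos.2 hε).le
  set C := (3 * K ^ 2) * ((3 * ‖k‖ ^ 2) * K) with hC
  have main : ∀ n : ℕ, 0 < n → y' ≤ y + (C / n) • e := by
    intro n hn
    have hn' : (0 : ℝ) < n := by exact_mod_cast hn
    have hind : ∀ j : ℕ, f ((j : ℝ) / n) ≤ y + ((j : ℝ) * (C / n ^ 2)) • e := by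
      intro j
      induction j with
      | zero =>
        have : f 0 = y := by
          have := hf 0 le_rfl
          rw [zero_smul, add_zero] at this
          exact this.unique hJ hxy
        simp [this]
      | succ j ih =>
        push_cast
        have p0 : 0 ≤ (j : ℝ) / n := by positivity
        have p1 : 0 ≤ ((j : ℝ) + 1) / n := by positivity
        have h1 := (hf _ p0).sub_eq hJ (hf _ p1)
        have h2 : x + (((j : ℝ) + 1) / n) • k - (x + ((j : ℝ) / n) • k) = (1 / n : ℝ) • k := by
          module
        rw [h2, quadRep_smul, map_sub, map_smul] at h1
        have h3 := h.quadRep_nonneg he ⟨ε, hε, hmem _ p0⟩ (hf _ p0) hk0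
        have h4 : ‖quadRep M (f ((j : ℝ) / n)) (quadRep M k (f (((j : ℝ) + 1) / n)))‖ ≤ C := by
          refine ((quadRep M _).le_opNorm _).trans ?_
          refine mul_le_mul ((h.quadRep_norm_le _).trans ?_) (((quadRep M _).le_opNorm _).trans ?_)
            (norm_nonneg _) (by positivity)
          · have := hfK _ p0; gcongr
          · exact mul_le_mul (h.quadRep_norm_le _) (hfK _ p1) (norm_nonneg _) (by positivity)
        have h5 := he.le_smul h4
        have h6 : (0 : ℝ) ≤ 1 / n := by positivity
        have h7 : (0 : ℝ) ≤ (1 / n) ^ 2 := by positivity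
        rw [smul_apply, map_smul] at h1
        have h8 := h1.le
        have h9 := h1.ge
        linear_combination (norm := (apply le_of_eq; match_scalars <;> field_simp <;> ring))
          ih + h9 + (1 / n : ℝ) • h3 + ((1 / n : ℝ) ^ 2) • h5
    have h1 := hind n
    have h2 : f ((n : ℝ) / n) = y' := by
      have := hf 1 zero_le_one
      rw [one_smul, hk, add_sub_cancel] at this
      rw [div_self hn'.ne']
      exact this.unique hJ hxy'
    rw [h2] at h1
    have h3 : (n : ℝ) * (C / n ^ 2) = C / n := by field_simp
    rwa [h3] at h1
  have hlim : Filter.Tendsto (fun n : ℕ => y + (C / n) • e) Filter.atTop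
      (𝓝 (y + ((0 : ℝ) • e))) :=
    ((tendsto_const_div_atTop_nhds_zero_nat _).smul_const e).const_add y
  simp only [zero_smul, add_zero] at hlim
  exact he.le_of_tendsto tendsto_const_nhds hlim
    ((Filter.eventually_gt_atTop 0).mono fun n hn => main n hn)

/-- The inverse map of a JB-algebra is gauge-reversing. -/
theorem exists_gaugeReversing [CompleteSpace V] (h : IsJBMul M e) (he : IsNormUnit e) :
    ∃ Φ : V → V, Set.BijOn Φ (unitCone e) (unitCone e) ∧
      (∀ x ∈ unitCone e, ∀ r : ℝ, 0 < r → Φ (r • x) = r⁻¹ • Φ x) ∧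
      (∀ x ∈ unitCone e, ∀ y ∈ unitCone e, (x ≤ y ↔ Φ y ≤ Φ x)) := by
  have hJ := h.toIsJordanMul
  have hex : ∀ x ∈ unitCone e, ∃ y, JInv M e x y := by
    rintro x ⟨ε, hε, hx⟩
    obtain ⟨y, hy, -⟩ := h.exists_jinv he hε hx
    exact ⟨y, hy⟩
  choose! Φ hΦ using hex
  have hmem : ∀ x ∈ unitCone e, Φ x ∈ unitCone e := fun x hx => h.jinv_mem_unitCone he hx (hΦ x hx)
  have hinv : ∀ x ∈ unitCone e, Φ (Φ x) = x := fun x hx =>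
    (hΦ _ (hmem x hx)).unique hJ ((hΦ x hx).symm hJ)
  refine ⟨Φ, ⟨hmem, ?_, ?_⟩, ?_, ?_⟩
  · intro x hx y hy hxy
    rw [← hinv x hx, hxy, hinv y hy]
  · intro x hx
    exact ⟨Φ x, hmem x hx, hinv x hx⟩
  · intro x hx r hr
    exact (hΦ _ (unitCone.smul_mem hx hr)).unique hJ ((hΦ x hx).smul hr.ne')
  · intro x hx y hy
    refine ⟨fun hle => h.jinv_antitone he hx (hΦ x hx) (hΦ y hy) hle, fun hle => ?_⟩
    exact h.jinv_antitone he (hmem y hy) ((hΦ y hy).symm hJ) ((hΦ x hx).symm hJ) hle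

end IsJBMul

end JBForward

section NormDerivative

variable {V : Type*} [NormedAddCommGroup V] [NormedSpace ℝ V]

theorem norm_add_smul_ge_of_hasDerivAt {c u : V} {l : ℝ}
    (h : HasDerivAt (fun s : ℝ => ‖c + s • u‖) l 0) {s : ℝ} (hs : 0 < s) :
    ‖c‖ + s * l ≤ ‖c + s • u‖ := by
  have hc : ConvexOn ℝ Set.univ (fun s : ℝ => ‖c + s • u‖) := by
    have := (convexOn_univ_norm (E := V)).comp_affineMap (AffineMap.lineMap (k := ℝ) c (c + u))
    simpa [Function.comp_def, AffineMap.lineMap_apply, add_comm] using this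
  have := hc.le_slope_of_hasDerivAt (Set.mem_univ 0) (Set.mem_univ s) hs h
  rw [slope_def_field, le_div_iff₀ (by simpa using hs)] at this
  simp only [sub_zero, zero_smul, add_zero] at this
  linarith

theorem eventually_norm_add_smul_le_of_hasDerivAt {c u : V} {l : ℝ}
    (h : HasDerivAt (fun s : ℝ => ‖c + s • u‖) l 0) {η : ℝ} (hη : 0 < η) :
    ∀ᶠ s in 𝓝[>] (0 : ℝ), ‖c + s • u‖ ≤ ‖c‖ + s * (l + η) := by
  have h1 := (hasDerivAt_iff_tendsto_slope_left_right.1 h).2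
  have h2 := h1.eventually (gt_mem_nhds (show l < l + η by linarith))
  filter_upwards [h2, self_mem_nhdsWithin] with s hs hs0
  have hs0' : (0 : ℝ) < s := hs0
  rw [slope_def_field, div_lt_iff₀ (by simpa using hs0')] at hs
  simp only [sub_zero, zero_smul, add_zero] at hs
  linarith

variable [PartialOrder V] [IsOrderedAddMonoid V] [IsOrderedModule ℝ V] {e : V}

/-- An element which is dominated by `(α + β) w` whenever `a ≤ α w` and `b ≤ β w` is dominated
by `a + b`. -/
theorem IsNormUnit.le_add_of_gauge_le (he : IsNormUnit e) {a b z : V} (ha : 0 ≤ a) (hb : 0 ≤ b)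
    (hz : 0 ≤ z) (h : ∀ w ∈ unitCone e, ∀ α β : ℝ, 0 < α → 0 < β → a ≤ α • w → b ≤ β • w →
      z ≤ (α + β) • w) : z ≤ a + b := by
  set f := z - a - b with hf
  suffices f ≤ 0 by
    rw [hf] at this
    rw [← sub_nonpos]
    exact le_trans (le_of_eq (by abel)) this
  set R := ‖f‖ + 1 with hR
  have hR0 : 0 < R := by positivity
  set c₀ := f + R • e with hc₀
  by_contra hcon
  have hlt : R < ‖c₀‖ := by
    by_contra hle
    refine hcon ?_
    have := he.le_smul (not_lt.mp hle)
    rw [hc₀] at this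
    simpa using this
  have hc₀e : (1 : ℝ) • e ≤ c₀ := by
    have := he.neg_le_norm f
    rw [hc₀, hR]
    linear_combination (norm := (apply le_of_eq; module)) this
  set g : ℝ × ℝ × ℝ → V := fun p => c₀ + (p.1 • z + p.2.1 • a + p.2.2 • b) with hg
  have hLip : LipschitzWith (‖z‖₊ + ‖a‖₊ + ‖b‖₊) (fun p => ‖g p‖) := by
    refine LipschitzWith.of_dist_le_mul fun p q => ?_
    rw [Real.dist_eq]
    refine (abs_norm_sub_norm_le _ _).trans ?_
    have h1 : g p - g q = (p.1 - q.1) • z + (p.2.1 - q.2.1) • a + (p.2.2 - q.2.2) • b := by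
      rw [hg]; module
    rw [h1, dist_eq_norm]
    have n1 : ‖p.1 - q.1‖ ≤ ‖p - q‖ := norm_fst_le (p - q)
    have n2 : ‖p.2.1 - q.2.1‖ ≤ ‖p - q‖ := (norm_fst_le (p - q).2).trans (norm_snd_le (p - q))
    have n3 : ‖p.2.2 - q.2.2‖ ≤ ‖p - q‖ := (norm_snd_le (p - q).2).trans (norm_snd_le (p - q))
    refine (norm_add₃_le).trans ?_
    rw [norm_smul, norm_smul, norm_smul]
    push_cast
    nlinarith [norm_nonneg z, norm_nonneg a, norm_nonneg b]
  have hdense := MeasureTheory.Measure.dense_of_ae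
    (hLip.ae_differentiableAt (μ := MeasureTheory.Measure.addHaar))
  have hcont : Continuous g := by rw [hg]; fun_prop
  set ρ := min ((‖c₀‖ - R) / 4) (1 / 2) with hρ
  have hρ0 : 0 < ρ := lt_min (by linarith) (by norm_num)
  have hopen : IsOpen (g ⁻¹' Metric.ball c₀ ρ) := Metric.isOpen_ball.preimage hcont
  obtain ⟨p, hpb, hpd⟩ := hdense.inter_open_nonempty _ hopen ⟨0, by simp [hg, hρ0]⟩
  set c := g p with hc
  have hcb : ‖c - c₀‖ < ρ := by rw [← dist_eq_norm]; exact hpb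
  have hc0 : 0 ≤ c := by
    have h1 := he.neg_le_smul (hcb.le.trans (min_le_right _ _))
    have h2 := smul_nonneg (show (0 : ℝ) ≤ 1 / 2 by norm_num) he.nonneg
    linear_combination (norm := (apply le_of_eq; module)) h1 + hc₀e + h2
  set D := fderiv ℝ (fun p => ‖g p‖) p with hD
  have hder : ∀ q : ℝ × ℝ × ℝ, HasDerivAt
      (fun s : ℝ => ‖c + s • (q.1 • z + q.2.1 • a + q.2.2 • b)‖) (D q) 0 := by
    intro q
    have h1 : HasFDerivAt (fun p => ‖g p‖) D (p + (0 : ℝ) • q) := by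
      rw [zero_smul, add_zero]; exact hpd.hasFDerivAt
    have h2 : HasDerivAt (fun s : ℝ => p + s • q) q 0 := by
      simpa using ((hasDerivAt_id (0 : ℝ)).smul_const q).const_add p
    have h3 := h1.comp_hasDerivAt (0 : ℝ) h2
    refine h3.congr_of_eventuallyEq (Filter.Eventually.of_forall fun s => ?_)
    simp only [hc, hg, Function.comp_apply, Prod.fst_add, Prod.smul_fst, Prod.snd_add, Prod.smul_snd,
      smul_eq_mul]
    congr 1; module
  set lz := D (1, 0, 0) with hlz
  set la := D (0, 1, 0) with hla
  set lb := D (0, 0, 1) with hlb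
  have dz : HasDerivAt (fun s : ℝ => ‖c + s • z‖) lz 0 := by simpa using hder (1, 0, 0)
  have da : HasDerivAt (fun s : ℝ => ‖c + s • a‖) la 0 := by simpa using hder (0, 1, 0)
  have db : HasDerivAt (fun s : ℝ => ‖c + s • b‖) lb 0 := by simpa using hder (0, 0, 1)
  have df : HasDerivAt (fun s : ℝ => ‖c + s • -f‖) (-(lz - la - lb)) 0 := by
    have h1 := hder (-1, 1, 1)
    have h2 : D (-1, 1, 1) = -(lz - la - lb) := by
      rw [hlz, hla, hlb, ← map_sub, ← map_sub, ← map_neg]; simp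
    rw [h2] at h1
    convert h1 using 5
    rw [hf]; simp; abel
  have hnn : ∀ {u : V} {l : ℝ}, 0 ≤ u → HasDerivAt (fun s : ℝ => ‖c + s • u‖) l 0 → 0 ≤ l := by
    intro u l hu hd
    by_contra hl
    have := eventually_norm_add_smul_le_of_hasDerivAt hd (η := -l / 2) (by linarith)
    obtain ⟨s, hs, hs0⟩ := (this.and self_mem_nhdsWithin).exists
    have hs0' : (0 : ℝ) < s := hs0
    have := he.norm_mono hc0 (show c ≤ c + s • u by simpa using smul_nonneg hs0'.le hu)
    nlinarith
  have hlf : 0 < lz - la - lb := by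
    have h1 := norm_add_smul_ge_of_hasDerivAt df one_pos
    have h2 : ‖c + (1 : ℝ) • -f‖ ≤ R + ρ := by
      have : c + (1 : ℝ) • -f = R • e + (c - c₀) := by rw [hc₀]; module
      rw [this]
      refine (norm_add_le _ _).trans (add_le_add ?_ hcb.le)
      rw [norm_smul, Real.norm_eq_abs, abs_of_pos hR0]
      have := he.norm_unit_le
      nlinarith
    have h3 : ‖c₀‖ - ρ ≤ ‖c‖ := by
      have := norm_sub_norm_le c₀ c
      rw [norm_sub_rev] at this
      linarith
    have h4 : ρ ≤ (‖c₀‖ - R) / 4 := min_le_left _ _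
    linarith
  set η := (lz - la - lb) / 4 with hη
  have hη0 : 0 < η := by positivity
  have la0 := hnn ha da
  have lb0 := hnn hb db
  have hA : 0 < la + η := by linarith
  have hB : 0 < lb + η := by linarith
  have hscale : ∀ {r : ℝ}, 0 < r →
      Filter.Tendsto (fun t : ℝ => t / r) (𝓝[>] 0) (𝓝[>] 0) := by
    intro r hr
    refine tendsto_nhdsWithin_iff.2 ⟨?_, ?_⟩
    · have : Filter.Tendsto (fun t : ℝ => t / r) (𝓝 0) (𝓝 (0 / r)) :=
        Filter.tendsto_id.div_const r
      rw [zero_div] at this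
      exact this.mono_left nhdsWithin_le_nhds
    · filter_upwards [self_mem_nhdsWithin] with t ht
      exact div_pos ht hr
  have e1 := (hscale hA).eventually (eventually_norm_add_smul_le_of_hasDerivAt da hη0)
  have e2 := (hscale hB).eventually (eventually_norm_add_smul_le_of_hasDerivAt db hη0)
  obtain ⟨t, ⟨h1, h2⟩, ht⟩ := ((e1.and e2).and self_mem_nhdsWithin).exists
  have ht0 : (0 : ℝ) < t := ht
  rw [div_mul_cancel₀ _ hA.ne'] at h1
  rw [div_mul_cancel₀ _ hB.ne'] at h2
  set w := (‖c‖ + t) • e - c with hw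
  have hwC : w ∈ unitCone e := by
    refine ⟨t, ht0, ?_⟩
    have := he.le_norm c
    rw [hw]
    linear_combination (norm := (apply le_of_eq; module)) this
  have gen : ∀ {u : V} {r : ℝ}, 0 < r → ‖c + (t / r) • u‖ ≤ ‖c‖ + t → u ≤ (r / t) • w := by
    intro u r hr hle
    have h3 := he.le_smul hle
    have h4 := smul_le_smul_of_nonneg_left h3 (show 0 ≤ r / t by positivity)
    rw [smul_add, smul_smul, show r / t * (t / r) = 1 by field_simp] at h4
    rw [hw]
    linear_combination (norm := (apply le_of_eq; module)) h4
  have k1 := gen hA h1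
  have k2 := gen hB h2
  have k3 := h w hwC _ _ (by positivity) (by positivity) k1 k2
  set r := la + η + (lb + η) with hr
  have hr0 : 0 < r := by positivity
  rw [← add_div] at k3
  have k4 : c + (t / r) • z ≤ (‖c‖ + t) • e := by
    have h4 := smul_le_smul_of_nonneg_left k3 (show 0 ≤ t / r by positivity)
    rw [smul_smul, show t / r * (r / t) = 1 by field_simp, hw] at h4
    linear_combination (norm := (apply le_of_eq; module)) h4
  have k5 := he.norm_le_of_nonneg (by positivity)
    (add_nonneg hc0 (smul_nonneg (by positivity : 0 ≤ t / r) hz)) k4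
  have k6 := norm_add_smul_ge_of_hasDerivAt dz (show 0 < t / r by positivity)
  have k7 : t / r * lz ≤ t := by linarith
  rw [div_mul_eq_mul_div, div_le_iff₀ hr0] at k7
  have k8 := le_of_mul_le_mul_left k7 ht0
  rw [hr] at k8
  linarith

end NormDerivative

section ConvexDifferentiability

variable {V : Type*} [NormedAddCommGroup V] [NormedSpace ℝ V] [CompleteSpace V]
  [PartialOrder V] [IsOrderedAddMonoid V] [IsOrderedModule ℝ V] {e : V}

/-- A locally convex map whose symmetrized increments are `o(‖u‖)` is differentiable. -/
theorem IsNormUnit.exists_hasFDerivAt_of_convex (he : IsNormUnit e) {R : V → V} {δ C : ℝ}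
    (hδ : 0 < δ) (h0 : R 0 = 0)
    (hconv : ∀ u v : V, ‖u‖ < δ → ‖v‖ < δ → ∀ s t : ℝ, 0 < s → 0 < t → s + t = 1 →
      R (s • u + t • v) ≤ s • R u + t • R v)
    (hlip : ∀ u : V, ‖u‖ < δ → ‖R u‖ ≤ C * ‖u‖)
    (hsym : ∀ ε : ℝ, 0 < ε → ∃ ρ : ℝ, 0 < ρ ∧ ∀ u : V, ‖u‖ < ρ → ‖R u + R (-u)‖ ≤ ε * ‖u‖) :
    ∃ D : V →L[ℝ] V, HasFDerivAt R D 0 := by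
  have hstar : ∀ u : V, ‖u‖ < δ → ∀ s : ℝ, 0 < s → s < 1 → R (s • u) ≤ s • R u := by
    intro u hu s hs hs1
    have := hconv u 0 hu (by simpa using hδ) s (1 - s) hs (by linarith) (by ring)
    simpa [h0] using this
  have hq0 : ∀ u : V, ‖u‖ < δ → 0 ≤ R u + R (-u) := by
    intro u hu
    have := hconv u (-u) hu (by simpa using hu) (1/2) (1/2) (by norm_num) (by norm_num)
      (by norm_num)
    rw [smul_neg, add_neg_cancel, h0] at this
    refine nonneg_of_smul_nonneg' (show (0 : ℝ) < 1 / 2 by norm_num) ?_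
    rwa [smul_add]
  have hquot : ∀ u : V, ‖u‖ < δ → ∀ s : ℝ, 0 < s → s < 1 →
      ‖s⁻¹ • R (s • u) - R u‖ ≤ ‖R u + R (-u)‖ := by
    intro u hu s hs hs1
    have hsu : ‖s • u‖ < δ := by
      rw [norm_smul, Real.norm_eq_abs, abs_of_pos hs]
      nlinarith [norm_nonneg u]
    rw [norm_sub_rev]
    refine he.norm_mono ?_ ?_
    · have := hstar u hu s hs hs1
      have h1 := smul_le_smul_of_nonneg_left this (inv_nonneg.2 hs.le)
      rw [smul_smul, inv_mul_cancel₀ hs.ne', one_smul] at h1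
      exact sub_nonneg.2 h1
    · have h1 := hq0 (s • u) hsu
      have h2 := hstar (-u) (by simpa using hu) s hs hs1
      rw [smul_neg] at h2
      have h3 := smul_le_smul_of_nonneg_left (h1.trans (add_le_add_right h2 _)) (inv_nonneg.2 hs.le)
      rw [smul_zero, smul_add, smul_smul, inv_mul_cancel₀ hs.ne', one_smul] at h3
      linear_combination (norm := (apply le_of_eq; module)) h3
  have hsmall : ∀ u : V, ∀ r : ℝ, 0 < r → ∃ s₀ : ℝ, 0 < s₀ ∧ ∀ s, 0 < s → s ≤ s₀ → ‖s • u‖ < r := by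
    intro u r hr
    refine ⟨r / (‖u‖ + 1), by positivity, fun s hs hs' => ?_⟩
    rw [norm_smul, Real.norm_eq_abs, abs_of_pos hs]
    rw [le_div_iff₀ (by positivity)] at hs'
    nlinarith
  have hlim : ∀ u : V, ∃ L : V, Filter.Tendsto (fun s : ℝ => s⁻¹ • R (s • u)) (𝓝[>] 0) (𝓝 L) := by
    intro u
    refine cauchy_map_iff_exists_tendsto.1 (Metric.cauchy_iff.2 ⟨inferInstance, fun η hη => ?_⟩)
    obtain ⟨ρ, hρ, hρq⟩ := hsym (η / (4 * (‖u‖ + 1))) (by positivity)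
    obtain ⟨s₀, hs₀, hs₀u⟩ := hsmall u (min ρ δ) (lt_min hρ hδ)
    have hs := hs₀u s₀ hs₀ le_rfl
    have hball : ∀ s, 0 < s → s < s₀ →
        ‖s⁻¹ • R (s • u) - s₀⁻¹ • R (s₀ • u)‖ ≤ η / 4 := by
      intro s hs1 hs2
      have h1 := hquot (s₀ • u) (hs.trans_le (min_le_right _ _)) (s / s₀) (by positivity)
        (by rwa [div_lt_one hs₀])
      have h2 := hρq (s₀ • u) (hs.trans_le (min_le_left _ _))
      rw [smul_smul, div_mul_cancel₀ _ hs₀.ne'] at h1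
      have h3 : s⁻¹ • R (s • u) - s₀⁻¹ • R (s₀ • u) =
          s₀⁻¹ • ((s / s₀)⁻¹ • R (s • u) - R (s₀ • u)) := by
        match_scalars <;> field_simp
      rw [h3, norm_smul, Real.norm_eq_abs, abs_of_pos (inv_pos.2 hs₀), inv_mul_le_iff₀ hs₀]
      refine (h1.trans h2).trans ?_
      rw [norm_smul, Real.norm_eq_abs, abs_of_pos hs₀, div_mul_eq_mul_div,
        div_le_iff₀ (by positivity)]
      have : 0 ≤ s₀ * η := by positivity
      nlinarith [norm_nonneg u]
    refine ⟨(fun s : ℝ => s⁻¹ • R (s • u)) '' Set.Ioo 0 s₀,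
      Filter.image_mem_map (Ioo_mem_nhdsGT hs₀), ?_⟩
    rintro _ ⟨s, ⟨hs1, hs2⟩, rfl⟩ _ ⟨s', ⟨hs1', hs2'⟩, rfl⟩
    rw [dist_eq_norm]
    have h1 := hball s hs1 hs2
    have h2 := hball s' hs1' hs2'
    have := norm_sub_le_norm_sub_add_norm_sub (s⁻¹ • R (s • u)) (s₀⁻¹ • R (s₀ • u))
      (s'⁻¹ • R (s' • u))
    rw [norm_sub_rev (s₀⁻¹ • R (s₀ • u))] at this
    linarith
  choose D hD using hlim
  have hDpos : ∀ u : V, ∀ r : ℝ, 0 < r → D (r • u) = r • D u := by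
    intro u r hr
    have h1 : Filter.Tendsto (fun s : ℝ => s * r) (𝓝[>] 0) (𝓝[>] 0) := by
      refine tendsto_nhdsWithin_iff.2 ⟨?_, ?_⟩
      · have : Filter.Tendsto (fun t : ℝ => t * r) (𝓝 0) (𝓝 (0 * r)) :=
          Filter.tendsto_id.mul_const r
        rw [zero_mul] at this
        exact this.mono_left nhdsWithin_le_nhds
      · filter_upwards [self_mem_nhdsWithin] with t ht
        exact mul_pos ht hr
    have h2 := ((hD u).comp h1).const_smul r
    refine tendsto_nhds_unique (hD (r • u)) (h2.congr' ?_)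
    filter_upwards [self_mem_nhdsWithin] with t ht
    have ht' : (0 : ℝ) < t := ht
    simp only [Function.comp_apply, smul_smul]
    congr 1
    field_simp
  have hDneg : ∀ u : V, D (-u) = -D u := by
    intro u
    rw [← add_eq_zero_iff_eq_neg]
    refine tendsto_nhds_unique ((hD (-u)).add (hD u)) ?_
    rw [tendsto_zero_iff_norm_tendsto_zero, Metric.tendsto_nhds]
    intro η hη
    obtain ⟨ρ, hρ, hρq⟩ := hsym (η / (2 * (‖u‖ + 1))) (by positivity)
    obtain ⟨s₀, hs₀, hs₀u⟩ := hsmall u ρ hρ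
    filter_upwards [Ioo_mem_nhdsGT hs₀] with s hs
    have h1 := hρq (s • u) (hs₀u s hs.1 hs.2.le)
    rw [dist_zero_right, norm_norm, smul_neg, ← smul_add, norm_smul, Real.norm_eq_abs,
      abs_of_pos (inv_pos.2 hs.1), inv_mul_lt_iff₀ hs.1, add_comm]
    refine h1.trans_lt ?_
    rw [norm_smul, Real.norm_eq_abs, abs_of_pos hs.1, div_mul_eq_mul_div,
      div_lt_iff₀ (by positivity)]
    have := mul_pos hs.1 hη
    nlinarith [norm_nonneg u]
  have hDsub : ∀ u v : V, D (u + v) ≤ D u + D v := by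
    intro u v
    have h1 := (hD ((2 : ℝ) • u)).add (hD ((2 : ℝ) • v))
    rw [hDpos u 2 two_pos, hDpos v 2 two_pos] at h1
    have h2 := h1.const_smul (1 / 2 : ℝ)
    have h3 : (1 / 2 : ℝ) • ((2 : ℝ) • D u + (2 : ℝ) • D v) = D u + D v := by module
    rw [h3] at h2
    refine he.le_of_tendsto (hD (u + v)) h2 ?_
    obtain ⟨s₁, hs₁, hs₁u⟩ := hsmall ((2 : ℝ) • u) δ hδ
    obtain ⟨s₂, hs₂, hs₂u⟩ := hsmall ((2 : ℝ) • v) δ hδ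
    filter_upwards [Ioo_mem_nhdsGT hs₁, Ioo_mem_nhdsGT hs₂] with s hs hs'
    have h4 := hconv _ _ (hs₁u s hs.1 hs.2.le) (hs₂u s hs'.1 hs'.2.le) (1 / 2) (1 / 2)
      (by norm_num) (by norm_num) (by norm_num)
    have h5 : (1 / 2 : ℝ) • s • (2 : ℝ) • u + (1 / 2 : ℝ) • s • (2 : ℝ) • v = s • (u + v) := by
      module
    rw [h5] at h4
    have h6 := smul_le_smul_of_nonneg_left h4 (inv_nonneg.2 hs.1.le)
    linear_combination (norm := (apply le_of_eq; module)) h6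
  have hDadd : ∀ u v : V, D (u + v) = D u + D v := by
    intro u v
    refine le_antisymm (hDsub u v) ?_
    have := hDsub (-u) (-v)
    rw [← neg_add, hDneg, hDneg, hDneg] at this
    rw [← neg_add] at this
    exact neg_le_neg_iff.mp this
  have hD0 : D 0 = 0 := by simpa using hDadd 0 0
  have hDsmul : ∀ (r : ℝ) (u : V), D (r • u) = r • D u := by
    intro r u
    rcases lt_trichotomy r 0 with h | h | h
    · have := hDpos (-u) (-r) (by linarith)
      rw [smul_neg, neg_smul, neg_neg, hDneg] at this
      rw [this]; module
    · simp [h, hD0]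
    · exact hDpos u r h
  have hDle : ∀ u : V, ‖D u‖ ≤ C * ‖u‖ := by
    intro u
    refine _root_.le_of_tendsto (hD u).norm ?_
    obtain ⟨s₀, hs₀, hs₀u⟩ := hsmall u δ hδ
    filter_upwards [Ioo_mem_nhdsGT hs₀] with s hs
    have h1 := hlip _ (hs₀u s hs.1 hs.2.le)
    rw [norm_smul, Real.norm_eq_abs, abs_of_pos (inv_pos.2 hs.1), inv_mul_le_iff₀ hs.1]
    rw [norm_smul, Real.norm_eq_abs, abs_of_pos hs.1] at h1
    linarith
  let D' : V →L[ℝ] V := LinearMap.mkContinuous ⟨⟨D, hDadd⟩, hDsmul⟩ C hDle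
  have hD' : ∀ u, D' u = D u := fun u => rfl
  refine ⟨D', ?_⟩
  rw [hasFDerivAt_iff_isLittleO_nhds_zero, Asymptotics.isLittleO_iff]
  intro c hc
  obtain ⟨ρ, hρ, hρq⟩ := hsym c hc
  have : Metric.ball (0 : V) (min ρ δ) ∈ 𝓝 (0 : V) := Metric.ball_mem_nhds _ (lt_min hρ hδ)
  filter_upwards [this] with u hu
  rw [mem_ball_zero_iff] at hu
  rw [zero_add, h0, sub_zero, hD', norm_sub_rev]
  refine le_trans ?_ (hρq u (hu.trans_le (min_le_left _ _)))
  refine _root_.le_of_tendsto ((hD u).sub_const (R u)).norm ?_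
  filter_upwards [Ioo_mem_nhdsGT one_pos] with s hs
  exact hquot u (hu.trans_le (min_le_right _ _)) s hs.1 hs.2

end ConvexDifferentiability

section GaugeMaps

variable {V : Type*} [NormedAddCommGroup V] [NormedSpace ℝ V]
  [PartialOrder V] [IsOrderedAddMonoid V] [IsOrderedModule ℝ V] {e : V}

/-- A gauge-preserving bijection of the open cone onto itself. -/
structure IsGaugePres (e : V) (f : V → V) : Prop where
  bij : Set.BijOn f (unitCone e) (unitCone e)
  map_smul : ∀ x ∈ unitCone e, ∀ r : ℝ, 0 < r → f (r • x) = r • f x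
  le_iff : ∀ x ∈ unitCone e, ∀ y ∈ unitCone e, (x ≤ y ↔ f x ≤ f y)

/-- A gauge-reversing bijection of the open cone onto itself. -/
structure IsGaugeRev (e : V) (f : V → V) : Prop where
  bij : Set.BijOn f (unitCone e) (unitCone e)
  map_smul : ∀ x ∈ unitCone e, ∀ r : ℝ, 0 < r → f (r • x) = r⁻¹ • f x
  le_iff : ∀ x ∈ unitCone e, ∀ y ∈ unitCone e, (x ≤ y ↔ f y ≤ f x)

namespace IsGaugePres

variable {f g : V → V}

theorem mem (hf : IsGaugePres e f) {x : V} (hx : x ∈ unitCone e) : f x ∈ unitCone e :=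
  hf.bij.mapsTo hx

theorem map_add (hf : IsGaugePres e f) (he : IsNormUnit e) {x y : V} (hx : x ∈ unitCone e)
    (hy : y ∈ unitCone e) : f (x + y) = f x + f y := by
  have hxy := unitCone.add_mem he hx hy
  refine le_antisymm ?_ ?_
  · refine he.le_add_of_gauge_le (unitCone.nonneg he (hf.mem hx)) (unitCone.nonneg he (hf.mem hy))
      (unitCone.nonneg he (hf.mem hxy)) fun w hw α β hα hβ h1 h2 => ?_
    obtain ⟨q, hq, rfl⟩ := hf.bij.surjOn hw
    rw [← hf.map_smul q hq _ hα, ← hf.le_iff _ hx _ (unitCone.smul_mem hq hα)] at h1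
    rw [← hf.map_smul q hq _ hβ, ← hf.le_iff _ hy _ (unitCone.smul_mem hq hβ)] at h2
    have h3 : 0 < α + β := by positivity
    rw [← hf.map_smul q hq _ h3, ← hf.le_iff _ hxy _ (unitCone.smul_mem hq h3), add_smul]
    exact add_le_add h1 h2
  · have hs := unitCone.add_mem he (hf.mem hx) (hf.mem hy)
    obtain ⟨z, hz, hzs⟩ := hf.bij.surjOn hs
    rw [← hzs, ← hf.le_iff _ hz _ hxy]
    refine he.le_add_of_gauge_le (unitCone.nonneg he hx) (unitCone.nonneg he hy)
      (unitCone.nonneg he hz) fun w hw α β hα hβ h1 h2 => ?_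
    rw [hf.le_iff _ hx _ (unitCone.smul_mem hw hα), hf.map_smul w hw _ hα] at h1
    rw [hf.le_iff _ hy _ (unitCone.smul_mem hw hβ), hf.map_smul w hw _ hβ] at h2
    have h3 : 0 < α + β := by positivity
    rw [hf.le_iff _ hz _ (unitCone.smul_mem hw h3), hf.map_smul w hw _ h3, hzs, add_smul]
    exact add_le_add h1 h2

theorem eqOn_of_hasFDerivAt (hf : IsGaugePres e f) (he : IsNormUnit e) {A : V →L[ℝ] V} {p : V}
    (hp : p ∈ unitCone e) (hA : HasFDerivAt f A p) {z : V} (hz : z ∈ unitCone e) : f z = A z := by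
  have h1 : HasDerivAt (fun t : ℝ => p + t • z) z 0 := by
    simpa using ((hasDerivAt_id (0 : ℝ)).smul_const z).const_add p
  have h2 : HasFDerivAt f A (p + (0 : ℝ) • z) := by simpa using hA
  have h3 := (h2.comp_hasDerivAt (0 : ℝ) h1).hasDerivWithinAt (s := Set.Ioi 0)
  have h4 : HasDerivAt (fun t : ℝ => f p + t • f z) (f z) 0 := by
    simpa using ((hasDerivAt_id (0 : ℝ)).smul_const (f z)).const_add (f p)
  have h5 := h4.hasDerivWithinAt (s := Set.Ioi 0)
  have h6 : HasDerivWithinAt (fun t : ℝ => f p + t • f z) (A z) (Set.Ioi 0) 0 := by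
    refine h3.congr (fun t ht => ?_) (by simp)
    rw [Function.comp_apply, hf.map_add he hp (unitCone.smul_mem hz ht), hf.map_smul z hz t ht]
  exact (uniqueDiffWithinAt_Ioi (0 : ℝ)).eq_deriv _ h5 h6

end IsGaugePres

namespace IsGaugeRev

variable {f g : V → V}

theorem mem (hf : IsGaugeRev e f) {x : V} (hx : x ∈ unitCone e) : f x ∈ unitCone e :=
  hf.bij.mapsTo hx

theorem convex (hf : IsGaugeRev e f) (he : IsNormUnit e) {x y : V} (hx : x ∈ unitCone e)
    (hy : y ∈ unitCone e) {s t : ℝ} (hs : 0 < s) (ht : 0 < t) (hst : s + t = 1) :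
    f (s • x + t • y) ≤ s • f x + t • f y := by
  have hxy := unitCone.add_mem he (unitCone.smul_mem hx hs) (unitCone.smul_mem hy ht)
  refine he.le_add_of_gauge_le (smul_nonneg hs.le (unitCone.nonneg he (hf.mem hx)))
      (smul_nonneg ht.le (unitCone.nonneg he (hf.mem hy)))
      (unitCone.nonneg he (hf.mem hxy)) fun w hw α β hα hβ h1 h2 => ?_
  obtain ⟨q, hq, rfl⟩ := hf.bij.surjOn hw
  have key : ∀ {x : V} {r a : ℝ}, x ∈ unitCone e → 0 < r → 0 < a → r • f x ≤ a • f q →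
      (r / a) • q ≤ x := by
    intro x r a hx hr ha h
    have h3 := smul_le_smul_of_nonneg_left h (inv_nonneg.2 hr.le)
    have hra : 0 < r / a := by positivity
    rw [smul_smul, inv_mul_cancel₀ hr.ne', one_smul, smul_smul,
      show r⁻¹ * a = (r / a)⁻¹ by field_simp, ← hf.map_smul q hq _ hra,
      ← hf.le_iff _ (unitCone.smul_mem hq hra) _ hx] at h3
    exact h3
  have k1 := key hx hs hα h1
  have k2 := key hy ht hβ h2
  set c := s * (s / α) + t * (t / β) with hc
  have hc0 : 0 < c := by positivity
  have k3 : c • q ≤ s • x + t • y := by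
    linear_combination (norm := (apply le_of_eq; module)) s • k1 + t • k2
  rw [hf.le_iff _ (unitCone.smul_mem hq hc0) _ hxy, hf.map_smul q hq _ hc0] at k3
  refine k3.trans (smul_le_smul_of_nonneg_right ?_ (unitCone.nonneg he (hf.mem hq)))
  rw [inv_le_iff_one_le_mul₀ hc0, hc]
  have h4 : (α + β) * (s * (s / α) + t * (t / β)) - 1 = (s * β - t * α) ^ 2 / (α * β) := by
    have : (1 : ℝ) = (s + t) ^ 2 := by rw [hst]; norm_num
    rw [this]; field_simp; ring
  have h5 : 0 ≤ (s * β - t * α) ^ 2 / (α * β) := by positivity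
  linarith

theorem le_half_smul (hf : IsGaugeRev e f) {x u w : V} (hx : x ∈ unitCone e)
    (hxu : x + u ∈ unitCone e) (hxu' : x - u ∈ unitCone e) (hw : w ∈ unitCone e) {α β : ℝ}
    (hα : 0 < α) (hβ : 0 < β) (h1 : w ≤ α • f (x + u)) (h2 : w ≤ β • f (x - u)) :
    w ≤ ((α + β) / 2) • f x := by
  obtain ⟨q, hq, rfl⟩ := hf.bij.surjOn hw
  have key : ∀ {x : V} {a : ℝ}, x ∈ unitCone e → 0 < a → (f q ≤ a • f x ↔ x ≤ a • q) := by
    intro x a hx ha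
    have h3 := hf.map_smul x hx a⁻¹ (inv_pos.2 ha)
    rw [inv_inv] at h3
    rw [← h3, ← hf.le_iff _ (unitCone.smul_mem hx (inv_pos.2 ha)) _ hq]
    constructor
    · intro h
      have := smul_le_smul_of_nonneg_left h ha.le
      rwa [smul_smul, mul_inv_cancel₀ ha.ne', one_smul] at this
    · intro h
      have := smul_le_smul_of_nonneg_left h (inv_nonneg.2 ha.le)
      rwa [smul_smul, inv_mul_cancel₀ ha.ne', one_smul] at this
  rw [key hxu hα] at h1
  rw [key hxu' hβ] at h2
  rw [key hx (by positivity)]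
  linear_combination (norm := (apply le_of_eq; module)) (1 / 2 : ℝ) • h1 + (1 / 2 : ℝ) • h2

/-- The bound for symmetrized increments obtained after `m` steps. -/
theorem symm_increment_step (hf : IsGaugeRev e f) (he : IsNormUnit e) {x u : V}
    (hx : x ∈ unitCone e) (hxu : x + u ∈ unitCone e) (hxu' : x - u ∈ unitCone e)
    {τ : ℝ} (hτ : 0 < τ) {k : ℕ} (hk : 0 < k) (hτk : 4 * τ * k ^ 2 ≤ 1)
    (h1 : f (x + u) - f x ≤ τ • f x) (h2 : -(τ • f x) ≤ f (x + u) - f x)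
    (h3 : f (x - u) - f x ≤ τ • f x) (h4 : -(τ • f x) ≤ f (x - u) - f x) (m : ℕ) :
    ∀ B : ℝ, m ≤ k ^ 2 → |B| ≤ ((k : ℝ) ^ 2 - m) / 2 →
    ((m : ℝ) / 2) • ((f (x + u) - f x) + (f (x - u) - f x)) +
      B • ((f (x + u) - f x) - (f (x - u) - f x)) ≤
    (2 * τ * (B ^ 2 / (2 * k) + k / 2) + m * (8 * τ ^ 2 * k ^ 3 + 2 * τ / (8 * k))) • f x := by
  have hy0 := unitCone.nonneg he (hf.mem hx)
  set y := f x with hy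
  set p := f (x + u) - y with hp
  set q := f (x - u) - y with hq
  have hk0 : (0 : ℝ) < k := by exact_mod_cast hk
  have hk1 : (1 : ℝ) ≤ k := by exact_mod_cast hk
  have hpq : 0 ≤ p + q := by
    have := hf.convex he hxu hxu' (s := 1 / 2) (t := 1 / 2) (by norm_num) (by norm_num)
      (by norm_num)
    rw [show (1 / 2 : ℝ) • (x + u) + (1 / 2 : ℝ) • (x - u) = x by module] at this
    rw [hp, hq]
    linear_combination (norm := (apply le_of_eq; module)) (2 : ℝ) • this
  have hB : ∀ B : ℝ, B • (p - q) ≤ (2 * τ * |B|) • y := by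
    intro B
    rcases le_total 0 B with h | h
    · rw [abs_of_nonneg h]
      have := smul_le_smul_of_nonneg_left (sub_le_sub h1 h4) h
      linear_combination (norm := (apply le_of_eq; module)) this
    · rw [abs_of_nonpos h]
      have := smul_le_smul_of_nonneg_left (sub_le_sub h3 h2) (neg_nonneg.2 h)
      linear_combination (norm := (apply le_of_eq; module)) this
  induction m with
  | zero =>
    intro B _ _
    simp only [Nat.cast_zero, zero_div, zero_smul, zero_add, zero_mul, add_zero]
    refine (hB B).trans (smul_le_smul_of_nonneg_right ?_ hy0)
    have : |B| ≤ B ^ 2 / (2 * k) + k / 2 := by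
      have h5 : B ^ 2 / (2 * k) + k / 2 - |B| = (|B| - k) ^ 2 / (2 * k) := by
        field_simp; rw [← sq_abs B]; ring
      have h6 : 0 ≤ (|B| - k) ^ 2 / (2 * k) := by positivity
      linarith
    have := mul_le_mul_of_nonneg_left this (show 0 ≤ 2 * τ by positivity)
    linarith
  | succ m ih =>
    intro B hm hBm
    push_cast at hBm ⊢
    have hm' : (m : ℝ) + 1 ≤ (k : ℝ) ^ 2 := by exact_mod_cast hm
    have hm0 : (0 : ℝ) ≤ m := Nat.cast_nonneg m
    set bd : ℝ → ℝ := fun B => 2 * τ * (B ^ 2 / (2 * k) + k / 2) +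
      m * (8 * τ ^ 2 * k ^ 3 + 2 * τ / (8 * k)) with hbd
    set ε := 8 * τ ^ 2 * k ^ 3 with hε
    have hbd0 : ∀ B, 0 ≤ bd B := fun B => by positivity
    have hbdK : ∀ B, |B| ≤ ((k : ℝ) ^ 2 - m) / 2 → (bd B + ε) * τ ≤ ε := by
      intro B hB
      have a1 : B ^ 2 ≤ (k : ℝ) ^ 4 / 4 := by
        rw [← sq_abs]
        have : |B| ≤ (k : ℝ) ^ 2 / 2 := by linarith
        calc |B| ^ 2 ≤ ((k : ℝ) ^ 2 / 2) ^ 2 := by gcongr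
          _ = _ := by ring
      have a2 : B ^ 2 / (2 * k) ≤ (k : ℝ) ^ 3 / 8 := by
        rw [div_le_iff₀ (by positivity)]; linarith
      have a3 : (m : ℝ) * (2 * τ / (8 * k)) ≤ τ * k / 4 := by
        calc (m : ℝ) * (2 * τ / (8 * k)) ≤ (k : ℝ) ^ 2 * (2 * τ / (8 * k)) := by
              gcongr; linarith
          _ = _ := by field_simp; ring
      have a4 : (m : ℝ) * ε + ε ≤ (k : ℝ) ^ 2 * ε := by
        have : 0 ≤ ε := by positivity
        nlinarith
      have a5 : (k : ℝ) ≤ (k : ℝ) ^ 3 := le_self_pow₀ hk1 (by norm_num)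
      have a6 : (k : ℝ) ^ 2 * ε ≤ 2 * τ * k ^ 3 := by
        rw [hε]
        have : 0 ≤ 2 * τ * k ^ 3 := by positivity
        calc (k : ℝ) ^ 2 * (8 * τ ^ 2 * k ^ 3) = (4 * τ * k ^ 2) * (2 * τ * k ^ 3) := by ring
          _ ≤ 1 * (2 * τ * k ^ 3) := by gcongr
          _ = _ := one_mul _
      have a7 : bd B + ε ≤ 4 * τ * k ^ 3 := by
        have e1 : bd B = 2 * τ * (B ^ 2 / (2 * k)) + τ * k + (m * ε + m * (2 * τ / (8 * k))) := by
          rw [hbd]; ring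
        have e2 := mul_le_mul_of_nonneg_left a2 (show 0 ≤ 2 * τ by positivity)
        have e3 := mul_le_mul_of_nonneg_left a5 (show 0 ≤ 2 * τ by positivity)
        have e4 : 0 ≤ τ * (k : ℝ) ^ 3 := by positivity
        rw [e1]
        linarith
      calc (bd B + ε) * τ ≤ 4 * τ * k ^ 3 * τ := by gcongr
        _ ≤ ε := by rw [hε]; nlinarith [show 0 ≤ τ ^ 2 * k ^ 3 by positivity]
    have hm1 : |B - 1 / 2| ≤ ((k : ℝ) ^ 2 - m) / 2 := by
      have := abs_sub B (1 / 2)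
      rw [abs_of_pos (show (0 : ℝ) < 1 / 2 by norm_num)] at this
      linarith
    have hm2 : |B + 1 / 2| ≤ ((k : ℝ) ^ 2 - m) / 2 := by
      have := abs_add_le B (1 / 2)
      rw [abs_of_pos (show (0 : ℝ) < 1 / 2 by norm_num)] at this
      linarith
    have i1 := ih (B - 1 / 2) (by omega) hm1
    have i2 := ih (B + 1 / 2) (by omega) hm2
    change _ ≤ bd _ • y at i1 i2
    set w := y + ((((m : ℝ) + 1) / 2) • (p + q) + B • (p - q)) with hw
    have hwC : w ∈ unitCone e := by
      refine unitCone.mem_of_le (unitCone.smul_mem (hf.mem hx) (show (0 : ℝ) < 1 / 2 by norm_num)) ?_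
      have b1 := hB (-B)
      rw [abs_neg] at b1
      have b2 : 2 * τ * |B| ≤ 1 / 2 := by
        have : |B| ≤ (k : ℝ) ^ 2 := by nlinarith [abs_nonneg B]
        have := mul_le_mul_of_nonneg_left this (show 0 ≤ 2 * τ by positivity)
        linarith
      have b3 := smul_le_smul_of_nonneg_right b2 hy0
      have b4 := smul_nonneg (show (0 : ℝ) ≤ ((m : ℝ) + 1) / 2 by positivity) hpq
      rw [hw]
      linear_combination (norm := (apply le_of_eq; module)) b1 + b3 + b4
    have gen : ∀ {B' : ℝ} {a : V}, (bd B' + ε) * τ ≤ ε → -(τ • y) ≤ a - y →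
        w ≤ bd B' • y + a → w ≤ (1 + bd B' + ε) • a := by
      intro B' a g1 g2 g3
      have g4 := smul_le_smul_of_nonneg_right g1 hy0
      have g5 := smul_le_smul_of_nonneg_left g2 (show 0 ≤ bd B' + ε from
        add_nonneg (hbd0 _) (by positivity))
      linear_combination (norm := (apply le_of_eq; module)) g3 + g4 + g5
    have hpos : ∀ B', 0 < 1 + bd B' + ε := fun B' => by
      have := hbd0 B'
      have : 0 ≤ ε := by positivity
      linarith
    have fin := hf.le_half_smul hx hxu hxu' hwC (hpos _) (hpos _)
      (gen (a := f (x + u)) (hbdK _ hm1) h2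
        (by rw [hw]; linear_combination (norm := (apply le_of_eq; rw [hp]; module)) i1))
      (gen (a := f (x - u)) (hbdK _ hm2) h4
        (by rw [hw]; linear_combination (norm := (apply le_of_eq; rw [hq]; module)) i2)
      )
    have e1 : (1 + bd (B - 1 / 2) + ε + (1 + bd (B + 1 / 2) + ε)) / 2 =
        1 + (2 * τ * (B ^ 2 / (2 * k) + k / 2) + (m + 1) * (ε + 2 * τ / (8 * k))) := by
      rw [hbd]; field_simp; ring
    rw [e1, hw, add_smul, one_smul] at fin
    exact (add_le_add_iff_left y).1 fin

theorem exists_symm_increment_le (hf : IsGaugeRev e f) (he : IsNormUnit e) {ε : ℝ} (hε : 0 < ε) :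
    ∃ τ₀ : ℝ, 0 < τ₀ ∧ ∀ τ : ℝ, 0 < τ → τ ≤ τ₀ → ∀ x ∈ unitCone e, ∀ u : V,
      x + u ∈ unitCone e → x - u ∈ unitCone e →
      f (x + u) - f x ≤ τ • f x → -(τ • f x) ≤ f (x + u) - f x →
      f (x - u) - f x ≤ τ • f x → -(τ • f x) ≤ f (x - u) - f x →
      (f (x + u) - f x) + (f (x - u) - f x) ≤ (ε * τ) • f x := by
  obtain ⟨k, hk⟩ := exists_nat_gt (5 / ε)
  have hk0 : (0 : ℝ) < k := lt_trans (by positivity) hk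
  have hkn : 0 < k := by exact_mod_cast hk0
  rw [div_lt_iff₀ hε] at hk
  refine ⟨min (1 / (4 * k ^ 2)) (ε / (32 * k ^ 3)), by positivity, ?_⟩
  intro τ hτ hτ' x hx u hxu hxu' h1 h2 h3 h4
  have t1 : τ * (4 * k ^ 2) ≤ 1 := by
    have := hτ'.trans (min_le_left _ _)
    rwa [le_div_iff₀ (by positivity)] at this
  have t2 : τ * (32 * k ^ 3) ≤ ε := by
    have := hτ'.trans (min_le_right _ _)
    rwa [le_div_iff₀ (by positivity)] at this
  have := hf.symm_increment_step he hx hxu hxu' hτ hkn (by linarith) h1 h2 h3 h4 (k ^ 2) 0 le_rfl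
    (by simp)
  rw [zero_smul, add_zero] at this
  have h5 := smul_le_smul_of_nonneg_left this (show (0 : ℝ) ≤ 2 / k ^ 2 by positivity)
  push_cast at h5
  rw [smul_smul, smul_smul, show (2 : ℝ) / k ^ 2 * (k ^ 2 / 2) = 1 by field_simp, one_smul] at h5
  refine h5.trans (smul_le_smul_of_nonneg_right ?_ (unitCone.nonneg he (hf.mem hx)))
  have h6 : (2 : ℝ) / k ^ 2 * (2 * τ * (0 ^ 2 / (2 * k) + k / 2) +
      k ^ 2 * (8 * τ ^ 2 * k ^ 3 + 2 * τ / (8 * k))) =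
      (5 / (2 * k)) * τ + (16 * τ * k ^ 3) * τ := by field_simp; ring
  rw [h6, ← add_mul]
  apply mul_le_mul_of_nonneg_right _ hτ.le
  have h7 : 5 / (2 * (k : ℝ)) ≤ ε / 2 := by
    rw [div_le_iff₀ (by positivity)]; nlinarith
  linarith

end IsGaugeRev

end GaugeMaps

section GaugeDifferentiability

variable {V : Type*} [NormedAddCommGroup V] [NormedSpace ℝ V]
  [PartialOrder V] [IsOrderedAddMonoid V] [IsOrderedModule ℝ V] {e : V}

namespace IsGaugeRev

variable {f : V → V}

theorem increment_bounds (hf : IsGaugeRev e f) (he : IsNormUnit e) {x u : V} {ε t : ℝ}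
    (hε : 0 < ε) (hx : ε • e ≤ x) (ht : 0 ≤ t) (ht' : t ≤ 1 / 2) (hu : ‖u‖ ≤ t * ε) :
    x + u ∈ unitCone e ∧ f (x + u) - f x ≤ (2 * t) • f x ∧ -((2 * t) • f x) ≤ f (x + u) - f x := by
  have hxC : x ∈ unitCone e := ⟨ε, hε, hx⟩
  have hfx := unitCone.nonneg he (hf.mem hxC)
  have u1 := he.le_smul hu
  have u2 := he.neg_le_smul hu
  have hl : (1 - t) • x ≤ x + u := by
    linear_combination (norm := (apply le_of_eq; module)) u2 + t • hx
  have hr : x + u ≤ (1 + t) • x := by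
    linear_combination (norm := (apply le_of_eq; module)) u1 + t • hx
  have p1 : 0 < 1 - t := by linarith
  have p2 : 0 < 1 + t := by linarith
  have m1 := unitCone.smul_mem hxC p1
  have m2 := unitCone.smul_mem hxC p2
  have hm := unitCone.mem_of_le m1 hl
  rw [hf.le_iff _ m1 _ hm, hf.map_smul _ hxC _ p1] at hl
  rw [hf.le_iff _ hm _ m2, hf.map_smul _ hxC _ p2] at hr
  refine ⟨hm, ?_, ?_⟩
  · have h1 : (1 - t)⁻¹ ≤ 1 + 2 * t := by
      rw [inv_le_iff_one_le_mul₀ p1]; nlinarith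
    have h2 := smul_le_smul_of_nonneg_right h1 hfx
    linear_combination (norm := (apply le_of_eq; module)) hl + h2
  · have h1 : 1 - 2 * t ≤ (1 + t)⁻¹ := by
      rw [inv_eq_one_div, le_div_iff₀ p2]; nlinarith
    have h2 := smul_le_smul_of_nonneg_right h1 hfx
    linear_combination (norm := (apply le_of_eq; module)) hr + h2

theorem exists_hasFDerivAt [CompleteSpace V] (hf : IsGaugeRev e f) (he : IsNormUnit e) {x : V}
    (hxC : x ∈ unitCone e) : ∃ D : V →L[ℝ] V, HasFDerivAt f D x := by
  obtain ⟨ε, hε, hx⟩ := hxC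
  have hxC : x ∈ unitCone e := ⟨ε, hε, hx⟩
  have hfx := unitCone.nonneg he (hf.mem hxC)
  have hb : ∀ u : V, ‖u‖ < ε / 2 → x + u ∈ unitCone e ∧
      f (x + u) - f x ≤ (2 * (‖u‖ / ε)) • f x ∧ -((2 * (‖u‖ / ε)) • f x) ≤ f (x + u) - f x := by
    intro u hu
    refine hf.increment_bounds he hε hx (by positivity) ?_ (by field_simp; rfl)
    rw [div_le_iff₀ hε]; linarith
  suffices h : ∃ D : V →L[ℝ] V, HasFDerivAt (fun u => f (x + u) - f x) D 0 by
    obtain ⟨D, hD⟩ := h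
    refine ⟨D, ?_⟩
    have h1 : HasFDerivAt (fun z : V => z - x) (ContinuousLinearMap.id ℝ V) x :=
      (hasFDerivAt_id x).sub_const x
    have h2 : HasFDerivAt (fun u => f (x + u) - f x) D (x - x) := by simpa using hD
    have h3 := (HasFDerivAt.comp (f := fun z => z - x) x h2 h1).add_const (f x)
    simpa [Function.comp_def] using h3
  refine he.exists_hasFDerivAt_of_convex
    (δ := ε / 2) (C := 2 / ε * ‖f x‖) (by positivity) (by simp) ?_ ?_ ?_
  · intro u v hu hv s t hs ht hst
    have := hf.convex he (hb u hu).1 (hb v hv).1 hs ht hst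
    have e1 : s • (x + u) + t • (x + v) = x + (s • u + t • v) := by
      have : x = (s + t) • x := by rw [hst, one_smul]
      nth_rewrite 3 [this]; module
    rw [e1] at this
    have e2 : f x = (s + t) • f x := by rw [hst, one_smul]
    calc f (x + (s • u + t • v)) - f x ≤ s • f (x + u) + t • f (x + v) - f x := by gcongr
      _ = _ := by nth_rewrite 1 [e2]; module
  · intro u hu
    obtain ⟨_, h1, h2⟩ := hb u hu
    have h3 := smul_le_smul_of_nonneg_left (he.le_norm (f x))
      (show 0 ≤ 2 * (‖u‖ / ε) by positivity)
    rw [smul_smul] at h3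
    have e1 : 2 / ε * ‖f x‖ * ‖u‖ = 2 * (‖u‖ / ε) * ‖f x‖ := by field_simp
    rw [e1]
    exact he.norm_le_of_abs (by positivity) ((neg_le_neg h3).trans h2) (h1.trans h3)
  · intro η hη
    obtain ⟨τ₀, hτ₀, H⟩ := hf.exists_symm_increment_le he
      (ε := η * ε / (2 * (‖f x‖ + 1))) (by positivity)
    refine ⟨min (ε / 2) (τ₀ * ε / 2), by positivity, fun u hu => ?_⟩
    rcases eq_or_ne u 0 with rfl | hu0
    · simp
    have hun : 0 < ‖u‖ := norm_pos_iff.2 hu0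
    have hu1 : ‖u‖ < ε / 2 := hu.trans_le (min_le_left _ _)
    have hu2 : ‖u‖ < τ₀ * ε / 2 := hu.trans_le (min_le_right _ _)
    obtain ⟨m1, a1, a2⟩ := hb u hu1
    obtain ⟨m2, b1, b2⟩ := hb (-u) (by rwa [norm_neg])
    rw [norm_neg, ← sub_eq_add_neg] at b1 b2
    rw [← sub_eq_add_neg] at m2
    have h := H (2 * (‖u‖ / ε)) (by positivity)
      (by rw [← mul_div_assoc, div_le_iff₀ hε]; linarith) x hxC u m1 m2 a1 a2 b1 b2
    have hc := hf.convex he m1 m2 (s := 1 / 2) (t := 1 / 2) (by norm_num) (by norm_num)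
      (by norm_num)
    rw [show (1 / 2 : ℝ) • (x + u) + (1 / 2 : ℝ) • (x - u) = x by module] at hc
    have h0 : 0 ≤ f (x + u) - f x + (f (x - u) - f x) := by
      linear_combination (norm := (apply le_of_eq; module)) (2 : ℝ) • hc
    have hpos : 0 ≤ η * ε / (2 * (‖f x‖ + 1)) * (2 * (‖u‖ / ε)) := by positivity
    have h3 := smul_le_smul_of_nonneg_left (he.le_norm (f x)) hpos
    rw [smul_smul] at h3
    have := he.norm_le_of_nonneg (by positivity) h0 (h.trans h3)
    rw [← sub_eq_add_neg]
    refine this.trans ?_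
    have e1 : η * ε / (2 * (‖f x‖ + 1)) * (2 * (‖u‖ / ε)) * ‖f x‖ =
        η * ‖u‖ * (‖f x‖ / (‖f x‖ + 1)) := by field_simp
    rw [e1]
    apply mul_le_of_le_one_right (by positivity)
    rw [div_le_one (by positivity)]; linarith

end IsGaugeRev

end GaugeDifferentiability

section OrderAutomorphisms

variable {V : Type*} [NormedAddCommGroup V] [NormedSpace ℝ V]
  [PartialOrder V] [IsOrderedAddMonoid V] [IsOrderedModule ℝ V] {e : V}

/-- `g` and `h` are mutually inverse positive linear maps. -/
structure IsPosInv (g h : V →L[ℝ] V) : Prop where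
  mul_eq : g * h = 1
  mul_eq' : h * g = 1
  nonneg : ∀ x, 0 ≤ x → 0 ≤ g x
  nonneg' : ∀ x, 0 ≤ x → 0 ≤ h x

namespace IsPosInv

variable {g h k l : V →L[ℝ] V}

theorem symm (H : IsPosInv g h) : IsPosInv h g := ⟨H.mul_eq', H.mul_eq, H.nonneg', H.nonneg⟩

theorem apply_apply (H : IsPosInv g h) (x : V) : g (h x) = x :=
  congrArg (fun T : V →L[ℝ] V => T x) H.mul_eq

theorem mul (H : IsPosInv g h) (K : IsPosInv k l) : IsPosInv (g * k) (l * h) where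
  mul_eq := by rw [mul_assoc, ← mul_assoc k, K.mul_eq, one_mul, H.mul_eq]
  mul_eq' := by rw [mul_assoc, ← mul_assoc h, H.mul_eq', one_mul, K.mul_eq']
  nonneg x hx := H.nonneg _ (K.nonneg x hx)
  nonneg' x hx := K.nonneg' _ (H.nonneg' x hx)

theorem mono (H : IsPosInv g h) {x y : V} (hxy : x ≤ y) : g x ≤ g y := by
  have := H.nonneg _ (sub_nonneg.2 hxy)
  rwa [map_sub, sub_nonneg] at this

theorem le_iff (H : IsPosInv g h) {x y : V} : x ≤ y ↔ g x ≤ g y := by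
  refine ⟨H.mono, fun hxy => ?_⟩
  have := H.symm.mono hxy
  rwa [H.symm.apply_apply, H.symm.apply_apply] at this

theorem mem (H : IsPosInv g h) (he : IsNormUnit e) {x : V} (hx : x ∈ unitCone e) :
    g x ∈ unitCone e := by
  obtain ⟨r, hr, h1⟩ := unitCone.exists_le_smul he hx (h e)
  have h2 := H.mono h1
  rw [H.apply_apply, map_smul] at h2
  refine ⟨r⁻¹, by positivity, ?_⟩
  have := smul_le_smul_of_nonneg_left h2 (inv_nonneg.2 hr.le)
  rwa [smul_smul, inv_mul_cancel₀ hr.ne', one_smul] at this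

theorem bijOn (H : IsPosInv g h) (he : IsNormUnit e) :
    Set.BijOn g (unitCone e) (unitCone e) := by
  refine ⟨fun x hx => H.mem he hx, fun x _ y _ hxy => ?_, fun y hy => ?_⟩
  · have := congrArg h hxy
    rwa [H.symm.apply_apply, H.symm.apply_apply] at this
  · exact ⟨h y, H.symm.mem he hy, H.apply_apply y⟩

theorem isGaugePres (H : IsPosInv g h) (he : IsNormUnit e) : IsGaugePres e g :=
  ⟨H.bijOn he, fun x _ r _ => map_smul g r x, fun _ _ _ _ => H.le_iff⟩

end IsPosInv

namespace IsGaugeRev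

variable {f g : V → V}

theorem comp (hf : IsGaugeRev e f) (hg : IsGaugeRev e g) : IsGaugePres e (f ∘ g) where
  bij := hf.bij.comp hg.bij
  map_smul x hx r hr := by
    rw [Function.comp_apply, hg.map_smul x hx r hr, hf.map_smul _ (hg.mem hx) _ (inv_pos.2 hr),
      inv_inv, Function.comp_apply]
  le_iff x hx y hy := by
    rw [hg.le_iff x hx y hy, hf.le_iff _ (hg.mem hy) _ (hg.mem hx)]; rfl

theorem pres_comp (hf : IsGaugePres e f) (hg : IsGaugeRev e g) : IsGaugeRev e (f ∘ g) where
  bij := hf.bij.comp hg.bij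
  map_smul x hx r hr := by
    rw [Function.comp_apply, hg.map_smul x hx r hr, hf.map_smul _ (hg.mem hx) _ (inv_pos.2 hr),
      Function.comp_apply]
  le_iff x hx y hy := by
    rw [hg.le_iff x hx y hy, hf.le_iff _ (hg.mem hy) _ (hg.mem hx)]; rfl

theorem exists_inverse (hf : IsGaugeRev e f) : ∃ g : V → V, IsGaugeRev e g ∧
    (∀ x ∈ unitCone e, g (f x) = x) ∧ ∀ x ∈ unitCone e, f (g x) = x := by
  have hinv := hf.bij.invOn_invFunOn
  set g := Function.invFunOn f (unitCone e)
  have hl : ∀ x ∈ unitCone e, g (f x) = x := fun x hx => hinv.1 hx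
  have hr : ∀ x ∈ unitCone e, f (g x) = x := fun x hx => hinv.2 hx
  have hb : Set.BijOn g (unitCone e) (unitCone e) := hf.bij.symm hinv.symm
  refine ⟨g, ⟨hb, fun x hx r hr' => ?_, fun x hx y hy => ?_⟩, hl, hr⟩
  · have hgx := hb.mapsTo hx
    have := hf.map_smul _ hgx _ (inv_pos.2 hr')
    rw [hr x hx, inv_inv] at this
    rw [← this, hl _ (unitCone.smul_mem hgx (inv_pos.2 hr'))]
  · rw [hf.le_iff _ (hb.mapsTo hy) _ (hb.mapsTo hx), hr x hx, hr y hy]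

theorem nonneg_of_hasFDerivAt (hf : IsGaugeRev e f) (he : IsNormUnit e) {x : V}
    (hx : x ∈ unitCone e) {D : V →L[ℝ] V} (hD : HasFDerivAt f D x) {u : V} (hu : 0 ≤ u) :
    0 ≤ (-D) u := by
  have h1 : HasDerivAt (fun t : ℝ => x + t • u) u 0 := by
    simpa using ((hasDerivAt_id (0 : ℝ)).smul_const u).const_add x
  have h2 : HasFDerivAt f D (x + (0 : ℝ) • u) := by simpa using hD
  have h3 := (h2.comp_hasDerivAt (0 : ℝ) h1).hasDerivWithinAt (s := Set.Ioi 0)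
  rw [hasDerivWithinAt_iff_tendsto_slope' (by simp)] at h3
  refine he.nonneg_of_tendsto h3.neg ?_
  filter_upwards [self_mem_nhdsWithin] with t ht
  have ht : (0 : ℝ) < t := ht
  rw [slope_def_module, sub_zero, ← smul_neg]
  refine smul_nonneg (inv_nonneg.2 ht.le) ?_
  have htu : 0 ≤ t • u := smul_nonneg ht.le hu
  have := (hf.le_iff x hx _ (unitCone.add_nonneg_mem hx htu)).1 (le_add_of_nonneg_right htu)
  simpa using this

theorem euler (hf : IsGaugeRev e f) {x : V}
    (hx : x ∈ unitCone e) {D : V →L[ℝ] V} (hD : HasFDerivAt f D x) : D x = - f x := by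
  have h1 : HasDerivAt (fun t : ℝ => t • x) x 1 := by
    simpa using ((hasDerivAt_id (1 : ℝ)).smul_const x)
  have h2 : HasFDerivAt f D ((1 : ℝ) • x) := by simpa using hD
  have h3 := h2.comp_hasDerivAt (1 : ℝ) h1
  have h4 : HasDerivAt (fun t : ℝ => t⁻¹ • f x) ((-1 : ℝ) • f x) 1 := by
    have := (hasDerivAt_inv (one_ne_zero (α := ℝ))).smul_const (f x)
    simpa using this
  have h5 : HasDerivAt (f ∘ fun t : ℝ => t • x) ((-1 : ℝ) • f x) 1 := by
    refine h4.congr_of_eventuallyEq ?_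
    filter_upwards [lt_mem_nhds (zero_lt_one (α := ℝ))] with t ht
    exact hf.map_smul x hx t ht
  rw [h3.unique h5, neg_one_smul]

end IsGaugeRev

/-- A gauge-reversing involution `S` of the open cone, with derivative `-B`,
normalized at the order unit. -/
structure IsGaugeInv (e : V) (S : V → V) (B : V → V →L[ℝ] V) : Prop where
  rev : IsGaugeRev e S
  invol : ∀ x ∈ unitCone e, S (S x) = x
  map_unit : S e = e
  deriv : ∀ x ∈ unitCone e, HasFDerivAt S (-B x) x
  B_unit : B e = 1

theorem IsGaugeRev.exists_isGaugeInv [CompleteSpace V] {f : V → V} (hf : IsGaugeRev e f)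
    (he : IsNormUnit e) : ∃ S B, IsGaugeInv e S B := by
  obtain ⟨g, hg, hgf, hfg⟩ := hf.exists_inverse
  have heC : e ∈ unitCone e := unitCone.unit_mem
  obtain ⟨D, hD⟩ := hf.exists_hasFDerivAt he heC
  obtain ⟨E, hE⟩ := hg.exists_hasFDerivAt he (hf.mem heC)
  have hED : E * D = 1 := by
    have h1 := hE.comp e hD
    have h2 : HasFDerivAt (g ∘ f) (ContinuousLinearMap.id ℝ V) e :=
      (hasFDerivAt_id e).congr_of_eventuallyEq
        (Filter.eventually_of_mem (unitCone.mem_nhds he heC) hgf)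
    exact h1.unique h2
  have hDE : D * E = 1 := by
    have hD' : HasFDerivAt f D (g (f e)) := by rwa [hgf e heC]
    have h1 := hD'.comp (f e) hE
    have h2 : HasFDerivAt (f ∘ g) (ContinuousLinearMap.id ℝ V) (f e) :=
      (hasFDerivAt_id _).congr_of_eventuallyEq
        (Filter.eventually_of_mem (unitCone.mem_nhds he (hf.mem heC)) hfg)
    exact h1.unique h2
  have hN : IsPosInv (-E) (-D) := ⟨by rw [neg_mul_neg, hED], by rw [neg_mul_neg, hDE],
    fun x hx => hg.nonneg_of_hasFDerivAt he (hf.mem heC) hE hx,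
    fun x hx => hf.nonneg_of_hasFDerivAt he heC hD hx⟩
  have hS := IsGaugeRev.pres_comp (hN.isGaugePres he) hf
  set S := (-E) ∘ f with hSdef
  have hSe : S e = e := by
    have h1 := hf.euler heC hD
    have h2 := congrArg (fun T : V →L[ℝ] V => T e) hED
    simp only [mul_apply_eq_comp, one_apply_eq_self, h1] at h2
    rw [hSdef, Function.comp_apply, neg_apply, ← map_neg, h2]
  have hSD : HasFDerivAt S (-1 : V →L[ℝ] V) e := by
    have := ((-E).hasFDerivAt (x := f e)).comp e hD
    have h2 : (-E) ∘SL D = -1 := by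
      rw [← hED]; ext x; simp
    rwa [h2] at this
  refine ⟨S, fun x => -fderiv ℝ S x, hS, fun x hx => ?_, hSe, fun x hx => ?_, ?_⟩
  · have hSD' : HasFDerivAt S (-1 : V →L[ℝ] V) (S e) := by rwa [hSe]
    have h1 := hSD'.comp e hSD
    have := (hS.comp hS).eqOn_of_hasFDerivAt he heC h1 hx
    simpa using this
  · obtain ⟨D', hD'⟩ := hS.exists_hasFDerivAt he hx
    simpa using hD'.differentiableAt.hasFDerivAt
  · simp [hSD.fderiv]

namespace IsGaugeInv

variable {S : V → V} {B : V → V →L[ℝ] V} {x y : V}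

theorem mem (hS : IsGaugeInv e S B) (hx : x ∈ unitCone e) : S x ∈ unitCone e := hS.rev.mem hx

theorem euler (hS : IsGaugeInv e S B) (hx : x ∈ unitCone e) : B x x = S x := by
  have := hS.rev.euler hx (hS.deriv x hx)
  rw [neg_apply] at this
  exact neg_injective this

theorem B_nonneg (hS : IsGaugeInv e S B) (he : IsNormUnit e) (hx : x ∈ unitCone e) {u : V}
    (hu : 0 ≤ u) : 0 ≤ B x u := by
  have := hS.rev.nonneg_of_hasFDerivAt he hx (hS.deriv x hx) hu
  simpa using this

theorem B_mul (hS : IsGaugeInv e S B) (he : IsNormUnit e) (hx : x ∈ unitCone e) :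
    B (S x) * B x = 1 := by
  have h1 := (hS.deriv _ (hS.mem hx)).comp x (hS.deriv x hx)
  have h2 : HasFDerivAt (S ∘ S) (ContinuousLinearMap.id ℝ V) x :=
    (hasFDerivAt_id x).congr_of_eventuallyEq
      (Filter.eventually_of_mem (unitCone.mem_nhds he hx) hS.invol)
  have h3 := h1.unique h2
  ext u
  have := congrArg (fun T : V →L[ℝ] V => T u) h3
  simpa using this

theorem isPosInv (hS : IsGaugeInv e S B) (he : IsNormUnit e) (hx : x ∈ unitCone e) :
    IsPosInv (B x) (B (S x)) := by
  have h := hS.B_mul he (hS.mem hx)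
  rw [hS.invol x hx] at h
  exact ⟨h, hS.B_mul he hx, fun u hu => hS.B_nonneg he hx hu,
    fun u hu => hS.B_nonneg he (hS.mem hx) hu⟩

/-- Intertwining relations for `S` differentiate to relations for `B`. -/
theorem B_intertwine (hS : IsGaugeInv e S B) (he : IsNormUnit e) {g h k : V →L[ℝ] V}
    (hg : IsPosInv g h) (H : ∀ y ∈ unitCone e, S (g y) = k (S y)) (hx : x ∈ unitCone e) :
    B (g x) * g = k * B x := by
  have h1 := (hS.deriv _ (hg.mem he hx)).comp x (g.hasFDerivAt (x := x))
  have h2 := ((k.hasFDerivAt (x := S x)).comp x (hS.deriv x hx)).congr_of_eventuallyEq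
    (Filter.eventually_of_mem (unitCone.mem_nhds he hx) H)
  have h3 := h1.unique h2
  ext u
  have := congrArg (fun T : V →L[ℝ] V => T u) h3
  simpa using this

theorem S_B (hS : IsGaugeInv e S B) (he : IsNormUnit e) (hx : x ∈ unitCone e)
    (hy : y ∈ unitCone e) : S (B x y) = B (S x) (S y) := by
  have hP := (hS.isPosInv he hx).symm
  have hg := IsGaugeRev.comp hS.rev (IsGaugeRev.pres_comp (hP.isGaugePres he) hS.rev)
  have e1 : B (S x) (S x) = x := by rw [hS.euler (hS.mem hx), hS.invol x hx]
  have hd : HasFDerivAt S (-B x) (B (S x) (S x)) := by rw [e1]; exact hS.deriv x hx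
  have hd2 := hd.comp x (((B (S x)).hasFDerivAt (x := S x)).comp x (hS.deriv x hx))
  have := hg.eqOn_of_hasFDerivAt he hx hd2 hy
  have h2 : S (B (S x) (S y)) = B x y := by
    have h3 : B (S x) (B x y) = y := hP.apply_apply y
    simpa [h3] using this
  rw [← h2, hS.invol _ (hP.mem he (hS.mem hy))]

theorem B_B (hS : IsGaugeInv e S B) (he : IsNormUnit e) (hx : x ∈ unitCone e)
    (hy : y ∈ unitCone e) : B (B (S x) y) = B x * B y * B x := by
  have hP := hS.isPosInv he hx
  have := hS.B_intertwine he hP.symm (k := B x) (fun z hz => by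
    rw [hS.S_B he (hS.mem hx) hz, hS.invol x hx]) hy
  calc B (B (S x) y) = B (B (S x) y) * (B (S x) * B x) := by rw [hP.mul_eq', mul_one]
    _ = _ := by rw [← mul_assoc, this]

end IsGaugeInv

end OrderAutomorphisms

section LipschitzAtUnit

/-- If the powers of `g` up to `n` stay near `1`, then `g` is within `1 / n` of `1`. -/
theorem norm_sub_one_le_of_pow {R : Type*} [NormedRing R] [NormedAlgebra ℝ R] {g : R} {n : ℕ}
    (hn : 0 < n) (h : ∀ k ≤ n, ‖g ^ k - 1‖ ≤ 1 / 2) : ‖g - 1‖ ≤ 1 / n := by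
  have hn' : (0 : ℝ) < n := by exact_mod_cast hn
  have h1 : ‖∑ k ∈ Finset.range n, (g ^ k - 1)‖ ≤ n * (1 / 2) := by
    refine (norm_sum_le_of_le _ fun k hk => h k (Finset.mem_range.1 hk).le).trans ?_
    simp
  have h2 : (g - 1) * ∑ k ∈ Finset.range n, (g ^ k - 1) = (g ^ n - 1) - (n : ℝ) • (g - 1) := by
    rw [Finset.sum_sub_distrib, mul_sub, mul_geom_sum, Finset.sum_const, Finset.card_range,
      mul_smul_comm, mul_one, Nat.cast_smul_eq_nsmul]
  have h3 : ‖(n : ℝ) • (g - 1)‖ ≤ ‖g ^ n - 1‖ + ‖g - 1‖ * (n * (1 / 2)) := by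
    have : (n : ℝ) • (g - 1) =
        (g ^ n - 1) - (g - 1) * ∑ k ∈ Finset.range n, (g ^ k - 1) := by rw [h2]; abel
    rw [this]
    refine (norm_sub_le _ _).trans (add_le_add le_rfl ((norm_mul_le _ _).trans ?_))
    gcongr
  rw [norm_smul, Real.norm_of_nonneg hn'.le] at h3
  have h4 := h n le_rfl
  rw [le_div_iff₀ hn']
  linarith

variable {V : Type*} [NormedAddCommGroup V] [NormedSpace ℝ V]
  [PartialOrder V] [IsOrderedAddMonoid V] [IsOrderedModule ℝ V] {e : V}

namespace IsGaugeInv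

variable {S : V → V} {B : V → V →L[ℝ] V} {x y : V}

/-- The graph of `S` lies above its tangents. -/
theorem tangent_le (hS : IsGaugeInv e S B) (he : IsNormUnit e) {w : V} (hx : x ∈ unitCone e)
    (hxw : x + w ∈ unitCone e) : S x - S (x + w) ≤ B x w := by
  have h1 : HasDerivAt (fun t : ℝ => x + t • w) w 0 := by
    simpa using ((hasDerivAt_id (0 : ℝ)).smul_const w).const_add x
  have h2 : HasFDerivAt S (-B x) (x + (0 : ℝ) • w) := by simpa using hS.deriv x hx
  have h3 := (h2.comp_hasDerivAt (0 : ℝ) h1).hasDerivWithinAt (s := Set.Ioi 0)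
  rw [hasDerivWithinAt_iff_tendsto_slope' (by simp)] at h3
  have h4 := h3.neg
  rw [neg_apply, neg_neg] at h4
  refine he.le_of_tendsto tendsto_const_nhds h4 ?_
  filter_upwards [Ioo_mem_nhdsGT (zero_lt_one (α := ℝ))] with t ht
  rw [slope_def_module, sub_zero, ← smul_neg]
  have h5 := hS.rev.convex he hx hxw (sub_pos.2 ht.2) ht.1 (by ring)
  rw [show (1 - t) • x + t • (x + w) = x + t • w by module] at h5
  have h6 := smul_le_smul_of_nonneg_left h5 (inv_nonneg.2 ht.1.le)
  simp only [Function.comp_apply, zero_smul, add_zero]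
  have h7 : S (x + w) = t⁻¹ • t • S (x + w) := by
    rw [smul_smul, inv_mul_cancel₀ ht.1.ne', one_smul]
  have h8 : S x = t⁻¹ • t • S x := by
    rw [smul_smul, inv_mul_cancel₀ ht.1.ne', one_smul]
  calc S x - S (x + w) = t⁻¹ • (t • S x - t • S (x + w)) := by rw [smul_sub, ← h7, ← h8]
    _ = t⁻¹ • (-(((1 - t) • S x + t • S (x + w)) - S x)) := by congr 1; module
    _ ≤ _ := by
        apply smul_le_smul_of_nonneg_left _ (inv_nonneg.2 ht.1.le)
        apply neg_le_neg
        gcongr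

theorem unit_add_mem (he : IsNormUnit e) {h : V} (hh : ‖h‖ < 1) : e + h ∈ unitCone e :=
  unitCone.mem_of_norm_sub_lt he (by rw [one_smul]) (by simpa using hh)

theorem continuousAt_B (hS : IsGaugeInv e S B) (he : IsNormUnit e) : ContinuousAt B e := by
  have heC : e ∈ unitCone e := unitCone.unit_mem
  rw [Metric.continuousAt_iff]
  intro η hη
  have hd := hS.deriv e heC
  rw [hS.B_unit, hasFDerivAt_iff_isLittleO_nhds_zero, hS.map_unit] at hd
  obtain ⟨δ', hδ', H'⟩ := Metric.eventually_nhds_iff.1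
    (Asymptotics.isLittleO_iff.1 hd (show 0 < η / 4 by positivity))
  obtain ⟨δ, hδ, hδ1, hδ2⟩ : ∃ δ : ℝ, 0 < δ ∧ 2 * δ < δ' ∧ 2 * δ < 1 :=
    ⟨min (δ' / 4) (1 / 4), by positivity, by linarith [min_le_left (δ' / 4) (1 / 4)],
      by linarith [min_le_right (δ' / 4) (1 / 4)]⟩
  have H : ∀ w : V, ‖w‖ ≤ 2 * δ → ‖S (e + w) - e + w‖ ≤ η / 4 * ‖w‖ := fun w hw => by
    have := H' (y := w) (by rw [dist_zero_right]; linarith)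
    simpa using this
  refine ⟨δ, hδ, fun {z} hz => ?_⟩
  obtain ⟨h, rfl⟩ : ∃ h, z = e + h := ⟨z - e, by abel⟩
  rw [dist_eq_norm, add_sub_cancel_left] at hz
  rw [dist_eq_norm, hS.B_unit]
  have key : ∀ u : V, ‖u‖ = 1 → u - (3 / 4 * η) • e ≤ B (e + h) u := by
    intro u hu
    have hw : ‖h + δ • u‖ ≤ 2 * δ := by
      refine (norm_add_le _ _).trans ?_
      rw [norm_smul, hu, Real.norm_of_nonneg hδ.le]; linarith
    have t1 := hS.tangent_le he (unit_add_mem he (h := h) (by linarith)) (w := δ • u)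
      (by rw [add_assoc]; exact unit_add_mem he (by linarith))
    have n1 := H h (by linarith)
    have n2 := H _ hw
    rw [← add_assoc e h] at n2
    have n3 : ‖(S (e + h) - e + h) - (S (e + h + δ • u) - e + (h + δ • u))‖ ≤
        3 / 4 * η * δ := by
      refine (norm_sub_le _ _).trans ?_
      have : η / 4 * ‖h‖ ≤ η / 4 * δ := by gcongr
      have : η / 4 * ‖h + δ • u‖ ≤ η / 4 * (2 * δ) := by gcongr
      linarith
    have n4 := he.neg_le_smul n3
    rw [map_smul] at t1
    have t2 : δ • (u - (3 / 4 * η) • e) ≤ δ • B (e + h) u := by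
      linear_combination (norm := (apply le_of_eq; module)) t1 + n4
    have t3 : 0 ≤ δ • (B (e + h) u - (u - (3 / 4 * η) • e)) := by
      rw [smul_sub]; exact sub_nonneg.2 t2
    exact sub_nonneg.1 (nonneg_of_smul_nonneg' hδ t3)
  refine lt_of_le_of_lt (ContinuousLinearMap.opNorm_le_of_unit_norm (C := 3 / 4 * η)
    (by positivity) fun u hu => ?_) (by linarith)
  have k1 := key u hu
  have k2 := key (-u) (by rwa [norm_neg])
  rw [map_neg] at k2
  simp only [sub_apply, one_apply_eq_self]
  refine he.norm_le_of_abs (by positivity) ?_ ?_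
  · linear_combination (norm := (apply le_of_eq; module)) k1
  · linear_combination (norm := (apply le_of_eq; module)) k2

theorem continuousAt_S (hS : IsGaugeInv e S B) (hx : x ∈ unitCone e) : ContinuousAt S x :=
  (hS.deriv x hx).continuousAt

theorem S_le_iff (hS : IsGaugeInv e S B) (hx : x ∈ unitCone e) {r : ℝ} (hr : 0 < r) :
    x ≤ r • e ↔ e ≤ r • S x := by
  rw [hS.rev.le_iff x hx _ (unitCone.smul_mem unitCone.unit_mem hr),
    hS.rev.map_smul e unitCone.unit_mem r hr, hS.map_unit]
  constructor <;> intro h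
  · have := smul_le_smul_of_nonneg_left h hr.le
    rwa [smul_smul, mul_inv_cancel₀ hr.ne', one_smul] at this
  · have := smul_le_smul_of_nonneg_left h (inv_nonneg.2 hr.le)
    rwa [smul_smul, inv_mul_cancel₀ hr.ne', one_smul] at this

theorem le_S_iff (hS : IsGaugeInv e S B) (hx : x ∈ unitCone e) {r : ℝ} (hr : 0 < r) :
    r • e ≤ x ↔ r • S x ≤ e := by
  rw [hS.rev.le_iff _ (unitCone.smul_mem unitCone.unit_mem hr) x hx,
    hS.rev.map_smul e unitCone.unit_mem r hr, hS.map_unit]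
  constructor <;> intro h
  · have := smul_le_smul_of_nonneg_left h hr.le
    rwa [smul_smul, mul_inv_cancel₀ hr.ne', one_smul] at this
  · have := smul_le_smul_of_nonneg_left h (inv_nonneg.2 hr.le)
    rwa [smul_smul, inv_mul_cancel₀ hr.ne', one_smul] at this

/-- The powers of `B (S x)` are again of this form, with control of the argument. -/
theorem exists_pow (hS : IsGaugeInv e S B) (he : IsNormUnit e) (hx : x ∈ unitCone e) {δ : ℝ}
    (hδ : 0 ≤ δ) (hδ1 : δ < 1) (h1 : (1 - δ) • e ≤ x) (h2 : x ≤ (1 + δ) • e) (n : ℕ) :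
    ∃ y ∈ unitCone e, B (S y) = B (S x) ^ n ∧ (1 - δ) ^ n • e ≤ y ∧ y ≤ (1 + δ) ^ n • e := by
  have hP := (hS.isPosInv he hx).symm
  have q1 : 0 < 1 - δ := by linarith
  have q2 : 0 < 1 + δ := by linarith
  have hPS : B (S x) (S x) = x := by rw [hS.euler (hS.mem hx), hS.invol x hx]
  suffices H : ∀ n : ℕ, ∃ y ∈ unitCone e, ∃ z ∈ unitCone e,
      B (S y) = B (S x) ^ n ∧ B (S z) = B (S x) ^ (n + 1) ∧
      z ≤ (1 + δ) • y ∧ (1 - δ) • y ≤ z ∧ B (S x) y ≤ (1 + δ) • z ∧ (1 - δ) • z ≤ B (S x) y ∧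
      (1 - δ) ^ n • e ≤ y ∧ y ≤ (1 + δ) ^ n • e by
    obtain ⟨y, hy, _, _, h3, _, _, _, _, _, h4⟩ := H n
    exact ⟨y, hy, h3, h4⟩
  intro n
  induction n with
  | zero =>
    refine ⟨e, unitCone.unit_mem, x, hx, ?_, by simp, h2, h1, ?_, ?_, by simp, by simp⟩
    · rw [hS.map_unit, hS.B_unit, pow_zero]
    · have := hP.mono ((hS.S_le_iff hx q2).1 h2)
      rwa [map_smul, hPS] at this
    · have := hP.mono ((hS.le_S_iff hx q1).1 h1)
      rwa [map_smul, hPS] at this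
  | succ n ih =>
    obtain ⟨y, hy, z, hz, i1, i2, i3, i4, i5, i6, i7, i8⟩ := ih
    refine ⟨z, hz, B (S x) y, hP.mem he hy, i2, ?_, i5, i6, ?_, ?_, ?_, ?_⟩
    · have := hS.S_B he (hS.mem hx) hy
      rw [hS.invol x hx] at this
      have h3 := hS.B_B he (hS.mem hx) (hS.mem hy)
      rw [hS.invol x hx] at h3
      rw [this, h3, i1, ← pow_succ', ← pow_succ]
    · have := hP.mono i3
      rwa [map_smul] at this
    · have := hP.mono i4
      rwa [map_smul] at this
    · have := smul_le_smul_of_nonneg_left i7 q1.le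
      rw [smul_smul, ← pow_succ'] at this
      exact this.trans i4
    · have := smul_le_smul_of_nonneg_left i8 q2.le
      rw [smul_smul, ← pow_succ'] at this
      exact i3.trans this

theorem isBigO_P_sub_one (hS : IsGaugeInv e S B) (he : IsNormUnit e) :
    (fun h => B (S (e + h)) - 1) =O[𝓝 0] (fun h : V => h) := by
  have heC : e ∈ unitCone e := unitCone.unit_mem
  have hc : ContinuousAt (fun x => B (S x)) e := by
    have h1 : ContinuousAt B (S e) := by rw [hS.map_unit]; exact hS.continuousAt_B he
    exact ContinuousAt.comp (f := S) h1 (hS.continuousAt_S heC)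
  rw [Metric.continuousAt_iff] at hc
  obtain ⟨ρ, hρ, H⟩ := hc (1 / 2) (by norm_num)
  simp only [dist_eq_norm, hS.map_unit, hS.B_unit] at H
  obtain ⟨s, hs, hs1, hs2⟩ : ∃ s : ℝ, 0 < s ∧ 2 * s < ρ ∧ s ≤ 1 / 2 :=
    ⟨min (ρ / 4) (1 / 2), by positivity, by linarith [min_le_left (ρ / 4) (1 / 2)],
      min_le_right _ _⟩
  refine Asymptotics.IsBigO.of_bound (2 / s) ?_
  filter_upwards [Metric.ball_mem_nhds (0 : V) (show 0 < s / 2 by positivity)] with h hh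
  rw [mem_ball_zero_iff] at hh
  rcases eq_or_ne h 0 with rfl | h0
  · simp [hS.map_unit, hS.B_unit]
  have hpos : 0 < ‖h‖ := norm_pos_iff.2 h0
  set δ := ‖h‖ with hδ
  have hxC : e + h ∈ unitCone e := unit_add_mem he (by linarith)
  obtain ⟨n, hn1, hn2⟩ : ∃ n : ℕ, n * δ ≤ s ∧ s ≤ (n + 1) * δ := by
    refine ⟨⌊s / δ⌋₊, ?_, ?_⟩
    · rw [← le_div_iff₀ hpos]; exact Nat.floor_le (by positivity)
    · rw [← div_le_iff₀ hpos]; exact (Nat.lt_floor_add_one _).le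
  have hn3 : s / 2 ≤ n * δ := by linarith
  have hn : 0 < n := by
    rcases Nat.eq_zero_or_pos n with rfl | h
    · simp at hn3; linarith
    · exact h
  have := norm_sub_one_le_of_pow (g := B (S (e + h))) hn fun k hk => by
    obtain ⟨y, hy, y1, y2, y3⟩ := hS.exists_pow he hxC hpos.le (by linarith)
      (by linear_combination (norm := (apply le_of_eq; module)) he.neg_le_norm h)
      (by linear_combination (norm := (apply le_of_eq; module)) he.le_norm h) k
    rw [← y1]
    refine (H ?_).le
    have kd : k * δ ≤ s := le_trans (by gcongr) hn1
    have kd0 : 0 ≤ k * δ := by positivity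
    have b1 : 1 - k * δ ≤ (1 - δ) ^ k := by
      have := one_add_mul_le_pow (a := -δ) (by linarith) k
      linarith [this, show (1 + -δ) ^ k = (1 - δ) ^ k by rw [sub_eq_add_neg]]
    have b2 : (1 + δ) ^ k ≤ 1 + 2 * (k * δ) := by
      have c1 : (1 + δ) ^ k * (1 - δ) ^ k ≤ 1 := by
        rw [← mul_pow]
        apply pow_le_one₀ <;> nlinarith
      have c2 : (1 + δ) ^ k * (1 - k * δ) ≤ 1 := le_trans (by gcongr) c1
      have c3 : (0 : ℝ) < (1 + δ) ^ k := by positivity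
      have c4 : 1 ≤ (1 + 2 * (k * δ)) * (1 - k * δ) := by nlinarith
      have c5 : 0 < 1 - k * δ := by linarith
      exact le_of_mul_le_mul_right (c2.trans c4) c5
    refine lt_of_le_of_lt (he.norm_le_of_abs (r := 2 * (k * δ)) (by positivity) ?_ ?_)
      (by linarith)
    · have := smul_le_smul_of_nonneg_right (show 1 - 2 * (k * δ) ≤ (1 - δ) ^ k by linarith)
        he.nonneg
      linear_combination (norm := (apply le_of_eq; module)) this + y2
    · have := smul_le_smul_of_nonneg_right b2 he.nonneg
      linear_combination (norm := (apply le_of_eq; module)) this + y3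
  refine this.trans ?_
  have hn' : (0 : ℝ) < n := by exact_mod_cast hn
  rw [div_le_iff₀ hn']
  field_simp
  linarith

theorem isBigO_B_sub_one (hS : IsGaugeInv e S B) (he : IsNormUnit e) :
    (fun h => B (e + h) - 1) =O[𝓝 0] (fun h : V => h) := by
  have h1 : (fun h => B (e + h) * (B (S (e + h)) - 1)) =O[𝓝 0] (fun h : V => (1 : ℝ) * ‖h‖) := by
    refine Asymptotics.IsBigO.mul ?_ (hS.isBigO_P_sub_one he).norm_right
    have hc : ContinuousAt (fun h => B (e + h)) 0 := by
      have : ContinuousAt B (e + 0) := by rw [add_zero]; exact hS.continuousAt_B he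
      exact ContinuousAt.comp (f := fun h => e + h) this (by fun_prop)
    exact hc.tendsto.isBigO_one ℝ
  simp only [one_mul] at h1
  refine (h1.neg_left.congr' ?_ Filter.EventuallyEq.rfl).of_norm_right
  filter_upwards [Metric.ball_mem_nhds (0 : V) one_pos] with h hh
  rw [mem_ball_zero_iff] at hh
  rw [mul_sub, (hS.isPosInv he (unit_add_mem he hh)).mul_eq, mul_one, neg_sub]

end IsGaugeInv

end LipschitzAtUnit

section ApproximatelyAdditive

open Asymptotics Filter

variable {V W : Type*} [NormedAddCommGroup V] [NormedSpace ℝ V] [NormedAddCommGroup W]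
  [NormedSpace ℝ W]

/-- A map which is additive up to second order near `0` is linear up to second order. -/
theorem exists_clm_of_approximately_additive [CompleteSpace W] {T : V → W}
    (hT1 : T =O[𝓝 0] (fun h : V => h))
    (hT2 : (fun p : V × V => T ((2 : ℝ) • p.1 + (2 : ℝ) • p.2) - (2 : ℝ) • T p.1 - (2 : ℝ) • T p.2)
      =O[𝓝 0] (fun p => ‖p‖ ^ 2)) :
    ∃ A : V →L[ℝ] W, (fun h => T h - A h) =O[𝓝 0] (fun h : V => ‖h‖ ^ 2) := by
  obtain ⟨L, hL, hT1⟩ := hT1.exists_pos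
  obtain ⟨C, hC, hT2⟩ := hT2.exists_pos
  obtain ⟨ρ₁, hρ₁, H1⟩ := Metric.eventually_nhds_iff.1 hT1.bound
  obtain ⟨ρ₂, hρ₂, H2⟩ := Metric.eventually_nhds_iff.1 hT2.bound
  have hT0 : T 0 = 0 := by
    have := H1 (y := 0) (by simpa using hρ₁)
    simpa using this
  have G1 : ∀ h : V, ‖h‖ < ρ₁ → ‖T h‖ ≤ L * ‖h‖ := fun h hh => H1 (by simpa using hh)
  have G2 : ∀ h k : V, ‖h‖ < ρ₂ → ‖k‖ < ρ₂ →
      ‖T ((2 : ℝ) • h + (2 : ℝ) • k) - (2 : ℝ) • T h - (2 : ℝ) • T k‖ ≤ C * (‖h‖ + ‖k‖) ^ 2 := by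
    intro h k hh hk
    have := H2 (y := (h, k)) (by rw [dist_zero_right, Prod.norm_mk]; exact max_lt hh hk)
    refine this.trans ?_
    rw [norm_pow, norm_norm, Prod.norm_mk]
    gcongr
    exact max_le (by linarith [norm_nonneg k]) (by linarith [norm_nonneg h])
  have G3 : ∀ h : V, ‖h‖ < ρ₂ → ‖T ((2 : ℝ) • h) - (2 : ℝ) • T h‖ ≤ C * ‖h‖ ^ 2 := by
    intro h hh
    have := G2 h 0 hh (by simpa using hρ₂)
    simpa [hT0] using this
  set U : ℕ → V → W := fun n h => (2 : ℝ) ^ n • T (((2 : ℝ)⁻¹) ^ n • h) with hU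
  have hnorm : ∀ (n : ℕ) (h : V), ‖((2 : ℝ)⁻¹) ^ n • h‖ = ((2 : ℝ)⁻¹) ^ n * ‖h‖ := fun n h => by
    rw [norm_smul, Real.norm_of_nonneg (by positivity)]
  have hstep : ∀ (h : V), ‖h‖ < ρ₂ → ∀ n, dist (U n h) (U (n + 1) h) ≤
      (C * ‖h‖ ^ 2 / 2) / 2 / 2 ^ n := by
    intro h hh n
    have hle : ‖((2 : ℝ)⁻¹) ^ (n + 1) • h‖ ≤ ‖h‖ := by
      rw [hnorm]
      exact mul_le_of_le_one_left (norm_nonneg _) (pow_le_one₀ (by norm_num) (by norm_num))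
    have h1 := G3 (((2 : ℝ)⁻¹) ^ (n + 1) • h) (hle.trans_lt hh)
    have e1 : U n h - U (n + 1) h = (2 : ℝ) ^ n • (T ((2 : ℝ) • ((2 : ℝ)⁻¹) ^ (n + 1) • h) -
        (2 : ℝ) • T (((2 : ℝ)⁻¹) ^ (n + 1) • h)) := by
      simp only [hU]
      rw [smul_smul 2, pow_succ ((2 : ℝ)⁻¹), show (2 : ℝ) * ((2 : ℝ)⁻¹ ^ n * 2⁻¹) = 2⁻¹ ^ n by ring,
        smul_sub, smul_smul, pow_succ]
    rw [dist_eq_norm, e1, norm_smul, Real.norm_of_nonneg (by positivity)]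
    calc (2 : ℝ) ^ n * _ ≤ 2 ^ n * (C * ‖((2 : ℝ)⁻¹) ^ (n + 1) • h‖ ^ 2) := by gcongr
      _ = _ := by
        rw [hnorm, pow_succ, inv_pow]
        field_simp; ring
  have hshift : ∀ (N n : ℕ) (h : V), U (n + N) h = (2 : ℝ) ^ N • U n (((2 : ℝ)⁻¹) ^ N • h) := by
    intro N n h
    simp only [hU]
    rw [smul_smul, smul_smul, ← pow_add, ← pow_add, add_comm N n]
  have htend0 : Tendsto (fun n : ℕ => ((2 : ℝ)⁻¹) ^ n) atTop (𝓝 0) :=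
    tendsto_pow_atTop_nhds_zero_of_lt_one (by norm_num) (by norm_num)
  have hsmall : ∀ (h : V) (ρ : ℝ), 0 < ρ → ∀ᶠ n : ℕ in atTop, ‖((2 : ℝ)⁻¹) ^ n • h‖ < ρ := by
    intro h ρ hρ
    have : Tendsto (fun n : ℕ => ‖((2 : ℝ)⁻¹) ^ n • h‖) atTop (𝓝 0) := by
      simpa using (htend0.smul_const h).norm
    exact this.eventually (gt_mem_nhds hρ)
  have hlim : ∀ h : V, ∃ a, Tendsto (fun n => U n h) atTop (𝓝 a) := by
    intro h
    obtain ⟨N, hN⟩ := (hsmall h ρ₂ hρ₂).exists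
    obtain ⟨a, ha⟩ := cauchySeq_tendsto_of_complete
      (cauchySeq_of_le_geometric_two (hstep _ hN))
    refine ⟨(2 : ℝ) ^ N • a, ?_⟩
    rw [← tendsto_add_atTop_iff_nat N]
    simp only [hshift N]
    exact ha.const_smul _
  choose A₀ hA₀ using hlim
  have hadd : ∀ h k, A₀ (h + k) = A₀ h + A₀ k := by
    intro h k
    have h1 : Tendsto (fun n => U n (h + k) - (U (n + 1) h + U (n + 1) k)) atTop
        (𝓝 (A₀ (h + k) - (A₀ h + A₀ k))) :=
      (hA₀ _).sub (((tendsto_add_atTop_iff_nat 1).2 (hA₀ h)).add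
        ((tendsto_add_atTop_iff_nat 1).2 (hA₀ k)))
    have h2 : Tendsto (fun n => U n (h + k) - (U (n + 1) h + U (n + 1) k)) atTop (𝓝 0) := by
      refine squeeze_zero_norm' (a := fun n => (C * (‖h‖ + ‖k‖) ^ 2 / 4) * ((2 : ℝ)⁻¹) ^ n) ?_
        (by simpa using htend0.const_mul (C * (‖h‖ + ‖k‖) ^ 2 / 4))
      have s1 := (tendsto_add_atTop_nat 1).eventually (hsmall h ρ₂ hρ₂)
      have s2 := (tendsto_add_atTop_nat 1).eventually (hsmall k ρ₂ hρ₂)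
      filter_upwards [s1, s2] with n s1 s2
      have g := G2 _ _ s1 s2
      have e1 : U n (h + k) - (U (n + 1) h + U (n + 1) k) = (2 : ℝ) ^ n •
          (T ((2 : ℝ) • ((2 : ℝ)⁻¹) ^ (n + 1) • h + (2 : ℝ) • ((2 : ℝ)⁻¹) ^ (n + 1) • k) -
            (2 : ℝ) • T (((2 : ℝ)⁻¹) ^ (n + 1) • h) - (2 : ℝ) • T (((2 : ℝ)⁻¹) ^ (n + 1) • k)) := by
        simp only [hU]
        rw [smul_smul 2, smul_smul 2, pow_succ ((2 : ℝ)⁻¹),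
          show (2 : ℝ) * ((2 : ℝ)⁻¹ ^ n * 2⁻¹) = 2⁻¹ ^ n by ring, ← smul_add ((2 : ℝ)⁻¹ ^ n) h k, pow_succ]
        module
      rw [e1, norm_smul, Real.norm_of_nonneg (by positivity)]
      calc (2 : ℝ) ^ n * _ ≤ 2 ^ n *
            (C * (‖((2 : ℝ)⁻¹) ^ (n + 1) • h‖ + ‖((2 : ℝ)⁻¹) ^ (n + 1) • k‖) ^ 2) := by gcongr
        _ = _ := by
          rw [hnorm, hnorm, pow_succ]
          simp only [inv_pow]
          field_simp; ring
    exact sub_eq_zero.1 (tendsto_nhds_unique h1 h2)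
  have hbdd : ∀ h, ‖A₀ h‖ ≤ L * ‖h‖ := by
    intro h
    refine le_of_tendsto (hA₀ h).norm ?_
    filter_upwards [hsmall h ρ₁ hρ₁] with n hn
    have := G1 _ hn
    simp only [hU]
    rw [norm_smul, Real.norm_of_nonneg (by positivity)]
    calc (2 : ℝ) ^ n * _ ≤ 2 ^ n * (L * ‖((2 : ℝ)⁻¹) ^ n • h‖) := by gcongr
      _ = L * ‖h‖ := by
        rw [hnorm, inv_pow]; field_simp
  let A₁ : V →+ W := AddMonoidHom.mk' A₀ hadd
  have hcont : Continuous A₁ := AddMonoidHomClass.continuous_of_bound A₁ L hbdd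
  refine ⟨A₁.toRealLinearMap hcont, ?_⟩
  refine IsBigO.of_bound (C / 2) ?_
  filter_upwards [Metric.ball_mem_nhds (0 : V) hρ₂] with h hh
  rw [mem_ball_zero_iff] at hh
  have := dist_le_of_le_geometric_two_of_tendsto₀ (hstep h hh) (hA₀ h)
  rw [dist_eq_norm] at this
  simp only [hU, pow_zero, one_smul] at this
  have e1 : (A₁.toRealLinearMap hcont) h = A₀ h := rfl
  rw [e1, norm_pow, norm_norm]
  linarith

/-- Applying an operator of order `u` to a vector of order `v`. -/
theorem isBigO_clm_apply {α : Type*} {l : Filter α} {F : α → V →L[ℝ] W} {g : α → V}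
    {u v : α → ℝ} (hF : F =O[l] u) (hg : g =O[l] v) :
    (fun p => F p (g p)) =O[l] (fun p => u p * v p) :=
  (IsBigO.of_norm_le (g := fun p => ‖F p‖ * ‖g p‖) fun p => (F p).le_opNorm (g p)).trans
    (hF.norm_left.mul hg.norm_left)

end ApproximatelyAdditive

section SecondOrderExpansion

open Asymptotics Filter

variable {V : Type*} [NormedAddCommGroup V] [NormedSpace ℝ V]
  [PartialOrder V] [IsOrderedAddMonoid V] [IsOrderedModule ℝ V] {e : V}

namespace IsGaugeInv

variable {S : V → V} {B : V → V →L[ℝ] V} {x y : V}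

theorem eventually_mem (he : IsNormUnit e) : ∀ᶠ h : V in 𝓝 0, e + h ∈ unitCone e := by
  filter_upwards [Metric.ball_mem_nhds (0 : V) one_pos] with h hh
  exact unit_add_mem he (by simpa using hh)

theorem isBigO_S (hS : IsGaugeInv e S B) (he : IsNormUnit e) :
    (fun h => S (e + h) - e + h) =O[𝓝 0] (fun h : V => ‖h‖ ^ 2) := by
  have h1 := isBigO_clm_apply (hS.isBigO_B_sub_one he).norm_right
    (isBigO_refl (fun h : V => h) (𝓝 0)).norm_right
  simp only [← sq] at h1
  refine (IsBigO.of_bound 1 ?_).trans h1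
  filter_upwards [eventually_mem he] with h hh
  have t1 := hS.tangent_le he unitCone.unit_mem hh
  have t2 := hS.tangent_le he hh (w := -h) (by simpa using unitCone.unit_mem)
  rw [hS.B_unit, one_apply_eq_self, hS.map_unit] at t1
  rw [add_neg_cancel_right, hS.map_unit, map_neg] at t2
  have h0 : 0 ≤ S (e + h) - e + h := by
    linear_combination (norm := (apply le_of_eq; module)) t1
  have h2 : S (e + h) - e + h ≤ -((B (e + h) - 1) h) := by
    simp only [sub_apply, one_apply_eq_self]
    linear_combination (norm := (apply le_of_eq; module)) t2
  have := he.norm_mono h0 h2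
  rwa [norm_neg, ← one_mul ‖(B (e + h) - 1) h‖] at this

theorem isBigO_P_unit (hS : IsGaugeInv e S B) (he : IsNormUnit e) :
    (fun h => B (S (e + h)) e - e - (2 : ℝ) • h) =O[𝓝 0] (fun h : V => ‖h‖ ^ 2) := by
  have h1 := isBigO_clm_apply (hS.isBigO_P_sub_one he).norm_right
    (isBigO_refl (fun h : V => h) (𝓝 0)).norm_right
  simp only [← sq] at h1
  have h2 : (fun h => B (S (e + h))) =O[𝓝 0] (fun _ : V => (1 : ℝ)) := by
    have : (fun h => (B (S (e + h)) - 1) + 1) =O[𝓝 0] (fun _ : V => (1 : ℝ)) := by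
      refine IsBigO.add ?_ (isBigO_const_const _ one_ne_zero _)
      exact (hS.isBigO_P_sub_one he).trans ((continuous_id.tendsto (0 : V)).isBigO_one ℝ)
    simpa using this
  have h3 := isBigO_clm_apply h2 (hS.isBigO_S he)
  simp only [one_mul] at h3
  refine (h1.sub h3).congr' ?_ EventuallyEq.rfl
  filter_upwards [eventually_mem he] with h hh
  have e1 : B (S (e + h)) (S (e + h)) = e + h := by
    rw [hS.euler (hS.mem hh), hS.invol _ hh]
  simp only [sub_apply, map_sub, map_add, one_apply_eq_self, e1]
  module

theorem isBigO_approximately_additive (hS : IsGaugeInv e S B) (he : IsNormUnit e) :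
    (fun p : V × V => (B (e + ((2 : ℝ) • p.1 + (2 : ℝ) • p.2)) - 1) -
      (2 : ℝ) • (B (e + p.1) - 1) - (2 : ℝ) • (B (e + p.2) - 1))
      =O[𝓝 0] (fun p => ‖p‖ ^ 2) := by
  have heC : e ∈ unitCone e := unitCone.unit_mem
  have t1 : Tendsto (fun p : V × V => p.1) (𝓝 0) (𝓝 0) := continuous_fst.tendsto (0 : V × V)
  have t2 : Tendsto (fun p : V × V => p.2) (𝓝 0) (𝓝 0) := continuous_snd.tendsto (0 : V × V)
  have o1 : (fun p : V × V => p.1) =O[𝓝 0] (fun p => ‖p‖) :=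
    IsBigO.of_norm_le fun p => norm_fst_le p
  have o2 : (fun p : V × V => p.2) =O[𝓝 0] (fun p => ‖p‖) :=
    IsBigO.of_norm_le fun p => norm_snd_le p
  have o1' : (fun p : V × V => ‖p.1‖ ^ 2) =O[𝓝 0] (fun p => ‖p‖ ^ 2) := o1.norm_left.pow 2
  have o2' : (fun p : V × V => ‖p.2‖ ^ 2) =O[𝓝 0] (fun p => ‖p‖ ^ 2) := o2.norm_left.pow 2
  have oone : (fun p : V × V => ‖p‖) =O[𝓝 0] (fun _ => (1 : ℝ)) :=
    (continuous_norm.tendsto (0 : V × V)).isBigO_one ℝ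
  have bdd : ∀ {F : V × V → V →L[ℝ] V}, (fun p => F p - 1) =O[𝓝 0] (fun p : V × V => ‖p‖) →
      F =O[𝓝 0] (fun _ : V × V => (1 : ℝ)) := fun {F} hF => by
    have := (hF.trans oone).add (isBigO_const_const (1 : V →L[ℝ] V) one_ne_zero (𝓝 (0 : V × V)))
    simpa using this
  have a1 : (fun p : V × V => B (e + p.1) - 1) =O[𝓝 0] (fun p => ‖p‖) :=
    ((hS.isBigO_B_sub_one he).comp_tendsto t1).trans o1
  have a2 : (fun p : V × V => B (e + p.2) - 1) =O[𝓝 0] (fun p => ‖p‖) :=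
    ((hS.isBigO_B_sub_one he).comp_tendsto t2).trans o2
  have p1 : (fun p : V × V => B (S (e + p.1)) - 1) =O[𝓝 0] (fun p => ‖p‖) :=
    ((hS.isBigO_P_sub_one he).comp_tendsto t1).trans o1
  have b1 := bdd a1
  have b2 := bdd a2
  have c1 := bdd p1
  have q1 : (fun p : V × V => B (S (e + p.1)) e - e - (2 : ℝ) • p.1) =O[𝓝 0] (fun p => ‖p‖ ^ 2) :=
    ((hS.isBigO_P_unit he).comp_tendsto t1).trans o1'
  have q2 : (fun p : V × V => B (S (e + p.2)) e - e - (2 : ℝ) • p.2) =O[𝓝 0] (fun p => ‖p‖ ^ 2) :=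
    ((hS.isBigO_P_unit he).comp_tendsto t2).trans o2'
  have z : (fun p : V × V => B (S (e + p.1)) (B (S (e + p.2)) e) -
      (e + ((2 : ℝ) • p.1 + (2 : ℝ) • p.2))) =O[𝓝 0] (fun p => ‖p‖ ^ 2) := by
    have r1 := isBigO_clm_apply c1 q2
    have r2 := (isBigO_clm_apply p1 o2).const_smul_left (2 : ℝ)
    simp only [one_mul, ← sq] at r1 r2
    refine ((r1.add r2).add q1).congr_left fun p => ?_
    simp only [Pi.smul_apply, sub_apply, map_sub, map_smul, one_apply_eq_self]
    module
  set m : V × V → V := fun p =>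
    B (e + p.2) (B (e + p.1) (e + ((2 : ℝ) • p.1 + (2 : ℝ) • p.2))) - e with hm
  have mO : m =O[𝓝 0] (fun p => ‖p‖ ^ 2) := by
    have r1 := isBigO_clm_apply b2 (isBigO_clm_apply b1 z.neg_left)
    simp only [one_mul] at r1
    refine r1.congr' ?_ EventuallyEq.rfl
    filter_upwards [t1.eventually (eventually_mem he), t2.eventually (eventually_mem he)]
      with p h1 h2
    have i1 := (hS.isPosInv he h1).apply_apply
    have i2 := (hS.isPosInv he h2).apply_apply
    simp only [map_neg, map_sub, i1, i2, hm]
    abel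
  have mt : Tendsto m (𝓝 0) (𝓝 0) := mO.trans_tendsto (by
    have : Tendsto (fun p : V × V => ‖p‖ ^ 2) (𝓝 0) (𝓝 (‖(0 : V × V)‖ ^ 2)) :=
      (Continuous.tendsto (by fun_prop) _)
    simpa using this)
  have cO : (fun p : V × V => B (e + m p) - 1) =O[𝓝 0] (fun p => ‖p‖ ^ 2) :=
    ((hS.isBigO_B_sub_one he).comp_tendsto mt).trans mO
  have f1 := ((b1.mul b2).mul cO).mul (b2.mul b1)
  have f2 := a1.mul a1
  have f3 := (a1.mul a2).const_smul_left (2 : ℝ)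
  have f4 := (a2.mul a1).const_smul_left (2 : ℝ)
  have f5 := ((a1.mul a2).mul (a1.trans oone)).const_smul_left (2 : ℝ)
  have f6 := (b1.mul (a2.mul a2)).mul b1
  simp only [one_mul, mul_one, ← sq, one_pow] at f1 f2 f3 f4 f5 f6
  refine (((((f1.add f2).add f3).add f4).add f5).add f6).congr' ?_ EventuallyEq.rfl
  filter_upwards [t1.eventually (eventually_mem he), t2.eventually (eventually_mem he),
    mt.eventually (eventually_mem he)] with p h1 h2 h3
  have i1 := (hS.isPosInv he h1).symm.apply_apply
  have i2 := (hS.isPosInv he h2).symm.apply_apply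
  have key : e + ((2 : ℝ) • p.1 + (2 : ℝ) • p.2) = B (S (e + p.1)) (B (S (e + p.2)) (e + m p)) := by
    rw [hm]; simp only [add_sub_cancel, i2, i1]
  have key2 : B (e + ((2 : ℝ) • p.1 + (2 : ℝ) • p.2)) =
      B (e + p.1) * (B (e + p.2) * B (e + m p) * B (e + p.2)) * B (e + p.1) := by
    rw [key, hS.B_B he h1 ((hS.isPosInv he h2).symm.mem he h3), hS.B_B he h2 h3]
  rw [key2]
  simp only [Pi.smul_apply, two_smul]
  noncomm_ring

theorem exists_expansion [CompleteSpace V] (hS : IsGaugeInv e S B) (he : IsNormUnit e) :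
    ∃ M : V →L[ℝ] V →L[ℝ] V,
      (fun h => B (e + h) - 1 + (2 : ℝ) • M h) =O[𝓝 0] (fun h : V => ‖h‖ ^ 2) := by
  obtain ⟨A, hA⟩ := exists_clm_of_approximately_additive (T := fun h => B (e + h) - 1)
    (hS.isBigO_B_sub_one he) (hS.isBigO_approximately_additive he)
  refine ⟨-(1 / 2 : ℝ) • A, hA.congr_left fun h => ?_⟩
  simp only [smul_apply]
  module

end IsGaugeInv

end SecondOrderExpansion

section ExponentialLimit

open Filter

variable {V : Type*} [NormedAddCommGroup V] [NormedSpace ℝ V]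

theorem norm_pow_sub_pow_le {a b : V →L[ℝ] V} {c ε : ℝ} (hc : 1 ≤ c) (ha : ‖a‖ ≤ c) (hb : ‖b‖ ≤ c)
    (hε : ‖a - b‖ ≤ ε) (k : ℕ) : ‖a ^ k - b ^ k‖ ≤ k * c ^ k * ε ∧ ‖b ^ k‖ ≤ c ^ k := by
  have hc0 : 0 ≤ c := by linarith
  have hε0 : 0 ≤ ε := (norm_nonneg _).trans hε
  induction k with
  | zero =>
    have h4 : ‖(1 : V →L[ℝ] V)‖ ≤ 1 := ContinuousLinearMap.norm_id_le
    exact ⟨by simp, by rw [pow_zero, pow_zero]; exact h4⟩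
  | succ k ih =>
    obtain ⟨i1, i2⟩ := ih
    constructor
    · have e1 : a ^ (k + 1) - b ^ (k + 1) = a * (a ^ k - b ^ k) + (a - b) * b ^ k := by
        rw [pow_succ', pow_succ']; noncomm_ring
      rw [e1]
      calc _ ≤ ‖a‖ * ‖a ^ k - b ^ k‖ + ‖a - b‖ * ‖b ^ k‖ :=
            (norm_add_le _ _).trans (add_le_add (norm_mul_le _ _) (norm_mul_le _ _))
        _ ≤ c * (k * c ^ k * ε) + ε * c ^ k := by gcongr
        _ ≤ c * (k * c ^ k * ε) + ε * c ^ k * c := by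
            have : ε * c ^ k ≤ ε * c ^ k * c := le_mul_of_one_le_right (by positivity) hc
            linarith
        _ = _ := by push_cast; ring
    · rw [pow_succ, pow_succ]
      exact (norm_mul_le _ _).trans (by gcongr)

theorem tendsto_pow_sub_pow {a b : ℕ → V →L[ℝ] V} {X : V →L[ℝ] V}
    (ha : Tendsto (fun n : ℕ => (n : ℝ) • (a n - 1)) atTop (𝓝 X))
    (hb : Tendsto (fun n : ℕ => (n : ℝ) • (b n - 1)) atTop (𝓝 X)) :
    Tendsto (fun n => a n ^ n - b n ^ n) atTop (𝓝 0) := by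
  set K := ‖X‖ + 1
  have hK : 0 ≤ K := by positivity
  have hd : Tendsto (fun n : ℕ => Real.exp K * ‖(n : ℝ) • (a n - b n)‖) atTop (𝓝 0) := by
    have := (ha.sub hb).norm.const_mul (Real.exp K)
    simpa [← smul_sub] using this
  refine squeeze_zero_norm' ?_ hd
  have bound : ∀ {g : ℕ → V →L[ℝ] V}, Tendsto (fun n : ℕ => (n : ℝ) • (g n - 1)) atTop (𝓝 X) →
      ∀ᶠ n : ℕ in atTop, ‖g n‖ ≤ 1 + K / n := by
    intro g hg
    filter_upwards [hg.norm.eventually (gt_mem_nhds (lt_add_one ‖X‖)), eventually_gt_atTop 0]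
      with n h1 h2
    have hn : (0 : ℝ) < n := by exact_mod_cast h2
    rw [norm_smul, Real.norm_of_nonneg hn.le] at h1
    have h3 : ‖g n - 1‖ ≤ K / n := by rw [le_div_iff₀ hn]; linarith
    have h4 : ‖(1 : V →L[ℝ] V)‖ ≤ 1 := ContinuousLinearMap.norm_id_le
    have h5 := norm_add_le (g n - 1) 1
    rw [sub_add_cancel] at h5
    linarith
  filter_upwards [bound ha, bound hb, eventually_gt_atTop 0] with n h1 h2 h3
  have hn : (0 : ℝ) < n := by exact_mod_cast h3
  have hc : (1 : ℝ) ≤ 1 + K / n := by linarith [show 0 ≤ K / n by positivity]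
  refine (norm_pow_sub_pow_le hc h1 h2 le_rfl n).1.trans ?_
  have h4 : (1 + K / n) ^ n ≤ Real.exp K := by
    calc (1 + K / n) ^ n ≤ (Real.exp (K / n)) ^ n := by
          gcongr; linarith [Real.add_one_le_exp (K / n)]
      _ = Real.exp K := by rw [← Real.exp_nat_mul]; congr 1; field_simp
  rw [norm_smul, Real.norm_of_nonneg hn.le]
  calc n * (1 + K / n) ^ n * ‖a n - b n‖ ≤ n * Real.exp K * ‖a n - b n‖ := by gcongr
    _ = _ := by ring

variable [CompleteSpace V]

theorem hasDerivAt_exp_smul (X : V →L[ℝ] V) :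
    HasDerivAt (fun t : ℝ => NormedSpace.exp (t • X)) X 0 := by
  have := hasDerivAt_exp_smul_const (𝕂 := ℝ) X (0 : ℝ)
  simpa using this

theorem tendsto_pow_exp {a : ℕ → V →L[ℝ] V} {X : V →L[ℝ] V}
    (ha : Tendsto (fun n : ℕ => (n : ℝ) • (a n - 1)) atTop (𝓝 X)) :
    Tendsto (fun n => a n ^ n) atTop (𝓝 (NormedSpace.exp X)) := by
  have hb : Tendsto (fun n : ℕ => (n : ℝ) • (NormedSpace.exp ((n : ℝ)⁻¹ • X) - 1)) atTop (𝓝 X) := by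
    have h1 := (hasDerivAt_exp_smul X)
    rw [hasDerivAt_iff_tendsto_slope_zero] at h1
    have h2 : Tendsto (fun n : ℕ => ((n : ℝ))⁻¹) atTop (𝓝[≠] 0) := by
      refine tendsto_nhdsWithin_iff.2 ⟨tendsto_inv_atTop_nhds_zero_nat, ?_⟩
      filter_upwards [eventually_gt_atTop 0] with n hn
      have : (0 : ℝ) < n := by exact_mod_cast hn
      simpa using this.ne'
    have := h1.comp h2
    simpa [Function.comp_def] using this
  have h3 := (tendsto_pow_sub_pow ha hb).add_const (NormedSpace.exp X)
  rw [zero_add] at h3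
  refine h3.congr' ?_
  filter_upwards [eventually_gt_atTop 0] with n hn
  have hn' : (n : ℝ) ≠ 0 := by exact_mod_cast hn.ne'
  let _ : NormedAlgebra ℚ (V →L[ℝ] V) := NormedAlgebra.restrictScalars ℚ ℝ _
  rw [← NormedSpace.exp_nsmul, ← Nat.cast_smul_eq_nsmul ℝ, smul_smul, mul_inv_cancel₀ hn', one_smul,
    sub_add_cancel]

theorem tendsto_one_add_smul_pow_exp (X : V →L[ℝ] V) :
    Tendsto (fun n : ℕ => (1 + (n : ℝ)⁻¹ • X) ^ n) atTop (𝓝 (NormedSpace.exp X)) := by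
  refine tendsto_pow_exp ((tendsto_const_nhds (x := X)).congr' ?_)
  filter_upwards [eventually_gt_atTop 0] with n hn
  have hn' : (n : ℝ) ≠ 0 := by exact_mod_cast hn.ne'
  rw [add_sub_cancel_left, smul_smul, mul_inv_cancel₀ hn', one_smul]

/-- The exponential of an operator on a vector killed by its square. -/
theorem exp_apply_of_apply_apply_eq_zero {X : V →L[ℝ] V} {x : V} (hx : X (X x) = 0) :
    NormedSpace.exp X x = x + X x := by
  have h : ∀ (c : ℝ) (n : ℕ), ((1 + c • X) ^ n) x = x + (n * c) • X x := by
    intro c n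
    induction n with
    | zero => simp
    | succ n ih =>
      rw [pow_succ', mul_apply_eq_comp, ih]
      simp only [add_apply, smul_apply, one_apply_eq_self, map_add, map_smul, hx]
      push_cast; module
  have h1 : Tendsto (fun n : ℕ => ((1 + (n : ℝ)⁻¹ • X) ^ n) x) atTop (𝓝 (NormedSpace.exp X x)) :=
    ((ContinuousLinearMap.apply ℝ V x).continuous.tendsto _).comp (tendsto_one_add_smul_pow_exp X)
  refine tendsto_nhds_unique h1 (tendsto_const_nhds.congr' ?_)
  filter_upwards [eventually_gt_atTop 0] with n hn
  have hn' : (n : ℝ) ≠ 0 := by exact_mod_cast hn.ne'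
  rw [h, mul_inv_cancel₀ hn', one_smul]

end ExponentialLimit

section DerivativeProduct

open Asymptotics Filter

variable {V : Type*} [NormedAddCommGroup V] [NormedSpace ℝ V]
  [PartialOrder V] [IsOrderedAddMonoid V] [IsOrderedModule ℝ V] {e : V}

namespace IsGaugeInv

variable {S : V → V} {B : V → V →L[ℝ] V} {M : V →L[ℝ] V →L[ℝ] V}

theorem exists_hasFDerivAt_B [CompleteSpace V] (hS : IsGaugeInv e S B) (he : IsNormUnit e) :
    ∃ M : V →L[ℝ] V →L[ℝ] V, HasFDerivAt B (-((2 : ℝ) • M)) e := by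
  obtain ⟨M, hM⟩ := hS.exists_expansion he
  refine ⟨M, ?_⟩
  rw [hasFDerivAt_iff_isLittleO_nhds_zero]
  have h1 : (fun h : V => ‖h‖ ^ 2) =o[𝓝 0] (fun h : V => h) := by
    have := isLittleO_norm_pow_norm_pow (E' := V) one_lt_two
    simp only [pow_one] at this
    exact this.of_norm_right
  refine (hM.trans_isLittleO h1).congr_left fun h => ?_
  simp [hS.B_unit]

theorem mul_comm' (hS : IsGaugeInv e S B) (he : IsNormUnit e)
    (hM : HasFDerivAt B (-((2 : ℝ) • M)) e) (x y : V) : M x y = M y x := by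
  have h1 : ∀ᶠ y in 𝓝 e, HasFDerivAt S (-B y) y := by
    filter_upwards [unitCone.mem_nhds he unitCone.unit_mem] with y hy using hS.deriv y hy
  have := second_derivative_symmetric_of_eventually h1 hM.neg x y
  simp only [neg_neg, smul_apply] at this
  exact smul_right_injective V (two_ne_zero (α := ℝ)) this

theorem mul_unit (hS : IsGaugeInv e S B) (he : IsNormUnit e)
    (hM : HasFDerivAt B (-((2 : ℝ) • M)) e) (h : V) : M h e = h := by
  have h1 := hM.clm_apply (hasFDerivAt_id e)
  have h2 := (hS.deriv e unitCone.unit_mem).congr_of_eventuallyEq (f₁ := fun x => B x (id x)) (by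
    filter_upwards [unitCone.mem_nhds he unitCone.unit_mem] with y hy using hS.euler hy)
  have h3 := congrArg (fun T : V →L[ℝ] V => T h) (h1.unique h2)
  simp [hS.B_unit] at h3
  have h4 : (2 : ℝ) • M h e = (2 : ℝ) • h := by
    linear_combination (norm := module) -h3
  exact smul_right_injective V (two_ne_zero (α := ℝ)) h4

theorem unit_mul (hS : IsGaugeInv e S B) (he : IsNormUnit e)
    (hM : HasFDerivAt B (-((2 : ℝ) • M)) e) : M e = 1 := by
  ext h
  rw [hS.mul_comm' he hM, hS.mul_unit he hM, one_apply_eq_self]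

theorem hasFDerivAt_P (hS : IsGaugeInv e S B) (hM : HasFDerivAt B (-((2 : ℝ) • M)) e) :
    HasFDerivAt (fun x => B (S x)) ((2 : ℝ) • M) e := by
  have h1 : HasFDerivAt B (-((2 : ℝ) • M)) (S e) := by rwa [hS.map_unit]
  have h2 := HasFDerivAt.comp e (f := S) h1 (hS.deriv e unitCone.unit_mem)
  have h3 : (-((2 : ℝ) • M)) ∘SL (-B e) = (2 : ℝ) • M := by
    ext x y
    simp [hS.B_unit]
  rwa [h3] at h2

theorem hasDerivAt_line {N : V →L[ℝ] V →L[ℝ] V} {F : V → V →L[ℝ] V} (hF : HasFDerivAt F N e)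
    (h : V) : HasDerivAt (fun t : ℝ => F (e + t • h)) (N h) 0 := by
  have h1 : HasDerivAt (fun t : ℝ => e + t • h) h 0 := by
    simpa using ((hasDerivAt_id (0 : ℝ)).smul_const h).const_add e
  have h2 : HasFDerivAt F N (e + (0 : ℝ) • h) := by simpa using hF
  exact h2.comp_hasDerivAt (0 : ℝ) h1

theorem tendsto_slope_line {N : V →L[ℝ] V →L[ℝ] V} {F : V → V →L[ℝ] V} (hF : HasFDerivAt F N e)
    (h1 : F e = 1) (h : V) {s : ℕ → ℝ} (hs : Tendsto s atTop (𝓝[>] 0)) :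
    Tendsto (fun n => (s n)⁻¹ • (F (e + s n • h) - 1)) atTop (𝓝 (N h)) := by
  have h2 := hasDerivAt_line hF h
  rw [hasDerivAt_iff_tendsto_slope_zero] at h2
  have h3 := h2.comp (hs.mono_right (nhdsWithin_mono _ fun x hx => ne_of_gt hx))
  simpa [Function.comp_def, h1] using h3

theorem sq_nonneg' (hS : IsGaugeInv e S B) (he : IsNormUnit e)
    (hM : HasFDerivAt B (-((2 : ℝ) • M)) e) (h : V) : 0 ≤ M h h := by
  have h2 := ((hasDerivAt_line hM h).clm_apply (hasDerivAt_const (0 : ℝ) h)).hasDerivWithinAt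
    (s := Set.Ioi 0)
  rw [hasDerivWithinAt_iff_tendsto_slope' (by simp)] at h2
  have h3 : Tendsto (fun t : ℝ => e + t • h) (𝓝[>] 0) (𝓝 e) := by
    have : Continuous (fun t : ℝ => e + t • h) := by fun_prop
    simpa using (this.tendsto 0).mono_left (nhdsWithin_le_nhds (s := Set.Ioi 0))
  have h4 := he.nonneg_of_tendsto h2.neg (by
    filter_upwards [h3 (unitCone.mem_nhds he unitCone.unit_mem), self_mem_nhdsWithin] with t ht ht0
    have ht0 : 0 < t := ht0
    have t1 := hS.tangent_le he unitCone.unit_mem ht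
    have t2 := hS.tangent_le he ht (w := -(t • h)) (by simpa using unitCone.unit_mem)
    rw [hS.B_unit, one_apply_eq_self, hS.map_unit] at t1
    rw [add_neg_cancel_right, hS.map_unit, map_neg, map_smul] at t2
    have t3 : 0 ≤ t • (h - B (e + t • h) h) := by
      linear_combination (norm := (apply le_of_eq; module)) t1 + t2
    have t4 := nonneg_of_smul_nonneg' ht0 t3
    have t5 := smul_le_smul_of_nonneg_left t4 (inv_nonneg.2 ht0.le)
    simp only [slope, vsub_eq_sub, sub_zero, zero_smul, add_zero, hS.B_unit, one_apply_eq_self]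
    rw [← smul_neg, neg_sub]
    rwa [smul_zero] at t5)
  refine nonneg_of_smul_nonneg' two_pos ?_
  simpa using h4

variable [CompleteSpace V]

theorem tendsto_inv_natCast : Tendsto (fun n : ℕ => ((n : ℝ))⁻¹) atTop (𝓝[>] 0) := by
  refine tendsto_nhdsWithin_iff.2 ⟨tendsto_inv_atTop_nhds_zero_nat, ?_⟩
  filter_upwards [eventually_gt_atTop 0] with n hn
  have : (0 : ℝ) < n := by exact_mod_cast hn
  simpa using this

theorem exp_apply_unit_le (hS : IsGaugeInv e S B) (he : IsNormUnit e)
    (hM : HasFDerivAt B (-((2 : ℝ) • M)) e) (h : V) :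
    NormedSpace.exp (M h) e ≤ Real.exp ‖h‖ • e := by
  set k := (1 / 2 : ℝ) • h with hk
  have e1 : ((2 : ℝ) • M) k = M h := by rw [smul_apply, hk, map_smul, smul_smul]; norm_num
  have e2 : Real.exp ‖h‖ = Real.exp ‖k‖ * Real.exp ‖k‖ := by
    rw [← Real.exp_add, hk, norm_smul]; norm_num; ring
  have h1 := tendsto_slope_line (hS.hasFDerivAt_P hM) (by rw [hS.map_unit, hS.B_unit]) k
    tendsto_inv_natCast
  simp only [inv_inv] at h1
  have h2 := tendsto_pow_exp h1
  have h3 := ((ContinuousLinearMap.apply ℝ V e).continuous.tendsto _).comp h2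
  rw [e1] at h3
  refine he.le_of_tendsto h3 tendsto_const_nhds ?_
  filter_upwards [eventually_gt_atTop ⌈‖k‖⌉₊] with n hn
  have hn1 : ‖k‖ < n := Nat.lt_of_ceil_lt hn
  have hn0 : (0 : ℝ) < n := (norm_nonneg k).trans_lt hn1
  have d1 : ‖k‖ / n < 1 := by rwa [div_lt_one hn0]
  have d0 : 0 ≤ ‖k‖ / n := by positivity
  have d2 : ‖(n : ℝ)⁻¹ • k‖ = ‖k‖ / n := by
    rw [norm_smul, Real.norm_of_nonneg (by positivity)]; field_simp
  have l1 := he.neg_le_smul d2.le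
  have l2 := he.le_smul d2.le
  obtain ⟨y, hy, hy1, hy2, hy3⟩ := hS.exists_pow he (unit_add_mem he (d2.le.trans_lt d1)) d0 d1
    (by linear_combination (norm := (apply le_of_eq; module)) l1)
    (by linear_combination (norm := (apply le_of_eq; module)) l2) n
  have hr : (1 + ‖k‖ / n) ^ n ≤ Real.exp ‖k‖ := by
    calc (1 + ‖k‖ / n) ^ n ≤ (Real.exp (‖k‖ / n)) ^ n := by
          gcongr; linarith [Real.add_one_le_exp (‖k‖ / n)]
      _ = Real.exp ‖k‖ := by rw [← Real.exp_nat_mul]; congr 1; field_simp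
  have he0 := unitCone.nonneg he (unitCone.unit_mem (e := e))
  have hy4 : y ≤ Real.exp ‖k‖ • e := hy3.trans (smul_le_smul_of_nonneg_right hr he0)
  have hy5 := (hS.S_le_iff hy (Real.exp_pos _)).1 hy4
  have hy6 := (hS.isPosInv he (hS.mem hy)).mono hy5
  rw [map_smul, hS.euler (hS.mem hy), hS.invol y hy, hy1] at hy6
  refine hy6.trans ?_
  rw [e2, mul_smul]
  exact smul_le_smul_of_nonneg_left hy4 (Real.exp_pos _).le

end IsGaugeInv

end DerivativeProduct

section Derivations

open Asymptotics Filter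

variable {V : Type*} [NormedAddCommGroup V] [NormedSpace ℝ V]

theorem tendsto_smul_commutator_sub_one {p q b c : ℕ → V →L[ℝ] V} {X Y : V →L[ℝ] V} {s : ℕ → ℝ}
    (hp : Tendsto (fun n => (s n)⁻¹ • (p n - 1)) atTop (𝓝 X))
    (hq : Tendsto (fun n => (s n)⁻¹ • (q n - 1)) atTop (𝓝 Y))
    (hb : Tendsto b atTop (𝓝 1)) (hc : Tendsto c atTop (𝓝 1))
    (h : ∀ᶠ n in atTop, q n * p n * b n * c n = 1) (hs : ∀ n : ℕ, (s n)⁻¹ * (s n)⁻¹ = n) :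
    Tendsto (fun n : ℕ => (n : ℝ) • (p n * q n * b n * c n - 1)) atTop (𝓝 (X * Y - Y * X)) := by
  have h1 := (((hp.mul hq).sub (hq.mul hp)).mul hb).mul hc
  rw [mul_one, mul_one] at h1
  refine h1.congr' ?_
  filter_upwards [h] with n hn
  rw [smul_mul_smul_comm, smul_mul_smul_comm, hs n, ← smul_sub, smul_mul_assoc, smul_mul_assoc]
  nth_rewrite 5 [← hn]
  congr 1
  noncomm_ring

variable [PartialOrder V] [IsOrderedAddMonoid V] [IsOrderedModule ℝ V] {e : V}

theorem IsPosInv.pow {g h : V →L[ℝ] V} (H : IsPosInv g h) (n : ℕ) : IsPosInv (g ^ n) (h ^ n) := by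
  induction n with
  | zero => exact ⟨by simp, by simp, by simp, by simp⟩
  | succ n ih => rw [pow_succ g, pow_succ' h]; exact ih.mul H

namespace IsGaugeInv

variable {S : V → V} {B : V → V →L[ℝ] V} {M : V →L[ℝ] V →L[ℝ] V} [CompleteSpace V]

theorem exists_exp_approx (hS : IsGaugeInv e S B) (he : IsNormUnit e)
    (hM : HasFDerivAt B (-((2 : ℝ) • M)) e) (a b : V) :
    ∃ g h k : ℕ → V →L[ℝ] V, Tendsto g atTop (𝓝 (NormedSpace.exp (M a * M b - M b * M a))) ∧
      Tendsto k atTop (𝓝 (NormedSpace.exp (M a * M b - M b * M a))) ∧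
      ∀ᶠ n in atTop, IsPosInv (g n) (h n) ∧ ∀ z ∈ unitCone e, S (g n z) = k n (S z) := by
  set c := (1 / 4 : ℝ) • a with hc
  set s : ℕ → ℝ := fun n => (√(n : ℝ))⁻¹ with hs
  have hs1 : Tendsto s atTop (𝓝[>] 0) := by
    have h0 : Tendsto s atTop (𝓝 0) :=
      (Real.tendsto_sqrt_atTop.comp tendsto_natCast_atTop_atTop).inv_tendsto_atTop
    refine tendsto_nhdsWithin_iff.2 ⟨h0, ?_⟩
    filter_upwards [eventually_gt_atTop 0] with n hn
    have : (0 : ℝ) < n := by exact_mod_cast hn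
    simp only [hs, Set.mem_Ioi]
    positivity
  have hs2 : ∀ n : ℕ, (s n)⁻¹ * (s n)⁻¹ = n := fun n => by
    simp only [hs, inv_inv]; exact Real.mul_self_sqrt (Nat.cast_nonneg n)
  have l1 : ∀ d : V, Tendsto (fun n => e + s n • d) atTop (𝓝 e) := fun d => by
    have : Continuous (fun t : ℝ => e + t • d) := by fun_prop
    have h0 := (this.tendsto 0).comp (hs1.mono_right nhdsWithin_le_nhds)
    simpa [Function.comp_def] using h0
  have hP := hS.hasFDerivAt_P hM
  have P1 : B (S e) = 1 := by rw [hS.map_unit, hS.B_unit]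
  have tB : ∀ d : V, Tendsto (fun n => B (e + s n • d)) atTop (𝓝 1) := fun d => by
    have := hM.continuousAt.tendsto.comp (l1 d); rwa [hS.B_unit] at this
  have tP : ∀ d : V, Tendsto (fun n => B (S (e + s n • d))) atTop (𝓝 1) := fun d => by
    have := hP.continuousAt.tendsto.comp (l1 d); rwa [P1] at this
  have ev : ∀ d : V, ∀ᶠ n in atTop, e + s n • d ∈ unitCone e := fun d =>
    (l1 d) (unitCone.mem_nhds he unitCone.unit_mem)
  have E1 : M a * M b - M b * M a = ((2 : ℝ) • M) c * ((2 : ℝ) • M) b -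
      ((2 : ℝ) • M) b * ((2 : ℝ) • M) c := by
    simp only [hc, smul_apply, map_smul, smul_mul_assoc, mul_smul_comm]
    module
  have E2 : M a * M b - M b * M a = (-((2 : ℝ) • M)) c * (-((2 : ℝ) • M)) b -
      (-((2 : ℝ) • M)) b * (-((2 : ℝ) • M)) c := by
    simp only [hc, smul_apply, map_smul, smul_mul_assoc, mul_smul_comm, neg_apply, neg_mul_neg]
    module
  have T1 := tendsto_smul_commutator_sub_one (tendsto_slope_line hP P1 c hs1)
    (tendsto_slope_line hP P1 b hs1) (tB c) (tB b) (by
      filter_upwards [ev c, ev b] with n h1 h2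
      rw [mul_assoc (B (S (e + s n • b))), (hS.isPosInv he h1).mul_eq', mul_one,
        (hS.isPosInv he h2).mul_eq']) hs2
  have T2 := tendsto_smul_commutator_sub_one (tendsto_slope_line hM hS.B_unit c hs1)
    (tendsto_slope_line hM hS.B_unit b hs1) (tP c) (tP b) (by
      filter_upwards [ev c, ev b] with n h1 h2
      rw [mul_assoc (B (e + s n • b)), (hS.isPosInv he h1).mul_eq, mul_one,
        (hS.isPosInv he h2).mul_eq]) hs2
  rw [← E1] at T1
  rw [← E2] at T2
  refine ⟨_, fun n => (B (S (e + s n • b)) * (B (S (e + s n • c)) * (B (e + s n • b) *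
    B (e + s n • c)))) ^ n, _, tendsto_pow_exp T1, tendsto_pow_exp T2, ?_⟩
  filter_upwards [ev c, ev b] with n h1 h2
  have i1 := hS.isPosInv he h1
  have i2 := hS.isPosInv he h2
  have i3 := ((i1.symm.mul i2.symm).mul i1).mul i2
  refine ⟨i3.pow n, fun z hz => ?_⟩
  have key : ∀ z ∈ unitCone e, S ((B (S (e + s n • c)) * B (S (e + s n • b)) * B (e + s n • c) *
      B (e + s n • b)) z) = (B (e + s n • c) * B (e + s n • b) * B (S (e + s n • c)) *
      B (S (e + s n • b))) (S z) := fun z hz => by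
    simp only [mul_apply_eq_comp]
    rw [hS.S_B he (hS.mem h1) (i2.symm.mem he (i1.mem he (i2.mem he hz))),
      hS.S_B he (hS.mem h2) (i1.mem he (i2.mem he hz)), hS.S_B he h1 (i2.mem he hz),
      hS.S_B he h2 hz, hS.invol _ h1, hS.invol _ h2]
  have step : ∀ m : ℕ, S (((B (S (e + s n • c)) * B (S (e + s n • b)) * B (e + s n • c) *
      B (e + s n • b)) ^ m) z) = ((B (e + s n • c) * B (e + s n • b) * B (S (e + s n • c)) *
      B (S (e + s n • b))) ^ m) (S z) := fun m => by
    induction m with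
    | zero => simp
    | succ m ih =>
      rw [pow_succ', pow_succ', mul_apply_eq_comp, key _ ((i3.pow m).mem he hz), ih]
      rfl
  exact step n

theorem exp_commutator_nonneg (hS : IsGaugeInv e S B) (he : IsNormUnit e)
    (hM : HasFDerivAt B (-((2 : ℝ) • M)) e) (a b : V) {x : V} (hx : 0 ≤ x) :
    0 ≤ NormedSpace.exp (M a * M b - M b * M a) x := by
  obtain ⟨g, h, k, h1, -, h3⟩ := hS.exists_exp_approx he hM a b
  refine he.nonneg_of_tendsto (((ContinuousLinearMap.apply ℝ V x).continuous.tendsto _).comp h1) ?_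
  filter_upwards [h3] with n hn using hn.1.nonneg x hx

theorem isPosInv_exp_commutator (hS : IsGaugeInv e S B) (he : IsNormUnit e)
    (hM : HasFDerivAt B (-((2 : ℝ) • M)) e) (a b : V) :
    IsPosInv (NormedSpace.exp (M a * M b - M b * M a))
      (NormedSpace.exp (-(M a * M b - M b * M a))) := by
  let _ : NormedAlgebra ℚ (V →L[ℝ] V) := NormedAlgebra.restrictScalars ℚ ℝ _
  have h1 := NormedSpace.exp_add_of_commute (Commute.neg_right (Commute.refl (M a * M b - M b * M a)))
  have h2 := NormedSpace.exp_add_of_commute (Commute.neg_left (Commute.refl (M a * M b - M b * M a)))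
  rw [add_neg_cancel, NormedSpace.exp_zero] at h1
  rw [neg_add_cancel, NormedSpace.exp_zero] at h2
  refine ⟨h1.symm, h2.symm, fun x hx => hS.exp_commutator_nonneg he hM a b hx, fun x hx => ?_⟩
  rw [neg_sub]
  exact hS.exp_commutator_nonneg he hM b a hx

theorem S_exp_commutator (hS : IsGaugeInv e S B) (he : IsNormUnit e)
    (hM : HasFDerivAt B (-((2 : ℝ) • M)) e) (a b : V) {z : V} (hz : z ∈ unitCone e) :
    S (NormedSpace.exp (M a * M b - M b * M a) z) =
      NormedSpace.exp (M a * M b - M b * M a) (S z) := by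
  obtain ⟨g, h, k, h1, h2, h3⟩ := hS.exists_exp_approx he hM a b
  have c1 := hS.continuousAt_S ((hS.isPosInv_exp_commutator he hM a b).mem he hz)
  have t1 := c1.tendsto.comp (((ContinuousLinearMap.apply ℝ V z).continuous.tendsto _).comp h1)
  have t2 := ((ContinuousLinearMap.apply ℝ V (S z)).continuous.tendsto _).comp h2
  refine tendsto_nhds_unique (t1.congr' ?_) t2
  filter_upwards [h3] with n hn using hn.2 z hz

theorem exp_commutator_unit (hS : IsGaugeInv e S B) (he : IsNormUnit e)
    (hM : HasFDerivAt B (-((2 : ℝ) • M)) e) (a b : V) :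
    NormedSpace.exp (M a * M b - M b * M a) e = e := by
  have : (M a * M b - M b * M a) e = 0 := by
    simp only [sub_apply, mul_apply_eq_comp, hS.mul_unit he hM]
    rw [hS.mul_comm' he hM a b, sub_self]
  rw [exp_apply_of_apply_apply_eq_zero (by rw [this, map_zero]), this, add_zero]

theorem norm_exp_commutator_le (hS : IsGaugeInv e S B) (he : IsNormUnit e)
    (hM : HasFDerivAt B (-((2 : ℝ) • M)) e) (a b x : V) :
    ‖NormedSpace.exp (M a * M b - M b * M a) x‖ ≤ ‖x‖ := by
  have h1 := hS.isPosInv_exp_commutator he hM a b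
  have h2 := h1.mono (he.le_norm x)
  have h3 := h1.mono (he.neg_le_norm x)
  rw [map_smul, hS.exp_commutator_unit he hM] at h2
  rw [map_neg, map_smul, hS.exp_commutator_unit he hM] at h3
  exact he.norm_le_of_abs (norm_nonneg x) h3 h2

theorem exp_commutator_mul (hS : IsGaugeInv e S B) (he : IsNormUnit e)
    (hM : HasFDerivAt B (-((2 : ℝ) • M)) e) (a b h k : V) :
    M (NormedSpace.exp (M a * M b - M b * M a) h) (NormedSpace.exp (M a * M b - M b * M a) k) =
      NormedSpace.exp (M a * M b - M b * M a) (M h k) := by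
  set g := NormedSpace.exp (M a * M b - M b * M a) with hg
  have d1 := (hasDerivAt_line hM (g h)).clm_apply (hasDerivAt_const (0 : ℝ) (g k))
  have d2 := (hasDerivAt_line hM h).clm_apply (hasDerivAt_const (0 : ℝ) k)
  have d3 := g.hasFDerivAt.comp_hasDerivAt (0 : ℝ) d2
  have l : Tendsto (fun t : ℝ => e + t • h) (𝓝 0) (𝓝 e) := by
    have : Continuous (fun t : ℝ => e + t • h) := by fun_prop
    simpa using this.tendsto 0
  have d4 := d1.congr_of_eventuallyEq (f₁ := fun t : ℝ => g (B (e + t • h) k)) (by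
    filter_upwards [l (unitCone.mem_nhds he unitCone.unit_mem)] with t ht
    have := congrArg (fun T : V →L[ℝ] V => T k) (hS.B_intertwine he
      (hS.isPosInv_exp_commutator he hM a b) (fun y hy => hS.S_exp_commutator he hM a b hy) ht)
    simp only [mul_apply_eq_comp, map_add, map_smul, hS.exp_commutator_unit he hM] at this
    exact this.symm)
  have := d4.unique d3
  simp only [map_zero, add_zero, neg_apply, smul_apply, map_neg, map_smul, neg_inj] at this
  exact smul_right_injective V (two_ne_zero (α := ℝ)) this

/-- Commutators of multiplication operators are derivations. -/
theorem commutator_mul (hS : IsGaugeInv e S B) (he : IsNormUnit e)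
    (hM : HasFDerivAt B (-((2 : ℝ) • M)) e) (a b h k : V) :
    (M a * M b - M b * M a) (M h k) =
      M ((M a * M b - M b * M a) h) k + M h ((M a * M b - M b * M a) k) := by
  set X := M a * M b - M b * M a with hX
  have e1 : ∀ t : ℝ, M (t • a) * M b - M b * M (t • a) = t • X := fun t => by
    simp only [map_smul, smul_mul_assoc, mul_smul_comm, hX, smul_sub]
  have h1 : ∀ u : V, HasDerivAt (fun t : ℝ => NormedSpace.exp (t • X) u) (X u) 0 := fun u => by
    simpa using (hasDerivAt_exp_smul X).clm_apply (hasDerivAt_const (0 : ℝ) u)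
  have h2 := (M.hasFDerivAt.comp_hasDerivAt (0 : ℝ) (h1 h)).clm_apply (h1 k)
  have h3 := h2.congr_of_eventuallyEq (f₁ := fun t : ℝ => NormedSpace.exp (t • X) (M h k))
    (Eventually.of_forall fun t => by
      have := hS.exp_commutator_mul he hM (t • a) b h k
      rw [e1] at this
      exact this.symm)
  have := (h1 (M h k)).unique h3
  simpa using this

theorem commutator_eq_zero_of_sq (hS : IsGaugeInv e S B) (he : IsNormUnit e)
    (hM : HasFDerivAt B (-((2 : ℝ) • M)) e) (a b : V) {x : V}
    (hx : (M a * M b - M b * M a) ((M a * M b - M b * M a) x) = 0) :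
    (M a * M b - M b * M a) x = 0 := by
  set X := M a * M b - M b * M a with hX
  have h : ∀ t : ℝ, |t| * ‖X x‖ ≤ 2 * ‖x‖ := fun t => by
    have e1 : M (t • a) * M b - M b * M (t • a) = t • X := by
      simp only [map_smul, smul_mul_assoc, mul_smul_comm, hX, smul_sub]
    have h1 := hS.norm_exp_commutator_le he hM (t • a) b x
    rw [e1, exp_apply_of_apply_apply_eq_zero (by simp [hx])] at h1
    have h2 := norm_sub_le (x + (t • X) x) x
    rw [add_sub_cancel_left, smul_apply, norm_smul, Real.norm_eq_abs] at h2
    rw [smul_apply] at h1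
    linarith
  by_contra hne
  have hpos : 0 < ‖X x‖ := norm_pos_iff.2 hne
  have := h ((2 * ‖x‖ + 1) / ‖X x‖)
  rw [abs_of_nonneg (by positivity), div_mul_cancel₀ _ hpos.ne'] at this
  linarith

end IsGaugeInv

end Derivations

section JordanIdentity

variable {V : Type*} [NormedAddCommGroup V] [NormedSpace ℝ V]
  [PartialOrder V] [IsOrderedAddMonoid V] [IsOrderedModule ℝ V] {e : V}

namespace IsGaugeInv

variable {S : V → V} {B : V → V →L[ℝ] V} {M : V →L[ℝ] V →L[ℝ] V} [CompleteSpace V]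

theorem mul_mul_sq (hS : IsGaugeInv e S B) (he : IsNormUnit e)
    (hM : HasFDerivAt B (-((2 : ℝ) • M)) e) (x : V) :
    M x (M x (M x x)) = M (M x x) (M x x) := by
  have hc := hS.mul_comm' he hM
  have hD := hS.commutator_mul he hM
  obtain ⟨u, hu⟩ : ∃ u, u = M x x := ⟨_, rfl⟩
  obtain ⟨w, hw⟩ : ∃ w, w = M x (M x u) - M u u := ⟨_, rfl⟩
  have h1 := hD x u x (M u x)
  have h2 := hD x u u x
  have h3 := hD x u u u
  have h4 := hD x u x x
  have h5 := hD w x x x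
  have hDx : (M x * M u - M u * M x) x = w := by
    simp only [sub_apply, mul_apply_eq_comp, hw, ← hu, hc u x]
  have hDw : (M x * M u - M u * M x) w = 0 := by
    have e1 : (M x * M u - M u * M x) w =
        (M x * M u - M u * M x) (M x (M u x)) - (M x * M u - M u * M x) (M u u) := by
      rw [← map_sub, hc u x, ← hw]
    have e2 : (M x * M u - M u * M x) w = M x (M u w) - M u (M x w) := by
      simp only [sub_apply, mul_apply_eq_comp]
    rw [← hu, hDx, hc w x] at h4
    rw [h1, h2, h3, hDx, h4, e2] at e1
    simp only [sub_apply, mul_apply_eq_comp, ← hu] at h5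
    rw [hc (M x w + M x w) x, hc (M x w + M x w) u, hc u x] at e1
    rw [hc w x, hc w u, hc (M u w - M x (M x w)) x] at h5
    simp only [map_add, map_sub] at e1 h5
    have h6 : (3 : ℝ) • (M x (M u w) - M u (M x w)) = 0 := by
      linear_combination (norm := module) -e1 - h5
    rw [sub_apply, mul_apply_eq_comp, mul_apply_eq_comp]
    exact (smul_eq_zero.1 h6).resolve_left (by norm_num)
  have h6 := hS.commutator_eq_zero_of_sq he hM x u (x := x) (by rw [hDx, hDw])
  rw [hDx, hw] at h6
  rw [← hu]
  exact sub_eq_zero.1 h6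

theorem isJordanMul (hS : IsGaugeInv e S B) (he : IsNormUnit e)
    (hM : HasFDerivAt B (-((2 : ℝ) • M)) e) : IsJordanMul M e := by
  have hc := hS.mul_comm' he hM
  refine ⟨hc, fun x => by rw [hS.unit_mul he hM, one_apply_eq_self], fun x u => ?_⟩
  have hN := hS.mul_mul_sq he hM
  have n1 := hN (x + u)
  have n2 := hN (x - u)
  have n3 := hN (x + (2 : ℝ) • u)
  have n4 := hN (x - (2 : ℝ) • u)
  have h5 := hS.commutator_mul he hM x u x x
  rw [hc ((M x * M u - M u * M x) x) x] at h5
  simp only [map_add, map_sub, map_smul, add_apply, sub_apply, smul_apply, mul_apply_eq_comp, hc u x,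
    hc (M x u) (M x x), hc (M u u) (M x x), hc (M u u) (M x u)] at n1 n2 n3 n4 h5 ⊢
  rw [hc (M x x) u]
  have h6 : (4 : ℝ) • (M x (M u (M x x)) - M (M x x) (M x u)) = 0 := by
    linear_combination (norm := module) (8 / 12 : ℝ) • (n1 - n2) - (1 / 12 : ℝ) • (n3 - n4) + h5
  exact sub_eq_zero.1 ((smul_eq_zero.1 h6).resolve_left (by norm_num))

end IsGaugeInv

end JordanIdentity

section SquareNorm

open Filter

variable {V : Type*} [NormedAddCommGroup V] [NormedSpace ℝ V]
  [PartialOrder V] [IsOrderedAddMonoid V] [IsOrderedModule ℝ V] {e : V}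
  {M : V →L[ℝ] V →L[ℝ] V}

theorem exists_factorial_bound : ∃ K : ℝ, 0 < K ∧ ∀ m : ℕ, 0 < m →
    (m.factorial : ℝ) * ((m : ℝ) ^ m)⁻¹ * Real.exp m ≤ K * m := by
  refine ⟨Stirling.stirlingSeq 1 * 2, by rw [Stirling.stirlingSeq_one]; positivity, ?_⟩
  intro m hm
  obtain ⟨k, rfl⟩ : ∃ k, m = k + 1 := ⟨m - 1, by omega⟩
  have h1 := Stirling.stirlingSeq'_antitone (Nat.zero_le k)
  simp only [Function.comp_apply, Nat.succ_eq_add_one, zero_add] at h1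
  set m := k + 1
  have hm1 : (1 : ℝ) ≤ m := by exact_mod_cast hm
  have h2 : √(2 * (m : ℝ)) ≤ 2 * m := by
    rw [Real.sqrt_le_left (by positivity)]; nlinarith
  have h3 : (m.factorial : ℝ) * ((m : ℝ) ^ m)⁻¹ * Real.exp m =
      Stirling.stirlingSeq m * √(2 * (m : ℝ)) := by
    rw [Stirling.stirlingSeq, div_pow, ← Real.exp_nat_mul, mul_one]
    have : √(2 * (m : ℝ)) ≠ 0 := by positivity
    field_simp
  rw [h3, mul_assoc]
  refine mul_le_mul h1 h2 (by positivity) ?_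
  rw [Stirling.stirlingSeq_one]; positivity

theorem le_one_of_pow_two_pow_le {a K : ℝ} (h : ∀ k : ℕ, a ^ 2 ^ k ≤ K * 2 ^ k) : a ≤ 1 := by
  by_contra! ha
  have h1 := tendsto_pow_const_div_const_pow_of_one_lt 1 ha
  have h2 := (h1.comp (tendsto_pow_atTop_atTop_of_one_lt (one_lt_two (α := ℕ)))).const_mul K
  rw [mul_zero] at h2
  have h3 : (1 : ℝ) ≤ 0 := by
    refine ge_of_tendsto h2 (Eventually.of_forall fun k => ?_)
    have ha0 : 0 < a ^ 2 ^ k := by positivity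
    simp only [Function.comp_apply, pow_one]
    rw [mul_div_assoc', le_div_iff₀ ha0, one_mul]
    exact_mod_cast h k
  linarith

namespace IsJordanMul

theorem norm_sq_le_norm_mul_self (hM : IsJordanMul M e) (he : IsNormUnit e)
    (hsq : ∀ x, 0 ≤ M x x) (x : V) : ‖x‖ ^ 2 ≤ ‖M x x‖ := by
  have key : ∀ s : ℝ, 0 < s → ‖M x x‖ ≤ s ^ 2 → ‖x‖ ≤ s := by
    intro s hs hc
    have h1 := he.le_smul hc
    have h2 := hsq (s • e - x)
    have h3 := hsq (s • e + x)
    simp only [map_sub, map_add, map_smul, sub_apply, add_apply, smul_apply, hM.one_mul, hM.mul_one]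
      at h2 h3
    have h4 : (0 : V) ≤ (2 * s) • (s • e - x) := by
      linear_combination (norm := (apply le_of_eq; module)) h1 + h2
    have h5 : (0 : V) ≤ (2 * s) • (s • e + x) := by
      linear_combination (norm := (apply le_of_eq; module)) h1 + h3
    have h6 := nonneg_of_smul_nonneg' (by positivity) h4
    have h7 := nonneg_of_smul_nonneg' (by positivity) h5
    refine he.norm_le_of_abs hs.le ?_ (sub_nonneg.1 h6)
    linear_combination (norm := (apply le_of_eq; module)) h7
  have h2 : ‖x‖ ≤ √‖M x x‖ := by
    refine le_of_forall_pos_le_add fun ε hε => key _ (by positivity) ?_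
    have := Real.sq_sqrt (norm_nonneg (M x x))
    nlinarith [Real.sqrt_nonneg ‖M x x‖]
  calc ‖x‖ ^ 2 ≤ (√‖M x x‖) ^ 2 := by gcongr
    _ = _ := Real.sq_sqrt (norm_nonneg _)

theorem norm_pw_two_pow_le (hM : IsJordanMul M e) (he : IsNormUnit e)
    (hsq : ∀ x, 0 ≤ M x x) (z : V) (k : ℕ) : ‖M z z‖ ^ 2 ^ k ≤ ‖pw M e z (2 * 2 ^ k)‖ := by
  induction k with
  | zero =>
    have h1 := hM.pw_mul z 1 1
    rw [hM.pw_one] at h1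
    simp [h1]
  | succ k ih =>
    have h1 := hM.norm_sq_le_norm_mul_self he hsq (pw M e z (2 * 2 ^ k))
    rw [hM.pw_mul] at h1
    calc ‖M z z‖ ^ 2 ^ (k + 1) = (‖M z z‖ ^ 2 ^ k) ^ 2 := by rw [← pow_mul, pow_succ]
      _ ≤ ‖pw M e z (2 * 2 ^ k)‖ ^ 2 := by gcongr
      _ ≤ _ := by rwa [show 2 * 2 ^ (k + 1) = 2 * 2 ^ k + 2 * 2 ^ k by ring]

variable [CompleteSpace V]

theorem hasSum_exp_unit (z : V) (t : ℝ) :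
    HasSum (fun n : ℕ => ((n.factorial : ℝ)⁻¹ * t ^ n) • pw M e z n)
      (NormedSpace.exp (M (t • z)) e) := by
  have h1 := NormedSpace.exp_series_hasSum_exp' (𝕂 := ℝ) (M (t • z))
  have h2 := h1.mapL (ContinuousLinearMap.apply ℝ V e)
  have h3 : ∀ n : ℕ, ((M (t • z)) ^ n) e = t ^ n • pw M e z n := fun n => by
    induction n with
    | zero => simp [pw_zero]
    | succ n ih =>
      rw [pow_succ' (M (t • z)), mul_apply_eq_comp, ih, pw_succ, map_smul, map_smul, smul_apply]
      module
  refine h2.congr_fun fun n => ?_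
  rw [ContinuousLinearMap.apply_apply, smul_apply, h3, smul_smul]

theorem norm_pw_two_mul_le (hM : IsJordanMul M e) (he : IsNormUnit e)
    (hsq : ∀ x, 0 ≤ M x x) (hexp : ∀ h, NormedSpace.exp (M h) e ≤ Real.exp ‖h‖ • e)
    {z : V} (hz : ‖z‖ ≤ 1) {n : ℕ} (hn : 0 < n) :
    ‖pw M e z (2 * n)‖ ≤ ((2 * n).factorial : ℝ) * (((2 * n : ℕ) : ℝ) ^ (2 * n))⁻¹ *
      Real.exp (2 * n : ℕ) := by
  have := he.orderClosedTopology
  set m := 2 * n with hm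
  have hm0 : 0 < m := by omega
  have ev : ∀ k, 0 ≤ pw M e z (2 * k) := fun k => by
    rw [two_mul, ← hM.pw_mul]; exact hsq _
  have h1 := (hasSum_exp_unit (M := M) (e := e) z (m : ℝ)).add
    (hasSum_exp_unit (M := M) (e := e) z (-(m : ℝ)))
  have h2 := le_hasSum h1 m fun j _ => by
    rw [← add_smul, ← mul_add]
    rcases Nat.even_or_odd j with hj | hj
    · obtain ⟨k, rfl⟩ := hj
      rw [← two_mul]
      refine smul_nonneg ?_ (ev k)
      rw [pow_mul, pow_mul, neg_sq]; positivity
    · rw [hj.neg_pow, add_neg_cancel, mul_zero, zero_smul]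
  have hb : ∀ t : ℝ, |t| = m → NormedSpace.exp (M (t • z)) e ≤ Real.exp m • e := fun t ht => by
    refine (hexp _).trans (smul_le_smul_of_nonneg_right (Real.exp_le_exp.2 ?_) he.nonneg)
    rw [norm_smul, Real.norm_eq_abs, ht]
    exact mul_le_of_le_one_right (by positivity) hz
  have h3 := h2.trans (add_le_add (hb m (by simp)) (hb (-m) (by simp)))
  rw [(show Even m from ⟨n, by omega⟩).neg_pow] at h3
  have hc : 0 < ((m.factorial : ℝ)⁻¹ * (m : ℝ) ^ m) := by positivity
  have h4 : (0 : V) ≤ (2 : ℝ) • (Real.exp m • e - ((m.factorial : ℝ)⁻¹ * (m : ℝ) ^ m) • pw M e z m) := by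
    linear_combination (norm := (apply le_of_eq; module)) h3
  have h5 := sub_nonneg.1 (nonneg_of_smul_nonneg' two_pos h4)
  refine he.norm_le_of_nonneg (by positivity) (ev n) ?_
  have h6 := smul_le_smul_of_nonneg_left h5 (inv_nonneg.2 hc.le)
  rw [smul_smul, inv_mul_cancel₀ hc.ne', one_smul, smul_smul] at h6
  convert h6 using 2
  rw [mul_inv, inv_inv]

theorem norm_mul_self_le_one (hM : IsJordanMul M e) (he : IsNormUnit e)
    (hsq : ∀ x, 0 ≤ M x x) (hexp : ∀ h, NormedSpace.exp (M h) e ≤ Real.exp ‖h‖ • e)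
    {z : V} (hz : ‖z‖ ≤ 1) : ‖M z z‖ ≤ 1 := by
  obtain ⟨K, -, hK⟩ := exists_factorial_bound
  refine le_one_of_pow_two_pow_le (K := K * 2) fun k => ?_
  refine (hM.norm_pw_two_pow_le he hsq z k).trans ((hM.norm_pw_two_mul_le he hsq hexp hz
    (by positivity)).trans ((hK _ (by positivity)).trans (le_of_eq ?_)))
  push_cast; ring

theorem isJBMul (hM : IsJordanMul M e) (he : IsNormUnit e)
    (hsq : ∀ x, 0 ≤ M x x) (hexp : ∀ h, NormedSpace.exp (M h) e ≤ Real.exp ‖h‖ • e) :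
    IsJBMul M e := by
  have h1 : ∀ z : V, ‖z‖ ≤ 1 → M z z ≤ e := fun z hz => by
    simpa using he.le_smul (hM.norm_mul_self_le_one he hsq hexp hz)
  have h2 : ∀ x y : V, ‖x‖ ≤ 1 → ‖y‖ ≤ 1 → ‖M x y‖ ≤ 1 := by
    intro x y hx hy
    have hu : ‖(1 / 2 : ℝ) • (x + y)‖ ≤ 1 := by
      rw [norm_smul, Real.norm_of_nonneg (by norm_num)]; linarith [norm_add_le x y]
    have hv : ‖(1 / 2 : ℝ) • (x - y)‖ ≤ 1 := by
      rw [norm_smul, Real.norm_of_nonneg (by norm_num)]; linarith [norm_sub_le x y]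
    have e1 : M x y = M ((1 / 2 : ℝ) • (x + y)) ((1 / 2 : ℝ) • (x + y)) -
        M ((1 / 2 : ℝ) • (x - y)) ((1 / 2 : ℝ) • (x - y)) := by
      simp only [map_smul, map_add, map_sub, smul_apply, add_apply, sub_apply, hM.comm y x]
      module
    rw [e1]
    refine he.norm_le_of_abs zero_le_one ?_ ?_
    · rw [one_smul]
      linear_combination (norm := (apply le_of_eq; module)) h1 _ hv + hsq ((1 / 2 : ℝ) • (x + y))
    · rw [one_smul]
      linear_combination (norm := (apply le_of_eq; module)) h1 _ hu + hsq ((1 / 2 : ℝ) • (x - y))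
  refine ⟨hM, fun x y => ?_, hsq⟩
  rcases eq_or_ne x 0 with rfl | hx
  · simp
  rcases eq_or_ne y 0 with rfl | hy
  · simp
  have hx' := norm_pos_iff.2 hx
  have hy' := norm_pos_iff.2 hy
  have h3 := h2 (‖x‖⁻¹ • x) (‖y‖⁻¹ • y) (by rw [norm_smul, norm_inv, norm_norm, inv_mul_cancel₀ hx'.ne'])
    (by rw [norm_smul, norm_inv, norm_norm, inv_mul_cancel₀ hy'.ne'])
  simp only [map_smul, smul_apply, norm_smul, norm_inv, norm_norm] at h3
  field_simp at h3
  linarith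

end IsJordanMul

end SquareNorm

section SquareRoot

open Filter Polynomial

variable {V : Type*} [NormedAddCommGroup V] [NormedSpace ℝ V]

/-- Evaluation of a polynomial at `z` with respect to the product `M`. -/
noncomputable def jordanEval (M : V →L[ℝ] V →L[ℝ] V) (e z : V) : ℝ[X] →ₗ[ℝ] V :=
  Polynomial.lsum fun n => LinearMap.toSpanSingleton ℝ V (IsJordanMul.pw M e z n)

/-- The iterates of `q ↦ (X + q²) / 2`, converging to `1 - √(1 - X)`. -/
noncomputable def sqrtPoly : ℕ → ℝ[X]
  | 0 => 0
  | n + 1 => C (1 / 2) * (X + sqrtPoly n * sqrtPoly n)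

theorem coeff_mul_nonneg {p q : ℝ[X]} (hp : ∀ k, 0 ≤ p.coeff k) (hq : ∀ k, 0 ≤ q.coeff k) (k : ℕ) :
    0 ≤ (p * q).coeff k := by
  rw [coeff_mul]
  exact Finset.sum_nonneg fun x _ => mul_nonneg (hp _) (hq _)

theorem coeff_sqrtPoly_nonneg (n k : ℕ) : 0 ≤ (sqrtPoly n).coeff k := by
  induction n generalizing k with
  | zero => simp [sqrtPoly]
  | succ n ih =>
    rw [sqrtPoly, coeff_C_mul, coeff_add, coeff_X]
    have := coeff_mul_nonneg ih ih k
    split_ifs <;> linarith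

theorem coeff_sqrtPoly_sub_nonneg (n k : ℕ) : 0 ≤ (sqrtPoly (n + 1) - sqrtPoly n).coeff k := by
  induction n generalizing k with
  | zero => simpa [sqrtPoly] using coeff_sqrtPoly_nonneg 1 k
  | succ n ih =>
    have e1 : sqrtPoly (n + 2) - sqrtPoly (n + 1) =
        C (1 / 2) * ((sqrtPoly (n + 1) + sqrtPoly n) * (sqrtPoly (n + 1) - sqrtPoly n)) := by
      rw [sqrtPoly]; nth_rewrite 3 [sqrtPoly]; ring
    rw [e1, coeff_C_mul]
    refine mul_nonneg (by norm_num) (coeff_mul_nonneg (fun j => ?_) ih k)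
    rw [coeff_add]
    exact add_nonneg (coeff_sqrtPoly_nonneg _ j) (coeff_sqrtPoly_nonneg _ j)

theorem eval_one_sqrtPoly_mem (n : ℕ) : 0 ≤ (sqrtPoly n).eval 1 ∧ (sqrtPoly n).eval 1 ≤ 1 := by
  induction n with
  | zero => simp [sqrtPoly]
  | succ n ih =>
    simp only [sqrtPoly, eval_mul, eval_C, eval_add, eval_X]
    constructor <;> nlinarith

variable [PartialOrder V] [IsOrderedAddMonoid V] [IsOrderedModule ℝ V] {e : V}
  {M : V →L[ℝ] V →L[ℝ] V}

theorem jordanEval_monomial (z : V) (n : ℕ) (a : ℝ) :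
    jordanEval M e z (monomial n a) = a • IsJordanMul.pw M e z n := by
  simp [jordanEval, lsum_apply]

theorem jordanEval_X (hM : IsJordanMul M e) (z : V) : jordanEval M e z X = z := by
  rw [← monomial_one_one_eq_X, jordanEval_monomial, hM.pw_one, one_smul]

theorem jordanEval_mul (hM : IsJordanMul M e) (z : V) (p q : ℝ[X]) :
    jordanEval M e z (p * q) = M (jordanEval M e z p) (jordanEval M e z q) := by
  induction p using Polynomial.induction_on' with
  | add p₁ p₂ h1 h2 => rw [add_mul, map_add, h1, h2, map_add, map_add, add_apply]
  | monomial m a =>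
    induction q using Polynomial.induction_on' with
    | add q₁ q₂ h1 h2 => rw [mul_add, map_add, h1, h2, map_add, map_add]
    | monomial n b =>
      simp only [monomial_mul_monomial, jordanEval_monomial, map_smul, smul_apply, hM.pw_mul,
        smul_smul]
      rw [mul_comm]

namespace IsJBMul

theorem norm_jordanEval_le (h : IsJBMul M e) (he : IsNormUnit e) {z : V} (hz : ‖z‖ ≤ 1) {p : ℝ[X]}
    (hp : ∀ k, 0 ≤ p.coeff k) : ‖jordanEval M e z p‖ ≤ p.eval 1 := by
  rw [jordanEval, lsum_apply, Polynomial.sum, eval_eq_sum, Polynomial.sum]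
  refine (norm_sum_le _ _).trans (Finset.sum_le_sum fun k _ => ?_)
  rw [LinearMap.toSpanSingleton_apply, norm_smul, Real.norm_of_nonneg (hp k)]
  refine mul_le_mul_of_nonneg_left ?_ (hp k)
  rw [one_pow]
  exact (h.pw_norm_le he z k).trans (pow_le_one₀ (norm_nonneg _) hz)

theorem exists_sq_eq_unit_sub [CompleteSpace V] (h : IsJBMul M e) (he : IsNormUnit e) {z : V}
    (hz : ‖z‖ ≤ 1) : ∃ x, M x x = e - z := by
  set w : ℕ → V := fun n => jordanEval M e z (sqrtPoly n) with hw
  set d : ℕ → ℝ := fun n => (sqrtPoly (n + 1)).eval 1 - (sqrtPoly n).eval 1 with hd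
  have h1 : ∀ n, ‖w (n + 1) - w n‖ ≤ d n := fun n => by
    have := h.norm_jordanEval_le he hz (coeff_sqrtPoly_sub_nonneg n)
    rwa [map_sub, eval_sub] at this
  have h2 : Summable d := by
    refine summable_of_sum_range_le (c := 1) (fun n => (norm_nonneg _).trans (h1 n)) fun n => ?_
    rw [Finset.sum_range_sub (fun n => (sqrtPoly n).eval 1)]
    linarith [(eval_one_sqrtPoly_mem n).2, (eval_one_sqrtPoly_mem 0).1]
  have hcs : CauchySeq w := cauchySeq_of_dist_le_of_summable d
    (fun n => by rw [dist_comm, dist_eq_norm]; exact h1 n) h2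
  obtain ⟨q, hq⟩ := cauchySeq_tendsto_of_complete hcs
  have h3 : ∀ n, w (n + 1) = (1 / 2 : ℝ) • (z + M (w n) (w n)) := fun n => by
    simp only [hw]
    rw [sqrtPoly, ← smul_eq_C_mul, map_smul, map_add, jordanEval_mul h.toIsJordanMul,
      jordanEval_X h.toIsJordanMul]
  have h4 : Tendsto (fun n => (1 / 2 : ℝ) • (z + M (w n) (w n))) atTop
      (𝓝 ((1 / 2 : ℝ) • (z + M q q))) := by
    have : Continuous (fun v : V => (1 / 2 : ℝ) • (z + M v v)) := by fun_prop
    exact (this.tendsto q).comp hq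
  have h5 : q = (1 / 2 : ℝ) • (z + M q q) := by
    refine tendsto_nhds_unique ((tendsto_add_atTop_iff_nat 1).2 hq) ?_
    simpa only [h3] using h4
  refine ⟨e - q, ?_⟩
  simp only [map_sub, sub_apply, h.one_mul, h.mul_one]
  linear_combination (norm := module) (-2 : ℝ) • h5

theorem exists_sq_eq [CompleteSpace V] (h : IsJBMul M e) (he : IsNormUnit e) {y : V}
    (hy : 0 ≤ y) : ∃ x, M x x = y := by
  rcases eq_or_ne y 0 with rfl | hy0
  · exact ⟨0, by simp⟩
  have hr := norm_pos_iff.2 hy0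
  have h1 : 0 ≤ ‖y‖⁻¹ • y := smul_nonneg (by positivity) hy
  have h2 : ‖y‖⁻¹ • y ≤ e := by
    have := he.le_smul (x := ‖y‖⁻¹ • y) (r := 1) (by
      rw [norm_smul, norm_inv, norm_norm, inv_mul_cancel₀ hr.ne'])
    rwa [one_smul] at this
  obtain ⟨x, hx⟩ := h.exists_sq_eq_unit_sub he (z := e - ‖y‖⁻¹ • y) (by
    refine he.norm_le_of_nonneg zero_le_one (sub_nonneg.2 h2) ?_
    rw [one_smul]; exact sub_le_self e h1)
  refine ⟨√‖y‖ • x, ?_⟩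
  rw [map_smul, map_smul, smul_apply, smul_smul, Real.mul_self_sqrt hr.le, hx, sub_sub_cancel,
    smul_smul, mul_inv_cancel₀ hr.ne', one_smul]

end IsJBMul

end SquareRoot

section OrderUnitSpace

variable {V : Type*} [NormedAddCommGroup V] [NormedSpace ℝ V]

theorem IsNormUnit.exists_isJBMul_iff [CompleteSpace V] [PartialOrder V] [IsOrderedAddMonoid V]
    [IsOrderedModule ℝ V] {e : V} (he : IsNormUnit e) :
    (∃ M, IsJBMul M e) ↔ ∃ f, IsGaugeRev e f := by
  constructor
  · rintro ⟨M, hM⟩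
    obtain ⟨f, h1, h2, h3⟩ := hM.exists_gaugeReversing he
    exact ⟨f, h1, h2, h3⟩
  · rintro ⟨f, hf⟩
    obtain ⟨S, B, hS⟩ := hf.exists_isGaugeInv he
    obtain ⟨M, hM⟩ := hS.exists_hasFDerivAt_B he
    exact ⟨M, (hS.isJordanMul he hM).isJBMul he (hS.sq_nonneg' he hM)
      (hS.exp_apply_unit_le he hM)⟩

namespace IsOrderUnitSpace

variable {P : Set V} {v : V}

theorem zero_mem (hV : IsOrderUnitSpace V P v) : (0 : V) ∈ P := by
  simpa using hV.smul_mem 0 le_rfl v hV.unit_mem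

/-- The partial order of an order unit space. -/
abbrev toPartialOrder (hV : IsOrderUnitSpace V P v) : PartialOrder V where
  le x y := y - x ∈ P
  le_refl x := by simpa using hV.zero_mem
  le_trans x y z hxy hyz := by simpa using hV.add_mem _ hyz _ hxy
  le_antisymm x y hxy hyx :=
    (sub_eq_zero.1 (hV.proper _ hxy (by rwa [neg_sub]))).symm

theorem mem_of_forall_pos (hV : IsOrderUnitSpace V P v) {x : V}
    (h : ∀ r : ℝ, 0 < r → x + r • v ∈ P) : x ∈ P := by
  rw [← neg_neg x]
  refine hV.archimedean (-x) v fun r hr => ?_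
  rcases hr.eq_or_lt with rfl | hr
  · simpa using hV.unit_mem
  · have := hV.smul_mem r hr.le _ (h r⁻¹ (inv_pos.2 hr))
    rw [smul_add, smul_smul, mul_inv_cancel₀ hr.ne', one_smul] at this
    convert this using 1
    module

theorem norm_smul_unit_sub_mem (hV : IsOrderUnitSpace V P v) (x : V) : ‖x‖ • v - x ∈ P := by
  refine hV.mem_of_forall_pos fun r hr => ?_
  have hne : {r : ℝ | 0 ≤ r ∧ x + r • v ∈ P ∧ r • v - x ∈ P}.Nonempty := by
    obtain ⟨a, ha, hax⟩ := hV.unit_order x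
    obtain ⟨b, hb, hbx⟩ := hV.unit_order (-x)
    refine ⟨a + b, by positivity, ?_, ?_⟩
    · convert hV.add_mem _ hbx _ (hV.smul_mem a ha.le v hV.unit_mem) using 1
      module
    · convert hV.add_mem _ hax _ (hV.smul_mem b hb.le v hV.unit_mem) using 1
      module
  obtain ⟨s, ⟨-, -, hs⟩, hsr⟩ := exists_lt_of_csInf_lt hne
    (show sInf _ < ‖x‖ + r by rw [← hV.norm_eq]; linarith)
  convert hV.add_mem _ hs _ (hV.smul_mem (‖x‖ + r - s) (by linarith) v hV.unit_mem) using 1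
  module

theorem isOrderedAddMonoid (hV : IsOrderUnitSpace V P v) :
    letI := hV.toPartialOrder
    IsOrderedAddMonoid V :=
  let := hV.toPartialOrder
  { add_le_add_left := fun x y hxy z => by
      change y + z - (x + z) ∈ P
      rwa [add_sub_add_right_eq_sub] }

theorem isOrderedModule (hV : IsOrderUnitSpace V P v) :
    letI := hV.toPartialOrder
    IsOrderedModule ℝ V :=
  let := hV.toPartialOrder
  { smul_le_smul_of_nonneg_left := fun r hr x y hxy => by
      change r • y - r • x ∈ P
      rw [← smul_sub]
      exact hV.smul_mem r hr _ hxy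
    smul_le_smul_of_nonneg_right := fun x hx r s hrs => by
      change s • x - r • x ∈ P
      rw [← sub_smul]
      refine hV.smul_mem _ (sub_nonneg.2 hrs) _ ?_
      have : x - 0 ∈ P := hx
      rwa [sub_zero] at this }

theorem isNormUnit (hV : IsOrderUnitSpace V P v) :
    letI := hV.toPartialOrder
    IsNormUnit v :=
  let := hV.toPartialOrder
  { nonneg := by
      change v - 0 ∈ P
      rw [sub_zero]
      exact hV.unit_mem
    le_norm := hV.norm_smul_unit_sub_mem
    norm_le := fun x r hr h1 h2 => by
      rw [hV.norm_eq]
      refine csInf_le ⟨0, fun s hs => hs.1⟩ ⟨hr, ?_, h1⟩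
      have : r • v - -x ∈ P := h2
      rwa [sub_neg_eq_add, add_comm] at this
    arch := fun x h => by
      change 0 - x ∈ P
      refine hV.mem_of_forall_pos fun r hr => ?_
      have : r • v - x ∈ P := h r hr
      rwa [zero_sub, neg_add_eq_sub] }

theorem exists_isJBAlgebraStructure_iff [CompleteSpace V] (hV : IsOrderUnitSpace V P v) :
    letI := hV.toPartialOrder
    (∃ mul : V →ₗ[ℝ] V →ₗ[ℝ] V, IsJBAlgebraStructure P v mul) ↔
      ∃ M : V →L[ℝ] V →L[ℝ] V, IsJBMul M v := by
  let := hV.toPartialOrder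
  have := hV.isOrderedAddMonoid
  have := hV.isOrderedModule
  have he := hV.isNormUnit
  have hP : ∀ x : V, 0 ≤ x ↔ x ∈ P := fun x => by
    change x - 0 ∈ P ↔ _
    rw [sub_zero]
  constructor
  · rintro ⟨mul, hcomm, hone, hjordan, hnorm, -, -, hsq⟩
    refine ⟨LinearMap.mkContinuous₂ mul 1 fun x y => by simpa using hnorm x y, ?_⟩
    refine ⟨⟨hcomm, hone, fun x y => ?_⟩, hnorm, fun x => ?_⟩
    · simp only [LinearMap.mkContinuous₂_apply]
      rw [hcomm (mul x x) y, hjordan, hcomm (mul x y)]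
    · rw [hP, hsq]
      exact ⟨x, rfl⟩
  · rintro ⟨M, hM⟩
    refine ⟨LinearMap.mk₂ ℝ (fun x y => M x y) (by simp) (by simp) (by simp) (by simp), ?_⟩
    simp only [IsJBAlgebraStructure, LinearMap.mk₂_apply]
    refine ⟨hM.comm, hM.one_mul, fun x y => ?_, hM.norm_mul_le, fun x => le_antisymm ?_ ?_,
      fun x y => he.norm_mono (hM.sq_nonneg x) (le_add_of_nonneg_right (hM.sq_nonneg y)), ?_⟩
    · rw [hM.comm y, hM.jordan, hM.comm (M x y)]
    · rw [sq]
      exact hM.norm_mul_le x x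
    · exact hM.toIsJordanMul.norm_sq_le_norm_mul_self he hM.sq_nonneg x
    · ext y
      rw [← hP]
      exact ⟨hM.exists_sq_eq he, fun ⟨x, hx⟩ => hx ▸ hM.sq_nonneg x⟩

end IsOrderUnitSpace

end OrderUnitSpace

/-- A complete order unit space `(V, P, v)` carries a JB-algebra
structure with unit element `v` and cone of squares `P` if and only if there exists a
gauge-reversing bijection of its open cone onto itself. -/
theorem jbAlgebraStructure_iff_exists_gaugeReversing
    {V : Type*} [NormedAddCommGroup V] [NormedSpace ℝ V] [CompleteSpace V]
    (P : Set V) (v : V) (hV : IsOrderUnitSpace V P v) :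
    (∃ mul : V →ₗ[ℝ] V →ₗ[ℝ] V, IsJBAlgebraStructure P v mul) ↔
      ∃ Φ : V → V, GaugeReversing P v P v Φ := by
  let := hV.toPartialOrder
  have := hV.isOrderedAddMonoid
  have := hV.isOrderedModule
  rw [hV.exists_isJBAlgebraStructure_iff, hV.isNormUnit.exists_isJBMul_iff]
  exact ⟨fun ⟨f, hf⟩ => ⟨f, hf.bij, hf.map_smul, hf.le_iff⟩, fun ⟨f, h1, h2, h3⟩ => ⟨f, h1, h2, h3⟩⟩
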